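/- Let N ∈ ℕ. If u is a tempered distribution on ℝ^{2n+1} belonging to H^{−N}(ℝ^{2n+1}) and Pu ∈ H^r(ℝ^{2n+1}) for every r ∈ ℝ, then u ∈ C^∞(ℝ^{2n+1}). -/

import Mathlib

open MeasureTheory
open scoped ENNReal Real

noncomputable section

/-- `ℝ^n` with the Euclidean norm. -/
abbrev E (n : ℕ) : Type := EuclideanSpace ℝ (Fin n)
/-- `ℝ^{2n+1} = ℝ_t × ℝ^n_x × ℝ^n_v` with the Euclidean norm. -/
abbrev Z (n : ℕ) : Type := EuclideanSpace ℝ (Unit ⊕ Fin n ⊕ Fin n)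

variable {n : ℕ}

/-- the `t` (resp. dual `τ`) coordinate -/
def tC (ζ : Z n) : ℝ := ζ (Sum.inl ())
/-- the `x` (resp. dual `ξ`) coordinates -/
def xC (ζ : Z n) : E n := WithLp.toLp 2 (fun i => ζ (Sum.inr (Sum.inl i)))
/-- the `v` (resp. dual `η`) coordinates -/
def vC (ζ : Z n) : E n := WithLp.toLp 2 (fun i => ζ (Sum.inr (Sum.inr i)))

/-- the unit vector in the `t` direction -/
def eT : Z n := EuclideanSpace.single (Sum.inl ()) 1
/-- the unit vector in the `xᵢ` direction -/
def eX (i : Fin n) : Z n := EuclideanSpace.single (Sum.inr (Sum.inl i)) 1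

/-- the symbol `F(η) = |η|^{2σ} w(η) + |η|² (1 - w(η))` -/
def Fsym (σ : ℝ) (w : E n → ℝ) (η : E n) : ℝ :=
  ‖η‖ ^ (2 * σ) * w η + ‖η‖ ^ 2 * (1 - w η)

/-- A tempered distribution `u` with function Fourier transform `h = 𝓕u` is
encoded through the pairing `⟨u, ψ⟩ = ∫ h(ζ) (𝓕⁻¹ψ)(ζ) dζ` with test
functions `ψ` (bilinear Parseval formula). -/
def pairing (h : Z n → ℂ) (ψ : Z n → ℂ) : ℂ :=
  ∫ ζ : Z n, h ζ * FourierTransformInv.fourierInv ψ ζ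

/-- the Fourier multiplier with symbol `F(-η)` (the transpose of `(-Δ̃_v)^σ`
for the bilinear pairing) -/
def fracLapNeg (σ : ℝ) (w : E n → ℝ) (g : Z n → ℂ) : Z n → ℂ :=
  FourierTransformInv.fourierInv (fun ζ => (Fsym σ w (-vC ζ) : ℂ) * FourierTransform.fourier g ζ)

/-- the transpose `P^t ψ = -∂_tψ - v·∂_xψ + (-Δ̃_v)^{σ,t}(a ψ)` of the operator
`P = ∂_t + v·∂_x + a(t,x,v)(-Δ̃_v)^σ`, so that `⟨Pu, ψ⟩ = ⟨u, P^tψ⟩` -/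
def Ptrans (σ : ℝ) (w : E n → ℝ) (a : Z n → ℝ) (ψ : Z n → ℂ) (z : Z n) : ℂ :=
  -fderiv ℝ ψ z eT - ∑ i : Fin n, (vC z i : ℂ) * fderiv ℝ ψ z (eX i)
    + fracLapNeg σ w (fun z' => (a z' : ℂ) * ψ z') z

/-- the tempered distribution with Fourier transform `h` belongs to `H^r`:
its Fourier transform is a function `G` with `⟨ζ⟩^r G ∈ L²`.  Here the
distribution is described by its pairings `L ψ` against Schwartz functions. -/
def IsHr (r : ℝ) (L : (Z n → ℂ) → ℂ) : Prop :=
  ∃ G : Z n → ℂ,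
    MemLp (fun ζ => (((1 + ‖ζ‖ ^ 2) ^ (r / 2) : ℝ) : ℂ) * G ζ) 2 volume ∧
    ∀ ψ : SchwartzMap (Z n) ℂ, L ⇑ψ = pairing G ⇑ψ

namespace KH
open SchwartzMap Function
open scoped FourierTransform LineDeriv ContDiff ComplexConjugate

/-- index type of coordinates -/
abbrev Ix (n : ℕ) : Type := Unit ⊕ Fin n ⊕ Fin n
/-- Schwartz space -/
abbrev Sch (n : ℕ) : Type := SchwartzMap (Z n) ℂ

/-- unit vector -/
def ej (j : Ix n) : Z n := EuclideanSpace.single j 1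

/-- bounded smooth functions with all bounded derivatives -/
def CB (b : Z n → ℂ) : Prop :=
  ContDiff ℝ ∞ b ∧ ∀ k : ℕ, ∃ C : ℝ, ∀ z, ‖iteratedFDeriv ℝ k b z‖ ≤ C

lemma CB.tg {b : Z n → ℂ} (hb : CB b) : b.HasTemperateGrowth := by
  refine ⟨hb.1, fun k => ?_⟩
  obtain ⟨C, hC⟩ := hb.2 k
  exact ⟨0, C, fun x => by simpa using hC x⟩

lemma CB.bdd {b : Z n → ℂ} (hb : CB b) : ∃ C : ℝ, 0 ≤ C ∧ ∀ z, ‖b z‖ ≤ C := by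
  obtain ⟨C, hC⟩ := hb.2 0
  refine ⟨C, (norm_nonneg _).trans (hC 0), fun z => ?_⟩
  simpa using hC z

lemma CB.lip {b : Z n → ℂ} (hb : CB b) : ∃ C : ℝ, 0 ≤ C ∧ ∀ z z', ‖b z - b z'‖ ≤ C * ‖z - z'‖ := by
  obtain ⟨C, hC⟩ := hb.2 1
  refine ⟨C, (norm_nonneg _).trans (hC 0), fun z z' => ?_⟩
  refine Convex.norm_image_sub_le_of_norm_fderiv_le (𝕜 := ℝ) (s := Set.univ) (fun x _ => ?_)
    (fun x _ => ?_) convex_univ (Set.mem_univ _) (Set.mem_univ _)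
  · exact (hb.1.differentiable (by simp)) x
  · have := hC x
    rwa [norm_iteratedFDeriv_one] at this

lemma CB.dir {b : Z n → ℂ} (hb : CB b) (c : ℂ) (m : Z n) : CB (fun z => c * fderiv ℝ b z m) := by
  set Λ : (Z n →L[ℝ] ℂ) →L[ℝ] ℂ :=
    (c • ContinuousLinearMap.id ℝ ℂ).comp (ContinuousLinearMap.apply ℝ ℂ m) with hΛ
  have e : (fun z => c * fderiv ℝ b z m) = Λ ∘ (fderiv ℝ b) := by
    funext z; simp [hΛ]
  have hd : ContDiff ℝ ∞ (fderiv ℝ b) := hb.1.fderiv_right (by simp)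
  rw [e]
  refine ⟨Λ.contDiff.comp hd, fun k => ?_⟩
  obtain ⟨C, hC⟩ := hb.2 (k+1)
  refine ⟨‖Λ‖ * C, fun z => ?_⟩
  refine (Λ.norm_iteratedFDeriv_comp_left hd.contDiffAt (n := k) (by exact_mod_cast le_top)).trans ?_
  have := hC z
  rw [← norm_iteratedFDeriv_fderiv] at this
  gcongr

lemma CB.shift {b : Z n → ℂ} (hb : CB b) (y : Z n) : CB (fun z => b (z - y)) := by
  refine ⟨hb.1.comp (contDiff_id.sub contDiff_const), fun k => ?_⟩
  obtain ⟨C, hC⟩ := hb.2 k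
  refine ⟨C, fun z => ?_⟩
  rw [iteratedFDeriv_comp_sub]
  exact hC _

lemma CB.sub {b c : Z n → ℂ} (hb : CB b) (hc : CB c) : CB (fun z => b z - c z) := by
  refine ⟨hb.1.sub hc.1, fun k => ?_⟩
  obtain ⟨C, hC⟩ := hb.2 k
  obtain ⟨D, hD⟩ := hc.2 k
  refine ⟨C + D, fun z => ?_⟩
  have : iteratedFDeriv ℝ k (fun z => b z - c z) z = iteratedFDeriv ℝ k b z - iteratedFDeriv ℝ k c z :=
    fun_iteratedFDeriv_sub_apply (hb.1.of_le (by exact_mod_cast le_top)).contDiffAt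
      (hc.1.of_le (by exact_mod_cast le_top)).contDiffAt
  rw [this]
  exact (norm_sub_le _ _).trans (add_le_add (hC z) (hD z))

/-- Fourier multiplier on Schwartz side: multiplication -/
abbrev mu (φ : Z n → ℂ) : Sch n →L[ℂ] Sch n := smulLeftCLM ℂ φ

lemma mu_apply {φ : Z n → ℂ} (hφ : φ.HasTemperateGrowth) (θ : Sch n) (z : Z n) :
    mu φ θ z = φ z * θ z := by
  simp [mu, smulLeftCLM_apply_apply hφ]

/-- conjugated multiplication operator `𝓕⁻¹ b 𝓕` -/
def Aop (b : Z n → ℂ) : Sch n →L[ℂ] Sch n :=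
  (FourierTransform.fourierInvCLM ℂ (Sch n)).comp
    ((mu b).comp (FourierTransform.fourierCLM ℂ (Sch n)))

lemma Aop_def (b : Z n → ℂ) (θ : Sch n) : Aop b θ = 𝓕⁻ (mu b (𝓕 θ)) := rfl

lemma Aop_sub_left {b c : Z n → ℂ} (hb : CB b) (hc : CB c) (φ : Sch n) :
    Aop (fun z => b z - c z) φ = Aop b φ - Aop c φ := by
  have : mu (fun z => b z - c z) (𝓕 φ) = mu b (𝓕 φ) - mu c (𝓕 φ) := by
    ext z
    rw [mu_apply (φ := fun z => b z - c z) (hb.tg.sub hc.tg)]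
    simp only [_root_.sub_apply]
    rw [mu_apply hb.tg, mu_apply hc.tg]
    ring
  rw [Aop_def, this]
  rw [sub_eq_add_neg, FourierTransform.fourierInv_add, ← neg_one_smul ℂ (mu c (𝓕 φ)),
    FourierTransform.fourierInv_smul, neg_one_smul, ← sub_eq_add_neg]; rfl

/-- coordinate function -/
def co (j : Ix n) (ζ : Z n) : ℂ := ((ζ j : ℝ) : ℂ)

lemma co_tg (j : Ix n) : (co (n := n) j).HasTemperateGrowth := by
  have : (co (n := n) j) = Complex.ofReal ∘ (EuclideanSpace.proj (𝕜 := ℝ) j) := by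
    funext; simp [co]
  rw [this]
  exact Function.Complex.hasTemperateGrowth_ofReal.comp (ContinuousLinearMap.hasTemperateGrowth _)

lemma mu_inner (j : Ix n) (θ : Sch n) :
    smulLeftCLM ℂ (inner ℝ · (ej j)) θ = mu (co j) θ := by
  ext z
  have : (inner ℝ · (ej j) : Z n → ℝ).HasTemperateGrowth := by fun_prop
  rw [smulLeftCLM_apply_apply this, mu_apply (co_tg j)]
  simp [ej, co, EuclideanSpace.inner_single_right]

/-- normalized derivative of a coefficient -/
def dj (j : Ix n) (b : Z n → ℂ) : Z n → ℂ := fun z => (-(2 * π * Complex.I)⁻¹) * fderiv ℝ b z (ej j)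

lemma CB.dj {b : Z n → ℂ} (hb : CB b) (j : Ix n) : CB (dj j b) := hb.dir _ _

lemma two_pi_I_ne : (2 * π * Complex.I : ℂ) ≠ 0 := Complex.two_pi_I_ne_zero

lemma dmul {b : Z n → ℂ} (hb : b.HasTemperateGrowth) (j : Ix n) (ψ : Sch n) (z : Z n) :
    (∂_{ej j} (mu b ψ) : Sch n) z = fderiv ℝ b z (ej j) * ψ z + b z * (∂_{ej j} ψ : Sch n) z := by
  rw [lineDerivOp_apply_eq_fderiv, lineDerivOp_apply_eq_fderiv]
  have : (⇑(mu b ψ) : Z n → ℂ) = fun z => b z * ψ z := by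
    funext z; exact mu_apply hb _ _
  rw [this, fderiv_fun_mul (hb.1.differentiable (by simp) z) (ψ.differentiable z)]
  simp; ring

lemma co_Aop {b : Z n → ℂ} (hb : CB b) (j : Ix n) (θ : Sch n) :
    mu (co j) (Aop b θ) = Aop b (mu (co j) θ) + Aop (dj j b) θ := by
  have h1 := fourierInv_lineDerivOp_eq (mu b (𝓕 θ)) (ej j)
  rw [mu_inner] at h1
  have h2 : (∂_{ej j} (mu b (𝓕 θ)) : Sch n) =
      (-(2 * π * Complex.I)) • (mu (dj j b) (𝓕 θ) + mu b (𝓕 (mu (co j) θ))) := by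
    ext z
    rw [dmul hb.tg, lineDerivOp_fourier_eq, mu_inner, FourierTransform.fourier_smul]
    simp [mu_apply hb.tg, mu_apply (hb.dj j).tg, dj]
    field_simp
    ring_nf
    simp
  rw [h2, FourierTransform.fourierInv_smul, FourierTransform.fourierInv_add] at h1
  have h3 := smul_right_injective (Sch n) (neg_ne_zero.mpr two_pi_I_ne) h1
  rw [Aop_def, ← h3, add_comm]; rfl

lemma Aop_deriv (b : Z n → ℂ) (hb : CB b) (j : Ix n) (θ : Sch n) :
    (∂_{ej j} (Aop b θ) : Sch n) = Aop b (∂_{ej j} θ) := by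
  rw [Aop_def, lineDerivOp_fourierInv_eq, mu_inner, Aop_def, fourier_lineDerivOp_eq, mu_inner]
  congr 1
  ext z
  simp [mu_apply hb.tg, mu_apply (co_tg j)]
  ring
end KH

namespace KH
open SchwartzMap Function
open scoped FourierTransform LineDeriv ContDiff ComplexConjugate

/-- square integrable -/
abbrev L2f (f : Z n → ℂ) : Prop := MemLp f 2 volume
/-- inner product of functions -/
def ip (f g : Z n → ℂ) : ℂ := ∫ ζ, conj (f ζ) * g ζ
/-- square of the norm -/
def nq (f : Z n → ℂ) : ℝ := ∫ ζ, ‖f ζ‖ ^ 2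
/-- the norm -/
def nr (f : Z n → ℂ) : ℝ := Real.sqrt (nq f)

lemma nq_nonneg (f : Z n → ℂ) : 0 ≤ nq f := integral_nonneg fun _ => by positivity
lemma nr_nonneg (f : Z n → ℂ) : 0 ≤ nr f := Real.sqrt_nonneg _
lemma nr_sq (f : Z n → ℂ) : nr f ^ 2 = nq f := Real.sq_sqrt (nq_nonneg f)

lemma L2f.sq {f : Z n → ℂ} (hf : L2f f) : Integrable (fun z => ‖f z‖ ^ 2) :=
  (memLp_two_iff_integrable_sq_norm hf.1).1 hf

lemma L2f.conj {f : Z n → ℂ} (hf : L2f f) : L2f (fun z => conj (f z)) := hf.star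

lemma L2f.ip_int {f g : Z n → ℂ} (hf : L2f f) (hg : L2f g) :
    Integrable (fun z => conj (f z) * g z) :=
  MemLp.integrable_mul (p := 2) (q := 2) hf.conj hg

lemma ip_toLp {f g : Z n → ℂ} (hf : L2f f) (hg : L2f g) :
    ip f g = inner ℂ (hf.toLp f) (hg.toLp g) := by
  rw [L2.inner_def, ip]
  refine integral_congr_ae ?_
  filter_upwards [hf.coeFn_toLp, hg.coeFn_toLp] with z h1 h2
  rw [h1, h2]; simp [mul_comm]

lemma ip_self (f : Z n → ℂ) : ip f f = (nq f : ℂ) := by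
  rw [ip, nq, ← integral_complex_ofReal]
  congr 1; funext z
  rw [Complex.conj_mul']; simp

lemma nr_toLp {f : Z n → ℂ} (hf : L2f f) : nr f = ‖hf.toLp f‖ := by
  rw [nr, Real.sqrt_eq_iff_mul_self_eq (nq_nonneg _) (norm_nonneg _)]
  have h1 := ip_toLp hf hf
  rw [ip_self, inner_self_eq_norm_sq_to_K] at h1
  have h2 : nq f = ‖hf.toLp f‖ ^ 2 := by
    have h3 := congrArg Complex.re h1
    rw [Complex.ofReal_re] at h3
    rw [h3, ← RCLike.ofReal_pow]; rfl
  rw [h2]; ring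

lemma ip_le {f g : Z n → ℂ} (hf : L2f f) (hg : L2f g) : ‖ip f g‖ ≤ nr f * nr g := by
  rw [ip_toLp hf hg, nr_toLp hf, nr_toLp hg]
  exact norm_inner_le_norm _ _

lemma nr_add_le {f g : Z n → ℂ} (hf : L2f f) (hg : L2f g) : nr (f + g) ≤ nr f + nr g := by
  rw [nr_toLp (hf.add hg), nr_toLp hf, nr_toLp hg, MemLp.toLp_add]
  exact norm_add_le _ _

lemma nr_mono {f g : Z n → ℂ} (hg : L2f g) (h : ∀ z, ‖f z‖ ≤ ‖g z‖) : nr f ≤ nr g := by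
  apply Real.sqrt_le_sqrt
  refine integral_mono_of_nonneg (Filter.Eventually.of_forall fun _ => by positivity) hg.sq
    (Filter.Eventually.of_forall fun z => ?_)
  have := h z
  simp only
  gcongr

lemma nq_le {f g : Z n → ℂ} (hg : L2f g) {C : ℝ} (hC : 0 ≤ C) (h : ∀ z, ‖f z‖ ≤ C * ‖g z‖) :
    nq f ≤ C ^ 2 * nq g := by
  rw [nq, nq, ← integral_const_mul]
  refine integral_mono_of_nonneg (Filter.Eventually.of_forall fun _ => by positivity)
    (hg.sq.const_mul _) (Filter.Eventually.of_forall fun z => ?_)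
  have := h z
  simp only
  rw [← mul_pow]
  gcongr

lemma nr_le {f g : Z n → ℂ} (hg : L2f g) {C : ℝ} (hC : 0 ≤ C) (h : ∀ z, ‖f z‖ ≤ C * ‖g z‖) :
    nr f ≤ C * nr g := by
  apply Real.sqrt_le_iff.2
  refine ⟨mul_nonneg hC (nr_nonneg _), ?_⟩
  rw [mul_pow, nr_sq]; exact nq_le hg hC h

lemma ip_add_left {f f' g : Z n → ℂ} (hf : L2f f) (hf' : L2f f') (hg : L2f g) :
    ip (fun z => f z + f' z) g = ip f g + ip f' g := by
  rw [ip, ip, ip, ← integral_add (hf.ip_int hg) (hf'.ip_int hg)]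
  congr 1; funext z; simp; ring

lemma ip_add_right {f g g' : Z n → ℂ} (hf : L2f f) (hg : L2f g) (hg' : L2f g') :
    ip f (fun z => g z + g' z) = ip f g + ip f g' := by
  rw [ip, ip, ip, ← integral_add (hf.ip_int hg) (hf.ip_int hg')]
  congr 1; funext z; ring

lemma ip_sub_right {f g g' : Z n → ℂ} (hf : L2f f) (hg : L2f g) (hg' : L2f g') :
    ip f (fun z => g z - g' z) = ip f g - ip f g' := by
  rw [ip, ip, ip, ← integral_sub (hf.ip_int hg) (hf.ip_int hg')]
  congr 1; funext z; ring

lemma ip_sub_left {f f' g : Z n → ℂ} (hf : L2f f) (hf' : L2f f') (hg : L2f g) :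
    ip (fun z => f z - f' z) g = ip f g - ip f' g := by
  rw [ip, ip, ip, ← integral_sub (hf.ip_int hg) (hf'.ip_int hg)]
  congr 1; funext z; simp; ring

lemma ip_const_right (c : ℂ) (f g : Z n → ℂ) : ip f (fun z => c * g z) = c * ip f g := by
  rw [ip, ip, ← integral_const_mul]
  congr 1; funext z; ring

lemma ip_const_left (c : ℂ) (f g : Z n → ℂ) : ip (fun z => c * f z) g = conj c * ip f g := by
  rw [ip, ip, ← integral_const_mul]
  congr 1; funext z; simp; ring

lemma sL2 (θ : Sch n) : L2f θ := θ.memLp 2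

/-- L² density of Schwartz functions -/
lemma dense_sch {f : Z n → ℂ} (hf : L2f f) {ε : ℝ} (hε : 0 < ε) :
    ∃ θ : Sch n, nr (fun z => f z - θ z) ≤ ε := by
  obtain ⟨g, hg, hg', h⟩ := hf.exist_eLpNorm_sub_le (by simp) (by simp) hε
  refine ⟨hg.toSchwartzMap hg', ?_⟩
  have h1 : L2f (f - g) := hf.sub (hg'.continuous.memLp_of_hasCompactSupport hg)
  have h2 : nr (f - g) ≤ ε := by
    rw [nr_toLp h1, Lp.norm_toLp]
    exact ENNReal.toReal_le_of_le_ofReal hε.le h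
  exact h2

/-- Riesz representation on the dense subspace of Schwartz functions -/
lemma riesz (ℓ : Sch n →ₗ[ℂ] ℂ) {C : ℝ} (hC : 0 ≤ C) (h : ∀ θ : Sch n, ‖ℓ θ‖ ≤ C * nr θ) :
    ∃ f : Z n → ℂ, L2f f ∧ nr f ≤ C ∧ ∀ θ : Sch n, ℓ θ = ip f θ := by
  set e : Sch n →ₗ[ℂ] Lp ℂ 2 (volume : Measure (Z n)) :=
    (toLpCLM ℂ ℂ 2 (volume : Measure (Z n))).toLinearMap with he
  have hd : DenseRange e := by
    have := denseRange_toLpCLM (E := Z n) (F := ℂ) (p := 2) (by simp) (μ := volume)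
    exact this
  have hn : ∀ θ, ‖e θ‖ = nr θ := by
    intro θ; rw [nr_toLp (sL2 θ)]; rfl
  have hb : ∀ θ, ‖ℓ θ‖ ≤ C * ‖e θ‖ := by intro θ; rw [hn]; exact h θ
  set Λ := ℓ.extendOfNorm e
  set f := (InnerProductSpace.toDual ℂ (Lp ℂ 2 (volume : Measure (Z n)))).symm Λ with hf
  have hL : L2f (f : Z n → ℂ) := Lp.memLp f
  refine ⟨f, hL, ?_, fun θ => ?_⟩
  · rw [nr_toLp hL, Lp.toLp_coeFn, hf, LinearIsometryEquiv.norm_map]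
    exact ContinuousLinearMap.opNorm_le_bound _ hC
      (fun x => LinearMap.norm_extendOfNorm_apply_le hd C hb x)
  · rw [ip_toLp hL (sL2 θ), Lp.toLp_coeFn]
    have : inner ℂ f (e θ) = Λ (e θ) := by
      rw [hf, InnerProductSpace.toDual_symm_apply]
    rw [← LinearMap.extendOfNorm_eq hd ⟨C, hb⟩ θ]
    exact this.symm

/-! Plancherel facts -/

lemma fourier_Aop (b : Z n → ℂ) (θ : Sch n) : 𝓕 (Aop b θ) = mu b (𝓕 θ) := by
  rw [Aop_def]; exact FourierTransform.fourier_fourierInv_eq _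

lemma nq_fourier (θ : Sch n) : nq (𝓕 θ : Sch n) = nq θ := integral_norm_sq_fourier θ

lemma ip_fourier (θ φ : Sch n) : ip (𝓕 θ : Sch n) (𝓕 φ : Sch n) = ip θ φ := by
  have := integral_inner_fourier_fourier θ φ
  simp only [ip]
  simpa [mul_comm] using this

lemma nr_Aop {b : Z n → ℂ} (hb : CB b) : ∃ C : ℝ, 0 ≤ C ∧ ∀ θ : Sch n, nr (Aop b θ) ≤ C * nr θ := by
  obtain ⟨C, hC, h⟩ := hb.bdd
  refine ⟨C, hC, fun θ => ?_⟩
  have h1 : nr (Aop b θ) = nr (mu b (𝓕 θ)) := by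
    rw [nr, ← nq_fourier, fourier_Aop]; rfl
  have h2 : nr θ = nr (𝓕 θ : Sch n) := by rw [nr, ← nq_fourier]; rfl
  rw [h1, h2]
  refine nr_le (sL2 _) hC fun z => ?_
  rw [mu_apply hb.tg, norm_mul]
  gcongr; exact h z

lemma re_Aop {a : Z n → ℝ} (hb : CB (fun z => (a z : ℂ))) {a₀ : ℝ} (h : ∀ z, a₀ ≤ a z) (θ : Sch n) :
    a₀ * nq θ ≤ (ip θ (Aop (fun z => (a z : ℂ)) θ)).re := by
  rw [← ip_fourier, fourier_Aop, ← nq_fourier, ip]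
  have h0 : ∀ z, conj ((𝓕 θ : Sch n) z) * mu (fun z => (a z : ℂ)) (𝓕 θ) z
      = ((a z * ‖(𝓕 θ : Sch n) z‖ ^ 2 : ℝ) : ℂ) := by
    intro z
    rw [mu_apply hb.tg, mul_left_comm, Complex.conj_mul']; push_cast; rfl
  have hi : Integrable (fun z => a z * ‖(𝓕 θ : Sch n) z‖ ^ 2) := by
    have := (L2f.ip_int (sL2 (𝓕 θ)) (sL2 (mu (fun z => (a z : ℂ)) (𝓕 θ)))).re
    refine this.congr (Filter.Eventually.of_forall fun z => ?_)
    simp only [h0]; exact Complex.ofReal_re _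
  simp_rw [h0]
  rw [integral_complex_ofReal, Complex.ofReal_re, nq, ← integral_const_mul]
  refine integral_mono ((sL2 _).sq.const_mul _) hi fun z => ?_
  have := h z
  simp only
  gcongr
end KH

namespace KH
open SchwartzMap Function
open scoped FourierTransform LineDeriv ContDiff ComplexConjugate

/-- sum of squares of the coordinates in `J` -/
def sqJ (J : Finset (Ix n)) (ζ : Z n) : ℝ := ∑ j ∈ J, (ζ j) ^ 2
/-- weight `1 + κ² |ζ_J|²` -/
def Sw (J : Finset (Ix n)) (κ : ℝ) (ζ : Z n) : ℝ := 1 + κ ^ 2 * sqJ J ζ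

lemma sqJ_nonneg (J : Finset (Ix n)) (ζ : Z n) : 0 ≤ sqJ J ζ :=
  Finset.sum_nonneg fun _ _ => sq_nonneg _

lemma Sw_ge (J : Finset (Ix n)) (κ : ℝ) (ζ : Z n) : 1 ≤ Sw J κ ζ := by
  have := mul_nonneg (sq_nonneg κ) (sqJ_nonneg J ζ)
  simp only [Sw]; linarith

lemma Sw_pos (J : Finset (Ix n)) (κ : ℝ) (ζ : Z n) : 0 < Sw J κ ζ :=
  lt_of_lt_of_le one_pos (Sw_ge J κ ζ)

/-- scaled projection -/
def Bp (J : Finset (Ix n)) (κ : ℝ) : Z n →L[ℝ] Z n :=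
  ∑ j ∈ J, κ • (EuclideanSpace.proj (𝕜 := ℝ) j : Z n →L[ℝ] ℝ).smulRight (ej j)

lemma Bp_norm (J : Finset (Ix n)) (κ : ℝ) (ζ : Z n) : 1 + ‖Bp J κ ζ‖ ^ 2 = Sw J κ ζ := by
  classical
  have : ∀ i, (Bp J κ ζ) i = if i ∈ J then κ * ζ i else 0 := by
    intro i
    simp [Bp, ej, Pi.single_apply]
  rw [EuclideanSpace.norm_sq_eq, Sw, sqJ, Finset.mul_sum]
  congr 1
  simp_rw [this]
  rw [← Finset.sum_filter_add_sum_filter_not Finset.univ (· ∈ J)]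
  rw [Finset.sum_congr rfl (g := fun i => κ ^ 2 * ζ i ^ 2)
    (by intro i hi; simp at hi; simp [hi, mul_pow])]
  rw [Finset.sum_eq_zero (s := Finset.univ.filter (fun x => ¬ x ∈ J))
    (by intro i hi; simp at hi; simp [hi])]
  simp

/-- complex powers of the weights -/
def Sp (J : Finset (Ix n)) (κ r : ℝ) (ζ : Z n) : ℂ := ((Sw J κ ζ ^ r : ℝ) : ℂ)

lemma Sp_tg (J : Finset (Ix n)) (κ r : ℝ) : (Sp J κ r).HasTemperateGrowth := by
  have : Sp J κ r = Complex.ofReal ∘ ((fun x : Z n => (1 + ‖x‖ ^ 2) ^ r) ∘ (Bp J κ)) := by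
    funext z; simp [Sp, Bp_norm]
  rw [this]
  exact Function.Complex.hasTemperateGrowth_ofReal.comp
    ((hasTemperateGrowth_one_add_norm_sq_rpow _ r).comp (ContinuousLinearMap.hasTemperateGrowth _))

lemma Sp_mul (J : Finset (Ix n)) (κ r r' : ℝ) (ζ : Z n) :
    Sp J κ r ζ * Sp J κ r' ζ = Sp J κ (r + r') ζ := by
  simp only [Sp, ← Complex.ofReal_mul, Real.rpow_add (Sw_pos J κ ζ)]

lemma Sp_zero (J : Finset (Ix n)) (κ : ℝ) (ζ : Z n) : Sp J κ 0 ζ = 1 := by simp [Sp]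
lemma Sp_one (J : Finset (Ix n)) (κ : ℝ) (ζ : Z n) : Sp J κ 1 ζ = (Sw J κ ζ : ℂ) := by simp [Sp]
lemma Sp_neg_one (J : Finset (Ix n)) (κ : ℝ) (ζ : Z n) :
    Sp J κ (-1) ζ = ((Sw J κ ζ)⁻¹ : ℝ) := by simp [Sp, Real.rpow_neg_one]

lemma mu_mul {φ ψ : Z n → ℂ} (hφ : φ.HasTemperateGrowth) (hψ : ψ.HasTemperateGrowth) (θ : Sch n) :
    mu φ (mu ψ θ) = mu (fun z => φ z * ψ z) θ := by
  ext z
  rw [mu_apply hφ, mu_apply hψ, mu_apply (φ := fun z => φ z * ψ z) (hφ.mul hψ), mul_assoc]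

lemma mu_comm {φ ψ : Z n → ℂ} (hφ : φ.HasTemperateGrowth) (hψ : ψ.HasTemperateGrowth) (θ : Sch n) :
    mu φ (mu ψ θ) = mu ψ (mu φ θ) := by
  ext z
  rw [mu_apply hφ, mu_apply hψ, mu_apply hψ, mu_apply hφ]; ring

lemma mu_one (θ : Sch n) : mu (fun _ => 1) θ = θ := by
  ext z
  rw [mu_apply (.const 1), one_mul]

lemma mu_Sp (J : Finset (Ix n)) (κ r r' : ℝ) (θ : Sch n) :
    mu (Sp J κ r) (mu (Sp J κ r') θ) = mu (Sp J κ (r + r')) θ := by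
  rw [mu_mul (Sp_tg _ _ _) (Sp_tg _ _ _)]; simp_rw [Sp_mul]

lemma mu_Sp_zero (J : Finset (Ix n)) (κ : ℝ) (θ : Sch n) : mu (Sp J κ 0) θ = θ := by
  have : Sp J κ 0 = fun _ => 1 := by funext z; exact Sp_zero J κ z
  rw [this, mu_one]

/-- the `v` index set -/
def Vs : Finset (Ix n) := Finset.univ.image (fun i : Fin n => Sum.inr (Sum.inr i))
/-- the `x,v` index set -/
def XVs : Finset (Ix n) := Finset.univ.image (fun i : Fin n ⊕ Fin n => Sum.inr i)
/-- the `t` index set -/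
def Ts : Finset (Ix n) := {Sum.inl ()}

lemma sqJ_Vs (ζ : Z n) : sqJ Vs ζ = ‖vC ζ‖ ^ 2 := by
  rw [EuclideanSpace.norm_sq_eq, sqJ, Vs, Finset.sum_image (by intro; simp)]
  simp [vC]

lemma sqJ_XVs (ζ : Z n) : sqJ XVs ζ = ‖xC ζ‖ ^ 2 + ‖vC ζ‖ ^ 2 := by
  rw [EuclideanSpace.norm_sq_eq, EuclideanSpace.norm_sq_eq, sqJ, XVs,
    Finset.sum_image (by intro; simp)]
  simp [vC, xC]

lemma sqJ_Ts (ζ : Z n) : sqJ Ts ζ = tC ζ ^ 2 := by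
  simp [sqJ, Ts, tC]

lemma norm_Z (ζ : Z n) : ‖ζ‖ ^ 2 = tC ζ ^ 2 + (‖xC ζ‖ ^ 2 + ‖vC ζ‖ ^ 2) := by
  rw [EuclideanSpace.norm_sq_eq, EuclideanSpace.norm_sq_eq, EuclideanSpace.norm_sq_eq]
  simp [vC, xC, tC]

lemma sqJ_cont (J : Finset (Ix n)) : Continuous (sqJ J) := by
  unfold sqJ; fun_prop
lemma Sw_cont (J : Finset (Ix n)) (κ : ℝ) : Continuous (Sw J κ) := by
  have := sqJ_cont J
  unfold Sw; fun_prop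

lemma nq_add_le {f g : Z n → ℂ} (hf : L2f f) (hg : L2f g) :
    nq (fun z => f z + g z) ≤ 2 * nq f + 2 * nq g := by
  have h := nr_add_le hf hg
  have : nq (fun z => f z + g z) = nr (f + g) ^ 2 := (nr_sq _).symm
  rw [this, ← nr_sq f, ← nr_sq g]
  nlinarith [nr_nonneg (f + g), nr_nonneg f, nr_nonneg g, sq_nonneg (nr f - nr g)]

lemma nq_Aop {b : Z n → ℂ} (hb : CB b) : ∃ C : ℝ, 0 ≤ C ∧ ∀ θ : Sch n, nq (Aop b θ) ≤ C * nq θ := by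
  obtain ⟨C, hC, h⟩ := nr_Aop hb
  refine ⟨C ^ 2, by positivity, fun θ => ?_⟩
  rw [← nr_sq, ← nr_sq, ← mul_pow]
  have := h θ
  have := nr_nonneg (Aop b θ)
  gcongr

/-- weighted square norm -/
def qk (κ : ℝ) (f : Z n → ℂ) : ℝ := ∫ ζ, (1 - (Sw Vs κ ζ)⁻¹) * ‖f ζ‖ ^ 2

lemma wk_bd (κ : ℝ) (ζ : Z n) : 0 ≤ 1 - (Sw Vs κ ζ)⁻¹ ∧ 1 - (Sw Vs κ ζ)⁻¹ ≤ 1 ∧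
    1 - (Sw Vs κ ζ)⁻¹ ≤ κ ^ 2 * sqJ Vs ζ := by
  have h1 := Sw_ge Vs κ ζ
  have h2 := Sw_pos Vs κ ζ
  have h3 : (Sw Vs κ ζ)⁻¹ ≤ 1 := inv_le_one_of_one_le₀ h1
  have h4 : 0 < (Sw Vs κ ζ)⁻¹ := inv_pos.2 h2
  refine ⟨by linarith, by linarith, ?_⟩
  have h5 : κ ^ 2 * sqJ Vs ζ = Sw Vs κ ζ - 1 := by simp [Sw]
  rw [h5]
  have h6 : Sw Vs κ ζ * (Sw Vs κ ζ)⁻¹ = 1 := mul_inv_cancel₀ h2.ne'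
  nlinarith

lemma qk_int (κ : ℝ) {f : Z n → ℂ} (hf : L2f f) :
    Integrable (fun ζ => (1 - (Sw Vs κ ζ)⁻¹) * ‖f ζ‖ ^ 2) := by
  refine hf.sq.bdd_mul (c := 1) ?_ ?_
  · have := Sw_cont (n := n) Vs κ
    exact (continuous_const.sub (this.inv₀ fun ζ => (Sw_pos _ _ _).ne')).aestronglyMeasurable
  · refine Filter.Eventually.of_forall fun ζ => ?_
    obtain ⟨h1, h2, -⟩ := wk_bd κ ζ
    rw [Real.norm_eq_abs, abs_of_nonneg h1]; exact h2

lemma qk_nonneg (κ : ℝ) (f : Z n → ℂ) : 0 ≤ qk κ f :=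
  integral_nonneg fun ζ => mul_nonneg (wk_bd κ ζ).1 (by positivity)

/-- complement multiplier -/
def Qp (κ : ℝ) (ζ : Z n) : ℂ := 1 - Sp Vs κ (-1) ζ

lemma Qp_tg (κ : ℝ) : (Qp (n := n) κ).HasTemperateGrowth := (Function.HasTemperateGrowth.const 1).sub (Sp_tg _ _ _)
lemma Qp_eq (κ : ℝ) (ζ : Z n) : Qp κ ζ = ((1 - (Sw Vs κ ζ)⁻¹ : ℝ) : ℂ) := by
  simp [Qp, Sp_neg_one]

lemma norm_Qp (κ : ℝ) (ζ : Z n) : ‖Qp κ ζ‖ = 1 - (Sw Vs κ ζ)⁻¹ := by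
  rw [Qp_eq, Complex.norm_real, Real.norm_eq_abs, abs_of_nonneg (wk_bd κ ζ).1]

lemma nq_qk (κ : ℝ) (θ : Sch n) :
    κ ^ 2 * ∑ j ∈ Vs, nq (mu (co j) (mu (Sp Vs κ (-1)) θ)) + nq (mu (Qp κ) θ) = qk κ θ := by
  simp only [nq]
  rw [← integral_finsetSum _ (fun j _ => (sL2 _).sq), ← integral_const_mul,
    ← integral_add ((integrable_finsetSum _ (fun j _ => (sL2 _).sq)).const_mul _) (sL2 _).sq, qk]
  congr 1; funext ζ
  simp_rw [mu_apply (co_tg _), mu_apply (Qp_tg κ), mu_apply (Sp_tg _ _ _), norm_mul, norm_Qp,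
    Sp_neg_one, co, Complex.norm_real, mul_pow]
  rw [← Finset.sum_mul]
  have h5 : κ ^ 2 * sqJ Vs ζ = Sw Vs κ ζ - 1 := by simp [Sw]
  have h6 : (∑ j ∈ Vs, ‖ζ j‖ ^ 2) = sqJ Vs ζ := by simp [sqJ]
  rw [h6, ← mul_assoc, h5]
  have h2 := (Sw_pos Vs κ ζ).ne'
  simp only [norm_inv, Real.norm_eq_abs, inv_pow, sq_abs]
  field_simp
  ring

lemma nq_Sp_neg (κ : ℝ) (θ : Sch n) : nq (mu (Sp Vs κ (-1)) θ) ≤ nq θ := by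
  have := nq_le (f := mu (Sp Vs κ (-1)) θ) (sL2 θ) (C := 1) zero_le_one fun z => ?_
  · simpa using this
  · rw [mu_apply (Sp_tg _ _ _), Sp_neg_one, norm_mul, Complex.norm_real, Real.norm_eq_abs,
      abs_of_pos (inv_pos.2 (Sw_pos _ _ _))]
    gcongr
    exact inv_le_one_of_one_le₀ (Sw_ge _ _ _)

lemma split_S (κ : ℝ) (θ : Sch n) : mu (Sp Vs κ (-1)) θ + mu (Qp κ) θ = θ := by
  ext z
  rw [_root_.add_apply, mu_apply (Sp_tg _ _ _), mu_apply (Qp_tg κ), Qp]; ring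

lemma qk_Aop {b : Z n → ℂ} (hb : CB b) : ∃ C : ℝ, 0 ≤ C ∧ ∀ (κ : ℝ) (θ : Sch n),
    qk κ (Aop b θ) ≤ C * (qk κ θ + κ ^ 2 * nq θ) := by
  obtain ⟨C, hC, h⟩ := nq_Aop hb
  choose D hD hDj using fun j => nq_Aop (hb.dj j)
  refine ⟨4 * C + 4 * ∑ j ∈ Vs, D j, by
    have : 0 ≤ ∑ j ∈ Vs, D j := Finset.sum_nonneg fun j _ => hD j
    positivity, fun κ θ => ?_⟩
  set f0 := mu (Sp Vs κ (-1)) θ with hf0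
  set f1 := mu (Qp κ) θ with hf1
  have hsplit : Aop b θ = Aop b f0 + Aop b f1 := by rw [← map_add, split_S]
  have hq := nq_qk κ θ
  rw [← hf0, ← hf1] at hq
  have h0 : nq f0 ≤ nq θ := nq_Sp_neg κ θ
  have step1 : qk κ (Aop b θ) ≤ 2 * nq (Aop b f1) + 2 * κ ^ 2 * ∑ j ∈ Vs, nq (mu (co j) (Aop b f0)) := by
    simp only [nq]
    rw [← integral_finsetSum _ (fun j _ => (sL2 _).sq), ← integral_const_mul, ← integral_const_mul,
      ← integral_add ((sL2 _).sq.const_mul _)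
        ((integrable_finsetSum _ (fun j _ => (sL2 _).sq)).const_mul _), qk]
    refine integral_mono (qk_int κ (sL2 _)) (((sL2 _).sq.const_mul _).add
        ((integrable_finsetSum _ (fun j _ => (sL2 _).sq)).const_mul _)) fun ζ => ?_
    obtain ⟨g1, g2, g3⟩ := wk_bd κ ζ
    simp only
    have e1 : (∑ j ∈ Vs, ‖(mu (co j) (Aop b f0)) ζ‖ ^ 2) = sqJ Vs ζ * ‖Aop b f0 ζ‖ ^ 2 := by
      simp_rw [mu_apply (co_tg _), norm_mul, co, Complex.norm_real, mul_pow]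
      rw [← Finset.sum_mul]; simp [sqJ]
    rw [e1, hsplit, _root_.add_apply]
    have e2 : ‖Aop b f0 ζ + Aop b f1 ζ‖ ^ 2 ≤ 2 * ‖Aop b f0 ζ‖ ^ 2 + 2 * ‖Aop b f1 ζ‖ ^ 2 := by
      have := norm_add_le (Aop b f0 ζ) (Aop b f1 ζ)
      nlinarith [norm_nonneg (Aop b f0 ζ + Aop b f1 ζ), sq_nonneg (‖Aop b f0 ζ‖ - ‖Aop b f1 ζ‖)]
    calc _ ≤ (1 - (Sw Vs κ ζ)⁻¹) * (2 * ‖Aop b f0 ζ‖ ^ 2 + 2 * ‖Aop b f1 ζ‖ ^ 2) := by gcongr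
      _ = (1 - (Sw Vs κ ζ)⁻¹) * (2 * ‖Aop b f0 ζ‖ ^ 2) + (1 - (Sw Vs κ ζ)⁻¹) * (2 * ‖Aop b f1 ζ‖ ^ 2) := by ring
      _ ≤ (κ ^ 2 * sqJ Vs ζ) * (2 * ‖Aop b f0 ζ‖ ^ 2) + 1 * (2 * ‖Aop b f1 ζ‖ ^ 2) := by gcongr
      _ = _ := by ring
  have step2 : ∀ j, nq (mu (co j) (Aop b f0)) ≤ 2 * C * nq (mu (co j) f0) + 2 * D j * nq θ := by
    intro j
    rw [co_Aop hb]
    refine (nq_add_le (sL2 (Aop b (mu (co j) f0))) (sL2 (Aop (dj j b) f0))).trans ?_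
    have e1 := h (mu (co j) f0)
    have e2 := (hDj j f0).trans (mul_le_mul_of_nonneg_left h0 (hD j))
    linarith
  have step3 : ∑ j ∈ Vs, nq (mu (co j) (Aop b f0)) ≤
      2 * C * ∑ j ∈ Vs, nq (mu (co j) f0) + 2 * (∑ j ∈ Vs, D j) * nq θ := by
    refine (Finset.sum_le_sum fun j _ => step2 j).trans (le_of_eq ?_)
    rw [Finset.sum_add_distrib, Finset.mul_sum, Finset.mul_sum, Finset.sum_mul]
  have hk : 0 ≤ κ ^ 2 := sq_nonneg κ
  have e3 := h f1
  have e4 := mul_le_mul_of_nonneg_left step3 hk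
  have e5 : 0 ≤ ∑ j ∈ Vs, D j := Finset.sum_nonneg fun j _ => hD j
  have e6 := nq_nonneg (n := n) f1
  have e7 := nq_nonneg (n := n) θ
  have e8 := qk_nonneg κ (θ : Z n → ℂ)
  have e9 : κ ^ 2 * (∑ j ∈ Vs, nq (mu (co j) f0)) = qk κ θ - nq f1 := by linarith
  have e10 : 0 ≤ C * nq f1 := by positivity
  have e11 : 0 ≤ (∑ j ∈ Vs, D j) * qk κ θ := by positivity
  have e12 : 0 ≤ C * (κ ^ 2 * nq θ) := by positivity
  nlinarith
end KH

namespace KH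
open SchwartzMap Function
open scoped FourierTransform LineDeriv ContDiff ComplexConjugate

lemma mu_sub_fun {φ ψ : Z n → ℂ} (hφ : φ.HasTemperateGrowth) (hψ : ψ.HasTemperateGrowth)
    (θ : Sch n) : mu (fun z => φ z - ψ z) θ = mu φ θ - mu ψ θ := by
  ext z
  rw [_root_.sub_apply, mu_apply hφ, mu_apply hψ, mu_apply (φ := fun z => φ z - ψ z) (hφ.sub hψ)]
  ring

/-- coercivity at scale `κ` -/
lemma qk_coer {a : Z n → ℝ} (hb : CB (fun z => (a z : ℂ))) {a₀ : ℝ} (ha₀ : 0 < a₀)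
    (h : ∀ z, a₀ ≤ a z) : ∃ C : ℝ, 0 ≤ C ∧ ∀ (κ : ℝ) (θ : Sch n),
    a₀ / 2 * qk κ θ - C * (κ ^ 2 * nq θ) ≤ (ip (mu (Qp κ) θ) (Aop (fun z => (a z : ℂ)) θ)).re := by
  set A := Aop (fun z => (a z : ℂ)) with hA
  choose D hD hDj using fun j => nr_Aop (hb.dj j)
  refine ⟨∑ j ∈ Vs, D j ^ 2 / (2 * a₀), Finset.sum_nonneg fun j _ => by positivity, fun κ θ => ?_⟩
  set f0 := mu (Sp Vs κ (-1)) θ with hf0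
  set f1 := mu (Qp κ) θ with hf1
  have hq := nq_qk κ θ
  rw [← hf0, ← hf1] at hq
  have h0 : nq f0 ≤ nq θ := nq_Sp_neg κ θ
  have hsplit : A θ = A f0 + A f1 := by rw [← map_add, split_S]
  have hf1' : ∀ ζ, f1 ζ = κ ^ 2 * ∑ j ∈ Vs, co j ζ * (mu (co j) f0) ζ := by
    intro ζ
    simp_rw [hf1, hf0, mu_apply (co_tg _), mu_apply (Qp_tg κ), mu_apply (Sp_tg _ _ _), Qp_eq,
      Sp_neg_one, co]
    simp_rw [← mul_assoc, ← Finset.sum_mul]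
    rw [← mul_assoc, ← mul_assoc]
    congr 1
    have h5 : Sw Vs κ ζ = 1 + κ ^ 2 * sqJ Vs ζ := by simp [Sw]
    have h2 := (Sw_pos Vs κ ζ).ne'
    have h7 : (1 - (Sw Vs κ ζ)⁻¹) = κ ^ 2 * sqJ Vs ζ * (Sw Vs κ ζ)⁻¹ := by
      field_simp; linarith
    rw [h7, sqJ]
    push_cast
    congr 2
    refine Finset.sum_congr rfl fun j _ => by ring
  have e1 : ip f1 (A f0) = κ ^ 2 * ∑ j ∈ Vs, ip (mu (co j) f0) (mu (co j) (A f0)) := by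
    simp only [ip]
    rw [← integral_finsetSum _ (fun j _ => (sL2 _).ip_int (sL2 _)), ← integral_const_mul]
    congr 1; funext ζ
    rw [hf1']
    simp only [map_mul, map_sum, map_pow, Complex.conj_ofReal, mul_assoc, Finset.sum_mul]
    congr 1
    refine Finset.sum_congr rfl fun j _ => ?_
    simp only [mu_apply (co_tg _), co, Complex.conj_ofReal, map_mul]
    ring
  have e2 : ∀ j, a₀ / 2 * nq (mu (co j) f0) - D j ^ 2 / (2 * a₀) * nq θ ≤
      (ip (mu (co j) f0) (mu (co j) (A f0))).re := by
    intro j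
    rw [hA, co_Aop hb]
    have g1 := ip_add_right (sL2 (mu (co j) f0)) (sL2 (A (mu (co j) f0)))
      (sL2 (Aop (dj j fun z => (a z : ℂ)) f0))
    have g2 := re_Aop hb h (mu (co j) f0)
    have g3 := ip_le (sL2 (mu (co j) f0)) (sL2 (Aop (dj j fun z => (a z : ℂ)) f0))
    have g4 := hDj j f0
    have g5 := (abs_le.1 (Complex.abs_re_le_norm
      (ip (mu (co j) f0) (Aop (dj j fun z => (a z : ℂ)) f0)))).1
    have g6 := nr_nonneg (n := n) (mu (co j) f0)
    have g7 : (ip (mu (co j) f0) ⇑(Aop (fun z => (a z : ℂ)) (mu (co j) f0) +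
      Aop (dj j fun z => (a z : ℂ)) f0)).re = (ip (mu (co j) f0) (A (mu (co j) f0))).re +
        (ip (mu (co j) f0) (Aop (dj j fun z => (a z : ℂ)) f0)).re := by
      rw [← Complex.add_re, ← g1]; rfl
    rw [g7]
    have g8 : nr (mu (co j) f0) * nr (Aop (dj j fun z => (a z : ℂ)) f0) ≤
        a₀ / 2 * nq (mu (co j) f0) + D j ^ 2 / (2 * a₀) * nq θ := by
      have k1 : nr (mu (co j) f0) * nr (Aop (dj j fun z => (a z : ℂ)) f0) ≤
        nr (mu (co j) f0) * (D j * nr f0) := by gcongr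
      have k2 : D j ^ 2 / (2 * a₀) * nq f0 ≤ D j ^ 2 / (2 * a₀) * nq θ := by gcongr
      have k3 : nr (mu (co j) f0) * (D j * nr f0) ≤
          a₀ / 2 * nr (mu (co j) f0) ^ 2 + D j ^ 2 / (2 * a₀) * nr f0 ^ 2 := by
        have : a₀ / 2 * nr (mu (co j) f0) ^ 2 + D j ^ 2 / (2 * a₀) * nr f0 ^ 2
          - nr (mu (co j) f0) * (D j * nr f0) =
            (a₀ * nr (mu (co j) f0) - D j * nr f0) ^ 2 / (2 * a₀) := by
          field_simp; ring
        have : 0 ≤ (a₀ * nr (mu (co j) f0) - D j * nr f0) ^ 2 / (2 * a₀) := by positivity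
        linarith
      rw [nr_sq, nr_sq] at k3
      linarith
    linarith
  have e3 := re_Aop hb h f1
  have e4 : ip f1 (A θ) = ip f1 (A f0) + ip f1 (A f1) := by
    rw [hsplit]; exact ip_add_right (sL2 _) (sL2 _) (sL2 _)
  have e5 := Finset.sum_le_sum (s := Vs) (fun j _ => e2 j)
  rw [Finset.sum_sub_distrib, ← Finset.mul_sum, ← Finset.sum_mul] at e5
  have e6 := mul_le_mul_of_nonneg_left e5 (sq_nonneg κ)
  have e7 : (ip f1 (A f0)).re = κ ^ 2 * ∑ j ∈ Vs, (ip (mu (co j) f0) (mu (co j) (A f0))).re := by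
    rw [e1, ← Complex.re_sum, ← Complex.ofReal_pow, Complex.re_ofReal_mul]
  rw [e4, Complex.add_re, e7]
  have e8 := nq_nonneg (n := n) f1
  have e9 : 0 ≤ a₀ * nq f1 := by positivity
  rw [← hq]
  nlinarith
end KH

namespace KH
open SchwartzMap Function
open scoped FourierTransform LineDeriv ContDiff ComplexConjugate

/-- kernel -/
def ker (σ : ℝ) (ζ : Z n) (s : ℝ) : ℝ := s ^ (σ - 1) * (1 - (Sw Vs (s ^ (-(1/2) : ℝ)) ζ)⁻¹)
/-- integral symbol, comparable with `|η|^{2σ}` -/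
def Lz (σ : ℝ) (ζ : Z n) : ℝ := ∫ s in Set.Ioi 1, ker σ ζ s

lemma kap_sq {s : ℝ} (hs : 0 < s) : (s ^ (-(1/2) : ℝ)) ^ 2 = s⁻¹ := by
  rw [← Real.rpow_natCast, ← Real.rpow_mul hs.le]; norm_num [Real.rpow_neg_one]

lemma ker_eq (σ : ℝ) (ζ : Z n) {s : ℝ} (hs : 0 < s) :
    ker σ ζ s = s ^ (σ - 1) * (sqJ Vs ζ / (s + sqJ Vs ζ)) := by
  have h := sqJ_nonneg Vs ζ
  rw [ker, Sw, kap_sq hs]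
  congr 1
  have : s + sqJ Vs ζ ≠ 0 := by positivity
  have : 1 + s⁻¹ * sqJ Vs ζ ≠ 0 := by positivity
  field_simp
  ring

lemma ker_nonneg (σ : ℝ) (ζ : Z n) {s : ℝ} (hs : 0 < s) : 0 ≤ ker σ ζ s :=
  mul_nonneg (by positivity) (wk_bd _ _).1

lemma ker_le (σ : ℝ) (ζ : Z n) {s : ℝ} (hs : 0 < s) : ker σ ζ s ≤ s ^ (σ - 2) * sqJ Vs ζ := by
  have h := (wk_bd (s ^ (-(1/2) : ℝ)) ζ).2.2
  rw [kap_sq hs] at h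
  have : s ^ (σ - 2) = s ^ (σ - 1) * s⁻¹ := by
    rw [← Real.rpow_neg_one s, ← Real.rpow_add hs]; ring_nf
  rw [ker, this, mul_assoc]
  gcongr

lemma ker_le' (σ : ℝ) (ζ : Z n) {s : ℝ} (hs : 0 < s) : ker σ ζ s ≤ s ^ (σ - 1) := by
  have h := (wk_bd (s ^ (-(1/2) : ℝ)) ζ).2.1
  rw [ker]
  exact mul_le_of_le_one_right (by positivity) h

lemma ker_meas (σ : ℝ) : Measurable (fun p : ℝ × Z n => ker σ p.2 p.1) := by
  have h : Measurable (fun p : ℝ × Z n => sqJ Vs p.2) := (sqJ_cont Vs).measurable.comp measurable_snd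
  unfold ker Sw
  fun_prop

lemma Lz_nonneg (σ : ℝ) (ζ : Z n) : 0 ≤ Lz σ ζ :=
  setIntegral_nonneg measurableSet_Ioi fun s hs => ker_nonneg σ ζ (one_pos.trans hs)

lemma Lz_meas (σ : ℝ) : StronglyMeasurable (Lz (n := n) σ) :=
  StronglyMeasurable.integral_prod_left (f := fun (s : ℝ) (ζ : Z n) => ker σ ζ s)
    (ker_meas σ).stronglyMeasurable

lemma int_s {σ : ℝ} (hσ1 : σ < 1) : IntegrableOn (fun s : ℝ => s ^ (σ - 2)) (Set.Ioi 1) :=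
  integrableOn_Ioi_rpow_of_lt (by linarith) one_pos

lemma ker_int1 {σ : ℝ} (hσ1 : σ < 1) (ζ : Z n) : IntegrableOn (ker σ ζ) (Set.Ioi 1) := by
  refine Integrable.mono' ((int_s hσ1).mul_const (sqJ Vs ζ)) ?_ ?_
  · exact ((ker_meas σ).comp (measurable_id.prodMk measurable_const)).aestronglyMeasurable
  · refine (ae_restrict_iff' measurableSet_Ioi).2 (Filter.Eventually.of_forall fun s hs => ?_)
    have hs0 : (0 : ℝ) < s := one_pos.trans hs
    rw [Real.norm_eq_abs, abs_of_nonneg (ker_nonneg σ ζ hs0)]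
    exact ker_le σ ζ hs0

lemma ker_int0 {σ : ℝ} (hσ0 : 0 < σ) (ζ : Z n) : IntegrableOn (ker σ ζ) (Set.Ioc 0 1) := by
  have h1 : IntegrableOn (fun s : ℝ => s ^ (σ - 1)) (Set.Ioc 0 1) :=
    (intervalIntegrable_iff_integrableOn_Ioc_of_le zero_le_one).1
      (intervalIntegral.intervalIntegrable_rpow' (by linarith))
  refine Integrable.mono' h1 ?_ ?_
  · exact ((ker_meas σ).comp (measurable_id.prodMk measurable_const)).aestronglyMeasurable
  · refine (ae_restrict_iff' measurableSet_Ioc).2 (Filter.Eventually.of_forall fun s hs => ?_)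
    rw [Real.norm_eq_abs, abs_of_nonneg (ker_nonneg σ ζ hs.1)]
    exact ker_le' σ ζ hs.1

/-- the constant -/
def cσ (σ : ℝ) : ℝ := ∫ t in Set.Ioi (0 : ℝ), t ^ (σ - 1) * (1 / (t + 1))

lemma ker_full {σ : ℝ} (hσ0 : 0 < σ) (ζ : Z n) :
    ∫ s in Set.Ioi 0, ker σ ζ s = cσ σ * (sqJ Vs ζ) ^ σ := by
  rcases (sqJ_nonneg Vs ζ).eq_or_lt with h | h
  · rw [← h, Real.zero_rpow hσ0.ne', mul_zero]
    rw [setIntegral_congr_fun measurableSet_Ioi (g := fun _ => 0)]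
    · simp
    · intro s hs; simp only; rw [ker_eq σ ζ hs, ← h]; simp
  · have h1 := integral_comp_mul_left_Ioi (ker σ ζ) 0 h
    rw [mul_zero] at h1
    have h2 : ∫ x in Set.Ioi (0:ℝ), ker σ ζ (sqJ Vs ζ * x) = (sqJ Vs ζ) ^ (σ - 1) * cσ σ := by
      rw [cσ, ← integral_const_mul]
      refine setIntegral_congr_fun measurableSet_Ioi fun t ht => ?_
      have ht : (0:ℝ) < t := ht
      rw [ker_eq σ ζ (by positivity), Real.mul_rpow h.le ht.le]
      field_simp
    rw [h2, smul_eq_mul] at h1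
    have h3 : (sqJ Vs ζ) ^ σ = sqJ Vs ζ * (sqJ Vs ζ) ^ (σ - 1) := by
      rw [Real.rpow_sub_one h.ne']; field_simp
    rw [h3]
    field_simp at h1
    linarith

lemma cσ_pos {σ : ℝ} (hn : 1 ≤ n) (hσ0 : 0 < σ) (hσ1 : σ < 1) : 0 < cσ σ := by
  -- use a concrete point
  set ζ : Z n := ej (Sum.inr (Sum.inr ⟨0, hn⟩)) with hζ
  have h1 : sqJ Vs ζ = 1 := by
    rw [sqJ_Vs, EuclideanSpace.norm_sq_eq]
    simp [hζ, vC, ej, Pi.single_apply]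
  have h2 : cσ σ = ∫ s in Set.Ioi 0, ker σ ζ s := by rw [ker_full hσ0, h1]; simp
  have h3 : IntegrableOn (ker σ ζ) (Set.Ioi 0) := by
    rw [← Set.Ioc_union_Ioi_eq_Ioi zero_le_one]
    exact (ker_int0 hσ0 ζ).union (ker_int1 hσ1 ζ)
  rw [h2, setIntegral_pos_iff_support_of_nonneg_ae _ h3]
  · have : Set.Ioi (0:ℝ) ⊆ support (ker σ ζ) ∩ Set.Ioi 0 := by
      intro s hs
      have hs' : (0:ℝ) < s := hs
      refine ⟨?_, hs⟩
      rw [Function.mem_support, ker_eq σ ζ hs, h1]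
      positivity
    refine lt_of_lt_of_le ?_ (measure_mono this)
    simp
  · exact (ae_restrict_iff' measurableSet_Ioi).2
      (Filter.Eventually.of_forall fun s hs => ker_nonneg σ ζ hs)

lemma Lz_approx {σ : ℝ} (hσ0 : 0 < σ) (hσ1 : σ < 1) :
    ∃ C, 0 ≤ C ∧ ∀ ζ : Z n, |Lz σ ζ - cσ σ * (sqJ Vs ζ) ^ σ| ≤ C := by
  have h1 : IntegrableOn (fun s : ℝ => s ^ (σ - 1)) (Set.Ioc 0 1) :=
    (intervalIntegrable_iff_integrableOn_Ioc_of_le zero_le_one).1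
      (intervalIntegral.intervalIntegrable_rpow' (by linarith))
  refine ⟨∫ s in Set.Ioc (0:ℝ) 1, s ^ (σ - 1), setIntegral_nonneg measurableSet_Ioc
    (fun s hs => by have := hs.1; positivity), fun ζ => ?_⟩
  rw [← ker_full hσ0, ← Set.Ioc_union_Ioi_eq_Ioi zero_le_one,
    setIntegral_union Set.Ioc_disjoint_Ioi_same measurableSet_Ioi (ker_int0 hσ0 ζ) (ker_int1 hσ1 ζ), Lz]
  have h2 : 0 ≤ ∫ s in Set.Ioc (0:ℝ) 1, ker σ ζ s :=
    setIntegral_nonneg measurableSet_Ioc fun s hs => ker_nonneg σ ζ hs.1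
  have h3 : ∫ s in Set.Ioc (0:ℝ) 1, ker σ ζ s ≤ ∫ s in Set.Ioc (0:ℝ) 1, s ^ (σ - 1) :=
    setIntegral_mono_on (ker_int0 hσ0 ζ) h1 measurableSet_Ioc fun s hs => ker_le' σ ζ hs.1
  rw [abs_le]; constructor <;> linarith

lemma Lz_le {σ : ℝ} (hσ1 : σ < 1) : ∃ C, 0 ≤ C ∧ ∀ ζ : Z n, Lz σ ζ ≤ C * sqJ Vs ζ := by
  refine ⟨∫ s in Set.Ioi (1:ℝ), s ^ (σ - 2), setIntegral_nonneg measurableSet_Ioi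
    (fun s hs => by have : (0:ℝ) < s := one_pos.trans hs; positivity), fun ζ => ?_⟩
  rw [Lz, ← integral_mul_const]
  exact setIntegral_mono_on (ker_int1 hσ1 ζ) ((int_s hσ1).mul_const _) measurableSet_Ioi
    fun s hs => ker_le σ ζ (one_pos.trans hs)

lemma fub_int {σ : ℝ} (hσ1 : σ < 1) {g : Z n → ℝ} (hg : AEStronglyMeasurable g)
    (hg2 : Integrable (fun ζ => sqJ Vs ζ * g ζ)) :
    Integrable (fun p : ℝ × Z n => ker σ p.2 p.1 * g p.2)
      ((volume.restrict (Set.Ioi 1)).prod volume) := by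
  have h1 : Integrable (fun p : ℝ × Z n => p.1 ^ (σ - 2) * (sqJ Vs p.2 * g p.2))
      ((volume.restrict (Set.Ioi 1)).prod volume) := (int_s hσ1).mul_prod hg2
  refine h1.mono ((ker_meas σ).aestronglyMeasurable.mul hg.comp_snd) ?_
  have h2 : ∀ᵐ p : ℝ × Z n ∂((volume.restrict (Set.Ioi 1)).prod volume), p.1 ∈ Set.Ioi (1:ℝ) :=
    Measure.quasiMeasurePreserving_fst.ae (ae_restrict_mem measurableSet_Ioi)
  filter_upwards [h2] with p hp
  have hs : (0:ℝ) < p.1 := one_pos.trans hp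
  have h3 := ker_le σ p.2 hs
  have h4 := ker_nonneg σ p.2 hs
  have h5 := sqJ_nonneg Vs p.2
  rw [norm_mul, norm_mul, norm_mul, Real.norm_eq_abs, abs_of_nonneg h4,
    Real.norm_eq_abs (p.1 ^ _), abs_of_nonneg (by positivity), Real.norm_eq_abs (sqJ _ _),
    abs_of_nonneg h5, ← mul_assoc]
  gcongr

/-- Fubini -/
lemma fub {σ : ℝ} (hσ1 : σ < 1) {g : Z n → ℝ} (hg : AEStronglyMeasurable g)
    (hg2 : Integrable (fun ζ => sqJ Vs ζ * g ζ)) :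
    IntegrableOn (fun s : ℝ => s ^ (σ - 1) * ∫ ζ, (1 - (Sw Vs (s ^ (-(1/2) : ℝ)) ζ)⁻¹) * g ζ)
      (Set.Ioi 1) ∧
    Integrable (fun ζ => Lz σ ζ * g ζ) ∧
    ∫ ζ, Lz σ ζ * g ζ =
      ∫ s in Set.Ioi (1:ℝ), s ^ (σ - 1) * ∫ ζ, (1 - (Sw Vs (s ^ (-(1/2) : ℝ)) ζ)⁻¹) * g ζ := by
  have h := fub_int hσ1 hg hg2
  have e1 : (fun s : ℝ => s ^ (σ - 1) * ∫ ζ, (1 - (Sw Vs (s ^ (-(1/2) : ℝ)) ζ)⁻¹) * g ζ) =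
      fun s => ∫ ζ, ker σ ζ s * g ζ := by
    funext s; rw [← integral_const_mul]; congr 1; funext ζ; rw [ker]; ring
  have e2 : (fun ζ => Lz σ ζ * g ζ) = fun ζ => ∫ s in Set.Ioi (1:ℝ), ker σ ζ s * g ζ := by
    funext ζ; rw [Lz, integral_mul_const]
  rw [e1, e2]
  refine ⟨h.integral_prod_left, h.integral_prod_right, ?_⟩
  rw [integral_integral_swap (f := fun s ζ => ker σ ζ s * g ζ) h]
end KH

namespace KH
open SchwartzMap Function
open scoped FourierTransform LineDeriv ContDiff ComplexConjugate

/-- functions with two extra `η` weights -/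
def D2 (f : Z n → ℂ) : Prop := L2f f ∧ L2f (fun ζ => (sqJ Vs ζ : ℂ) * f ζ)

/-- `1 + L` weighted square norm -/
def ns (σ : ℝ) (f : Z n → ℂ) : ℝ := ∫ ζ, (1 + Lz σ ζ) * ‖f ζ‖ ^ 2

lemma ns_nonneg (σ : ℝ) (f : Z n → ℂ) : 0 ≤ ns σ f :=
  integral_nonneg fun ζ => by have := Lz_nonneg σ ζ; positivity

lemma sqJ_tg (J : Finset (Ix n)) : (fun ζ : Z n => (sqJ J ζ : ℂ)).HasTemperateGrowth := by
  have : (fun ζ : Z n => (sqJ J ζ : ℂ)) = fun ζ => ∑ j ∈ J, co j ζ * co j ζ := by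
    funext ζ; simp [sqJ, co, sq]
  rw [this]
  exact Function.HasTemperateGrowth.sum fun j _ => (co_tg j).mul (co_tg j)

lemma sD2 (θ : Sch n) : D2 θ := by
  refine ⟨sL2 θ, ?_⟩
  have : (fun ζ => (sqJ Vs ζ : ℂ) * θ ζ) = mu (fun ζ => (sqJ Vs ζ : ℂ)) θ := by
    funext ζ; rw [mu_apply (sqJ_tg _)]
  rw [this]; exact sL2 _

lemma D2.int {f : Z n → ℂ} (hf : D2 f) : Integrable (fun ζ => sqJ Vs ζ * ‖f ζ‖ ^ 2) := by
  have := (hf.1.ip_int hf.2).norm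
  refine this.congr (Filter.Eventually.of_forall fun ζ => ?_)
  simp only [norm_mul, RCLike.norm_conj, Complex.norm_real, Real.norm_eq_abs,
    abs_of_nonneg (sqJ_nonneg Vs ζ)]
  ring

lemma D2.Lint {σ : ℝ} (hσ1 : σ < 1) {f : Z n → ℂ} (hf : D2 f) :
    Integrable (fun ζ => Lz σ ζ * ‖f ζ‖ ^ 2) :=
  (fub hσ1 hf.1.sq.1 hf.int).2.1

lemma D2.nsint {σ : ℝ} (hσ1 : σ < 1) {f : Z n → ℂ} (hf : D2 f) :
    Integrable (fun ζ => (1 + Lz σ ζ) * ‖f ζ‖ ^ 2) := by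
  refine (hf.1.sq.add (hf.Lint hσ1)).congr (Filter.Eventually.of_forall fun ζ => ?_)
  simp only [Pi.add_apply]; ring

lemma ns_eq {σ : ℝ} (hσ1 : σ < 1) {f : Z n → ℂ} (hf : D2 f) :
    ns σ f = nq f + ∫ ζ, Lz σ ζ * ‖f ζ‖ ^ 2 := by
  rw [nq, ← integral_add hf.1.sq (hf.Lint hσ1), ns]
  congr 1; funext ζ; ring

lemma Lint_nonneg (σ : ℝ) (f : Z n → ℂ) : 0 ≤ ∫ ζ, Lz σ ζ * ‖f ζ‖ ^ 2 :=
  integral_nonneg fun ζ => by have := Lz_nonneg σ ζ; positivity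

lemma nq_le_ns {σ : ℝ} (hσ1 : σ < 1) {f : Z n → ℂ} (hf : D2 f) : nq f ≤ ns σ f := by
  rw [ns_eq hσ1 hf]; have := Lint_nonneg σ f; linarith

lemma ns_le {σ : ℝ} (hσ1 : σ < 1) {f g : Z n → ℂ} (hg : D2 g) {C : ℝ}
    (h : ∀ z, ‖f z‖ ≤ C * ‖g z‖) : ns σ f ≤ C ^ 2 * ns σ g := by
  rw [ns, ns, ← integral_const_mul]
  refine integral_mono_of_nonneg (Filter.Eventually.of_forall fun ζ => ?_)
    ((hg.nsint hσ1).const_mul _) (Filter.Eventually.of_forall fun z => ?_)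
  · have := Lz_nonneg σ ζ; simp only [Pi.zero_apply]; positivity
  · have h1 := h z
    have h2 := Lz_nonneg σ z
    have h3 : ‖f z‖ ^ 2 ≤ (C * ‖g z‖) ^ 2 := by gcongr
    simp only
    calc _ ≤ (1 + Lz σ z) * (C * ‖g z‖) ^ 2 := by gcongr
      _ = _ := by ring

/-- boundedness of coefficients on the fractional space -/
lemma ns_Aop {σ : ℝ} (hσ1 : σ < 1) {b : Z n → ℂ} (hb : CB b) :
    ∃ C, 0 ≤ C ∧ ∀ θ : Sch n, ns σ (Aop b θ) ≤ C * ns σ θ := by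
  obtain ⟨C0, hC0, h0⟩ := nq_Aop hb
  obtain ⟨C1, hC1, h1⟩ := qk_Aop hb
  set I := ∫ s in Set.Ioi (1:ℝ), s ^ (σ - 2) with hI
  have hI0 : 0 ≤ I := setIntegral_nonneg measurableSet_Ioi
    (fun s hs => by have : (0:ℝ) < s := one_pos.trans hs; positivity)
  refine ⟨C0 + C1 + C1 * I, by positivity, fun θ => ?_⟩
  obtain ⟨i1, -, i3⟩ := fub hσ1 (sD2 (Aop b θ)).1.sq.1 (sD2 (Aop b θ)).int
  obtain ⟨j1, -, j3⟩ := fub hσ1 (sD2 θ).1.sq.1 (sD2 θ).int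
  have key : ∫ ζ, Lz σ ζ * ‖Aop b θ ζ‖ ^ 2 ≤ C1 * (∫ ζ, Lz σ ζ * ‖θ ζ‖ ^ 2) + C1 * I * nq θ := by
    rw [i3, j3, mul_right_comm, hI, ← integral_const_mul, ← integral_const_mul,
      ← integral_add (j1.const_mul _) ((int_s hσ1).const_mul _)]
    refine setIntegral_mono_on i1 ((j1.const_mul _).add ((int_s hσ1).const_mul _))
      measurableSet_Ioi fun s hs => ?_
    have hs0 : (0:ℝ) < s := one_pos.trans hs
    have k := h1 (s ^ (-(1/2) : ℝ)) θ
    rw [kap_sq hs0] at k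
    have e : s ^ (σ - 2) = s ^ (σ - 1) * s⁻¹ := by
      rw [← Real.rpow_neg_one s, ← Real.rpow_add hs0]; ring_nf
    have hp : 0 ≤ s ^ (σ - 1) := by positivity
    have k2 := mul_le_mul_of_nonneg_left k hp
    simp only [qk] at k2
    rw [e]
    refine k2.trans (le_of_eq ?_)
    ring
  rw [ns_eq hσ1 (sD2 _), ns_eq hσ1 (sD2 _)]
  have k0 := h0 θ
  have k1 := Lint_nonneg σ (θ : Z n → ℂ)
  have k2 := nq_nonneg (n := n) θ
  nlinarith [mul_nonneg hC0 k1, mul_nonneg hC1 k2, mul_nonneg (mul_nonneg hC1 hI0) k1]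

lemma Qp_ip (κ : ℝ) (f g : Sch n) :
    (ip (mu (Qp κ) f) g).re = ∫ ζ, (1 - (Sw Vs κ ζ)⁻¹) * (conj (f ζ) * g ζ).re := by
  rw [ip]
  have := integral_re ((sL2 (mu (Qp κ) f)).ip_int (sL2 g))
  rw [← RCLike.re_eq_complex_re, ← this]
  congr 1; funext ζ
  rw [mu_apply (Qp_tg κ), Qp_eq, map_mul (starRingEnd ℂ), Complex.conj_ofReal, mul_assoc,
    RCLike.re_eq_complex_re, Complex.re_ofReal_mul]

lemma Lz_coer {σ : ℝ} (hσ1 : σ < 1) {a : Z n → ℝ} (hb : CB (fun z => (a z : ℂ))) {a₀ : ℝ}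
    (ha₀ : 0 < a₀) (h : ∀ z, a₀ ≤ a z) : ∃ C, 0 ≤ C ∧ ∀ θ : Sch n,
    a₀ / 2 * (∫ ζ, Lz σ ζ * ‖θ ζ‖ ^ 2) - C * nq θ ≤
      ∫ ζ, Lz σ ζ * (conj (θ ζ) * Aop (fun z => (a z : ℂ)) θ ζ).re := by
  obtain ⟨C1, hC1, h1⟩ := qk_coer hb ha₀ h
  set I := ∫ s in Set.Ioi (1:ℝ), s ^ (σ - 2) with hI
  have hI0 : 0 ≤ I := setIntegral_nonneg measurableSet_Ioi
    (fun s hs => by have : (0:ℝ) < s := one_pos.trans hs; positivity)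
  refine ⟨C1 * I, by positivity, fun θ => ?_⟩
  set A := Aop (fun z => (a z : ℂ))
  have hm : Integrable (fun ζ => (conj (θ ζ) * A θ ζ).re) :=
    ((sL2 θ).ip_int (sL2 (A θ))).re
  have hm2 : Integrable (fun ζ => sqJ Vs ζ * (conj (θ ζ) * A θ ζ).re) := by
    refine ((sD2 θ).1.ip_int (sD2 (A θ)).2).re.congr (Filter.Eventually.of_forall fun ζ => ?_)
    simp only
    rw [mul_left_comm, RCLike.re_eq_complex_re, Complex.re_ofReal_mul]
  obtain ⟨i1, -, i3⟩ := fub hσ1 hm.1 hm2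
  obtain ⟨j1, -, j3⟩ := fub hσ1 (sD2 θ).1.sq.1 (sD2 θ).int
  rw [i3, j3, mul_right_comm, hI, ← integral_const_mul, ← integral_const_mul,
      ← integral_sub (j1.const_mul _) ((int_s hσ1).const_mul _)]
  refine setIntegral_mono_on ((j1.const_mul _).sub ((int_s hσ1).const_mul _)) i1
      measurableSet_Ioi fun s hs => ?_
  have hs0 : (0:ℝ) < s := one_pos.trans hs
  have k := h1 (s ^ (-(1/2) : ℝ)) θ
  rw [kap_sq hs0, Qp_ip] at k
  have e : s ^ (σ - 2) = s ^ (σ - 1) * s⁻¹ := by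
    rw [← Real.rpow_neg_one s, ← Real.rpow_add hs0]; ring_nf
  have hp : 0 ≤ s ^ (σ - 1) := by positivity
  have k2 := mul_le_mul_of_nonneg_left k hp
  simp only [qk] at k2
  rw [e]
  refine (le_of_eq ?_).trans k2
  ring
end KH

namespace KH
open SchwartzMap Function
open scoped FourierTransform LineDeriv ContDiff ComplexConjugate

lemma rpow_tg {H : Type*} [NormedAddCommGroup H] [NormedSpace ℝ H] {f : H → ℝ}
    (hf : f.HasTemperateGrowth) (hpos : ∀ x, 1 / 2 < f x) (r : ℝ) :
    (fun x => f x ^ r).HasTemperateGrowth := by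
  set t := {y : ℝ | 1 / 2 < y}
  have ht : Set.range f ⊆ t := by
    rintro - ⟨y, rfl⟩
    exact hpos y
  have hdiff : ContDiffOn ℝ ∞ (fun x ↦ x ^ r) t :=
    contDiffOn_fun_id.rpow_const_of_ne fun x hx ↦ (lt_trans (by norm_num) hx).ne'
  have hunique : UniqueDiffOn ℝ t := (isOpen_lt' (1 / 2)).uniqueDiffOn
  apply HasTemperateGrowth.comp' ht hunique hdiff _ hf
  intro N
  obtain ⟨k, hk⟩ := exists_nat_ge (max r <| (N - r) * Real.log 2 / (Real.log (3 / 2)))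
  have hk₁ : r ≤ k := le_sup_left.trans hk
  have hl32 : 0 < Real.log (3 / 2) := Real.log_pos (by norm_num)
  have hk₂ : Real.log 2 * (N - r) ≤ (Real.log (3 / 2)) * k := by
    have := le_sup_right.trans hk
    rw [div_le_iff₀ hl32] at this
    linarith
  use k, ∑ k ∈ Finset.range (N + 1), ‖Polynomial.eval r (descPochhammer ℝ k)‖, by positivity
  intro n hn x hx
  have : ContDiffAt ℝ n (fun x ↦ x ^ r) x :=
    Real.contDiffAt_rpow_const <| Or.inl (lt_trans (by norm_num) hx).ne'
  rw [norm_iteratedFDerivWithin_eq_norm_iteratedDerivWithin,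
    iteratedDerivWithin_eq_iteratedDeriv hunique this hx, iteratedDeriv_eq_iterate,
    Real.iter_deriv_rpow_const, norm_mul]
  gcongr 1
  · have : n ∈ Finset.range (N + 1) := by grind
    apply Finset.single_le_sum (fun _ _ ↦ by positivity) this
  have hx' : 1 / 2 < x := by simpa [t] using hx
  have hx'' : 0 < x := lt_of_lt_of_le (by norm_num) hx'.le
  simp only [Real.norm_eq_abs]
  apply (Real.abs_rpow_le_abs_rpow _ _).trans
  by_cases! h : 0 ≤ r - n
  · have : r - n ≤ k := by simpa using hk₁.trans (by simp)
    rw [← Real.rpow_natCast]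
    exact (Real.rpow_le_rpow (by positivity) (by simp) h).trans
      (Real.rpow_le_rpow_of_exponent_le (by simp) this)
  have h : 0 < n - r := by grind
  calc
    _ = x ^ (-(n - r)) := by
      rw [neg_sub]
      congr
      simpa using hx''.le
    _ ≤ (2 : ℝ) ^ (n - r) := by
      rw [Real.rpow_neg_eq_inv_rpow]
      gcongr
      rw [inv_le_comm₀ hx'' (by norm_num)]
      linarith
    _ = Real.exp (Real.log 2 * (n - r)) := by
      rw [Real.rpow_def_of_pos]
      norm_num
    _ ≤ Real.exp (Real.log (3/2) * k) := by
      rw [Real.exp_le_exp]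
      refine le_trans ?_ hk₂
      have : (n : ℝ) ≤ N := by exact_mod_cast hn
      have h2 : 0 < Real.log 2 := Real.log_pos (by norm_num)
      nlinarith
    _ = (3/2 : ℝ) ^ k := by
      rw [← Real.rpow_natCast, Real.rpow_def_of_pos]
      norm_num
    _ ≤ _ := by
      gcongr
      rw [abs_of_pos hx'']; linarith

/-- hypotheses on the cut-off -/
structure Wc (w : E n → ℝ) : Prop where
  sm : ContDiff ℝ ∞ w
  b : ∀ η, 0 ≤ w η ∧ w η ≤ 1
  out : ∀ η : E n, 2 ≤ ‖η‖ → w η = 1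
  inn : ∀ η : E n, ‖η‖ ≤ 1 → w η = 0

/-- the symbol on phase space -/
def Fz (σ : ℝ) (w : E n → ℝ) (ζ : Z n) : ℝ := Fsym σ w (vC ζ)

lemma cpt_tg {f : E n → ℝ} (hf : ContDiff ℝ ∞ f) (hc : HasCompactSupport f) : f.HasTemperateGrowth :=
  (hc.toSchwartzMap hf).hasTemperateGrowth

lemma w_tg {w : E n → ℝ} (hw : Wc w) : w.HasTemperateGrowth := by
  have h1 : HasCompactSupport (fun η => 1 - w η) := by
    refine HasCompactSupport.intro (isCompact_closedBall (0 : E n) 2) fun x hx => ?_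
    simp only [Metric.mem_closedBall, dist_zero_right, not_le] at hx
    rw [hw.out x hx.le, sub_self]
  have h2 := cpt_tg (contDiff_const.sub hw.sm) h1
  have := (Function.HasTemperateGrowth.const (E := E n) (1:ℝ)).sub h2
  convert this using 1
  funext; simp

lemma Fsym_tg (σ : ℝ) {w : E n → ℝ} (hw : Wc w) : (Fsym σ w).HasTemperateGrowth := by
  let χ : ContDiffBump (0 : E n) := ⟨3/4, 1, by norm_num, by norm_num⟩
  have hχ : (χ : E n → ℝ).HasTemperateGrowth := cpt_tg χ.contDiff χ.hasCompactSupport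
  have hs : (fun η : E n => ‖η‖ ^ 2).HasTemperateGrowth := hasTemperateGrowth_norm_sq _
  have hρ : (fun η : E n => ‖η‖ ^ 2 + χ η).HasTemperateGrowth := hs.add hχ
  have hpos : ∀ η : E n, 1 / 2 < ‖η‖ ^ 2 + χ η := by
    intro η
    by_cases h : ‖η‖ ≤ 3/4
    · have : χ η = 1 := χ.one_of_mem_closedBall (by simpa using h)
      rw [this]; nlinarith [sq_nonneg ‖η‖]
    · have := χ.nonneg (x := η)
      push Not at h
      nlinarith
  have h1 := ((rpow_tg hρ hpos σ).mul (w_tg hw)).add (hs.mul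
    ((Function.HasTemperateGrowth.const (E := E n) (1:ℝ)).sub (w_tg hw)))
  refine (congrArg Function.HasTemperateGrowth ?_).mp h1
  symm
  funext η
  simp only [Fsym, Pi.add_apply, Pi.mul_apply, Pi.sub_apply]
  congr 1
  by_cases h : ‖η‖ ≤ 1
  · rw [hw.inn η h]; simp
  · push Not at h
    have : χ η = 0 := χ.zero_of_le_dist (by simpa using h.le)
    rw [this, add_zero, Real.rpow_mul (norm_nonneg _)]
    norm_num

/-- projection to velocity frequencies -/
def vL : Z n →L[ℝ] E n := LinearMap.toContinuousLinearMap
  { toFun := vC, map_add' := fun x y => by ext; simp [vC], map_smul' := fun c x => by ext; simp [vC] }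

lemma vL_apply (ζ : Z n) : vL ζ = vC ζ := rfl

lemma Fz_tg (σ : ℝ) {w : E n → ℝ} (hw : Wc w) : (fun ζ : Z n => (Fz σ w ζ : ℂ)).HasTemperateGrowth :=
  Function.Complex.hasTemperateGrowth_ofReal.comp ((Fsym_tg σ hw).comp vL.hasTemperateGrowth)

lemma Fz_cont (σ : ℝ) {w : E n → ℝ} (hw : Wc w) : Continuous (Fz (n := n) σ w) :=
  ((Fsym_tg σ hw).comp vL.hasTemperateGrowth).1.continuous

lemma sq_rpow (σ : ℝ) (ζ : Z n) : sqJ Vs ζ ^ σ = ‖vC ζ‖ ^ (2 * σ) := by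
  rw [sqJ_Vs, Real.rpow_mul (norm_nonneg _)]; norm_num

lemma Fz_approx {σ : ℝ} (hσ0 : 0 < σ) (hσ1 : σ < 1) {w : E n → ℝ} (hw : Wc w) (ζ : Z n) :
    |Fz σ w ζ - sqJ Vs ζ ^ σ| ≤ 4 := by
  rw [sq_rpow, Fz, Fsym]
  set r := ‖vC ζ‖
  have hr : 0 ≤ r := norm_nonneg _
  obtain ⟨b0, b1⟩ := hw.b (vC ζ)
  by_cases h : 2 ≤ r
  · rw [hw.out _ h]; norm_num
  · push Not at h
    have e : r ^ (2 * σ) * w (vC ζ) + r ^ 2 * (1 - w (vC ζ)) - r ^ (2 * σ) =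
      (1 - w (vC ζ)) * (r ^ 2 - r ^ (2 * σ)) := by ring
    have h1 : 0 ≤ r ^ (2 * σ) := by positivity
    have h2 : r ^ (2 * σ) ≤ 4 := by
      calc r ^ (2 * σ) ≤ 2 ^ (2 * σ) := Real.rpow_le_rpow hr h.le (by linarith)
        _ ≤ 2 ^ (2 : ℝ) := Real.rpow_le_rpow_of_exponent_le (by norm_num) (by linarith)
        _ = 4 := by norm_num
    have h3 : r ^ 2 ≤ 4 := by nlinarith
    rw [e, abs_mul, abs_of_nonneg (by linarith : 0 ≤ 1 - w (vC ζ))]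
    have : |r ^ 2 - r ^ (2 * σ)| ≤ 4 := abs_le.2 ⟨by nlinarith, by nlinarith⟩
    nlinarith [abs_nonneg (r ^ 2 - r ^ (2 * σ))]

lemma Fz_nonneg (σ : ℝ) {w : E n → ℝ} (hw : Wc w) (ζ : Z n) : 0 ≤ Fz σ w ζ := by
  obtain ⟨b0, b1⟩ := hw.b (vC ζ)
  rw [Fz, Fsym]
  have : 0 ≤ 1 - w (vC ζ) := by linarith
  positivity

/-- decomposition `F = c Lz + bounded` -/
lemma Fz_dec (hn : 1 ≤ n) {σ : ℝ} (hσ0 : 0 < σ) (hσ1 : σ < 1) {w : E n → ℝ} (hw : Wc w) :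
    ∃ C, 0 ≤ C ∧ ∀ ζ : Z n, |Fz σ w ζ - (cσ σ)⁻¹ * Lz σ ζ| ≤ C := by
  obtain ⟨C, hC, h⟩ := Lz_approx (n := n) hσ0 hσ1
  have hc := cσ_pos hn hσ0 hσ1
  refine ⟨4 + (cσ σ)⁻¹ * C, by positivity, fun ζ => ?_⟩
  have e : Fz σ w ζ - (cσ σ)⁻¹ * Lz σ ζ = (Fz σ w ζ - sqJ Vs ζ ^ σ) -
    (cσ σ)⁻¹ * (Lz σ ζ - cσ σ * (sqJ Vs ζ) ^ σ) := by
    field_simp; ring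
  rw [e]
  refine (abs_sub _ _).trans (add_le_add (Fz_approx hσ0 hσ1 hw ζ) ?_)
  rw [abs_mul, abs_of_pos (inv_pos.2 hc)]
  exact mul_le_mul_of_nonneg_left (h ζ) (inv_pos.2 hc).le

lemma Fz_le (hn : 1 ≤ n) {σ : ℝ} (hσ0 : 0 < σ) (hσ1 : σ < 1) {w : E n → ℝ} (hw : Wc w) :
    ∃ C, 0 ≤ C ∧ ∀ ζ : Z n, Fz σ w ζ ≤ C * (1 + Lz σ ζ) := by
  obtain ⟨C, hC, h⟩ := Fz_dec (n := n) hn hσ0 hσ1 hw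
  have hc := inv_pos.2 (cσ_pos hn hσ0 hσ1)
  refine ⟨(cσ σ)⁻¹ + C, by positivity, fun ζ => ?_⟩
  have h1 := (abs_le.1 (h ζ)).2
  have h2 := Lz_nonneg σ ζ
  have h3 := mul_nonneg hC h2
  nlinarith

lemma Fz_le' {σ : ℝ} (hσ0 : 0 < σ) (hσ1 : σ < 1) {w : E n → ℝ} (hw : Wc w) (ζ : Z n) :
    Fz σ w ζ ≤ 5 * (1 + sqJ Vs ζ) := by
  have h := (abs_le.1 (Fz_approx hσ0 hσ1 hw ζ)).2
  have h0 := sqJ_nonneg Vs ζ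
  have : sqJ Vs ζ ^ σ ≤ 1 + sqJ Vs ζ := by
    calc sqJ Vs ζ ^ σ ≤ (1 + sqJ Vs ζ) ^ σ := Real.rpow_le_rpow h0 (by linarith) hσ0.le
      _ ≤ (1 + sqJ Vs ζ) ^ (1 : ℝ) := Real.rpow_le_rpow_of_exponent_le (by linarith) hσ1.le
      _ = _ := Real.rpow_one _
  linarith

lemma D2.F {σ : ℝ} (hσ0 : 0 < σ) (hσ1 : σ < 1) {w : E n → ℝ} (hw : Wc w) {f : Z n → ℂ} (hf : D2 f) :
    L2f (fun ζ => (Fz σ w ζ : ℂ) * f ζ) := by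
  have h1 : L2f (fun ζ => 5 * (f ζ + (sqJ Vs ζ : ℂ) * f ζ)) := (hf.1.add hf.2).const_mul 5
  refine h1.mono (((Complex.continuous_ofReal.comp (Fz_cont σ hw)).aestronglyMeasurable).mul hf.1.1)
    (Filter.Eventually.of_forall fun ζ => ?_)
  have e : f ζ + (sqJ Vs ζ : ℂ) * f ζ = ((1 + sqJ Vs ζ : ℝ) : ℂ) * f ζ := by push_cast; ring
  rw [e, norm_mul, norm_mul, norm_mul, Complex.norm_real, Complex.norm_real, Real.norm_of_nonneg (Fz_nonneg σ hw ζ),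
    Real.norm_of_nonneg (by linarith [sqJ_nonneg Vs ζ]), ← mul_assoc]
  gcongr
  simpa using Fz_le' hσ0 hσ1 hw ζ

/-- half power weight -/
lemma D2.half {σ : ℝ} (hσ1 : σ < 1) {f : Z n → ℂ} (hf : D2 f) :
    L2f (fun ζ => (Real.sqrt (1 + Lz σ ζ) : ℂ) * f ζ) ∧
    nq (fun ζ => (Real.sqrt (1 + Lz σ ζ) : ℂ) * f ζ) = ns σ f := by
  have e : ∀ ζ, ‖(Real.sqrt (1 + Lz σ ζ) : ℂ) * f ζ‖ ^ 2 = (1 + Lz σ ζ) * ‖f ζ‖ ^ 2 := by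
    intro ζ
    have := Lz_nonneg σ ζ
    rw [norm_mul, mul_pow, Complex.norm_real, Real.norm_of_nonneg (Real.sqrt_nonneg _), Real.sq_sqrt (by linarith)]
  constructor
  · refine (memLp_two_iff_integrable_sq_norm ?_).2 ?_
    · refine AEStronglyMeasurable.mul ?_ hf.1.1
      exact Complex.continuous_ofReal.comp_aestronglyMeasurable
        (Real.continuous_sqrt.comp_aestronglyMeasurable
          (aestronglyMeasurable_const.add (Lz_meas σ).aestronglyMeasurable))
    · simp_rw [e]; exact hf.nsint hσ1
  · simp only [nq, ns, e]

lemma F_form (hn : 1 ≤ n) {σ : ℝ} (hσ0 : 0 < σ) (hσ1 : σ < 1) {w : E n → ℝ} (hw : Wc w) :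
    ∃ C, 0 ≤ C ∧ ∀ f g : Z n → ℂ, D2 f → D2 g →
      ‖ip (fun ζ => (Fz σ w ζ : ℂ) * f ζ) g‖ ≤ C * Real.sqrt (ns σ f) * Real.sqrt (ns σ g) := by
  obtain ⟨C, hC, h⟩ := Fz_le (n := n) hn hσ0 hσ1 hw
  refine ⟨C, hC, fun f g hf hg => ?_⟩
  obtain ⟨hf1, hf2⟩ := hf.half hσ1
  obtain ⟨hg1, hg2⟩ := hg.half hσ1
  set s : Z n → ℝ := fun ζ => Real.sqrt (1 + Lz σ ζ) with hs
  have hs2 : ∀ ζ, s ζ ^ 2 = 1 + Lz σ ζ := fun ζ => Real.sq_sqrt (by linarith [Lz_nonneg σ ζ])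
  have hs1 : ∀ ζ, 1 ≤ s ζ := fun ζ => Real.one_le_sqrt.2 (by linarith [Lz_nonneg σ ζ])
  have e : ip (fun ζ => (Fz σ w ζ : ℂ) * f ζ) g =
      ip (fun ζ => ((Fz σ w ζ / s ζ ^ 2 : ℝ) : ℂ) * ((s ζ : ℂ) * f ζ)) (fun ζ => (s ζ : ℂ) * g ζ) := by
    unfold ip
    congr 1; funext ζ
    have : (s ζ : ℂ) ≠ 0 := by
      have := hs1 ζ; norm_cast; linarith
    simp only [map_mul, Complex.conj_ofReal]
    push_cast
    field_simp
  have hb : ∀ ζ, ‖((Fz σ w ζ / s ζ ^ 2 : ℝ) : ℂ) * ((s ζ : ℂ) * f ζ)‖ ≤ C * ‖(s ζ : ℂ) * f ζ‖ := by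
    intro ζ
    rw [norm_mul]
    gcongr
    rw [Complex.norm_real, Real.norm_of_nonneg (div_nonneg (Fz_nonneg σ hw ζ) (sq_nonneg _)), div_le_iff₀, hs2]
    · exact h ζ
    · have := hs1 ζ; positivity
  have hm : L2f (fun ζ => ((Fz σ w ζ / s ζ ^ 2 : ℝ) : ℂ) * ((s ζ : ℂ) * f ζ)) := by
    refine MemLp.of_le_mul (c := C) hf1 ?_ (Filter.Eventually.of_forall hb)
    refine AEStronglyMeasurable.mul ?_ hf1.1
    refine Complex.continuous_ofReal.comp_aestronglyMeasurable ?_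
    simp_rw [hs2]
    exact ((Fz_cont σ hw).measurable.div (measurable_const.add (Lz_meas σ).measurable)).aestronglyMeasurable
  rw [e]
  refine (ip_le hm hg1).trans ?_
  have h1 := nr_le hf1 hC hb
  have h1' : nr (fun ζ => (s ζ : ℂ) * f ζ) = Real.sqrt (ns σ f) := by rw [nr, hf2]
  rw [h1'] at h1
  have h2 : nr (fun ζ => (s ζ : ℂ) * g ζ) = Real.sqrt (ns σ g) := by rw [nr, hg2]
  rw [h2]
  exact mul_le_mul_of_nonneg_right h1 (Real.sqrt_nonneg _)

lemma Fcoer (hn : 1 ≤ n) {σ : ℝ} (hσ0 : 0 < σ) (hσ1 : σ < 1) {w : E n → ℝ} (hw : Wc w)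
    {a : Z n → ℝ} (hb : CB (fun z => (a z : ℂ))) {a₀ : ℝ} (ha₀ : 0 < a₀) (h : ∀ z, a₀ ≤ a z) :
    ∃ c C, 0 < c ∧ 0 ≤ C ∧ ∀ θ : Sch n, c * ns σ θ - C * nq θ ≤
      (ip (fun ζ => (Fz σ w ζ : ℂ) * θ ζ) (Aop (fun z => (a z : ℂ)) θ)).re := by
  obtain ⟨C1, hC1, h1⟩ := Lz_coer hσ1 hb ha₀ h
  obtain ⟨C2, hC2, h2⟩ := Fz_dec (n := n) hn hσ0 hσ1 hw
  obtain ⟨C3, hC3, h3⟩ := nr_Aop hb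
  have hc := inv_pos.2 (cσ_pos hn hσ0 hσ1)
  set c := (cσ σ)⁻¹
  refine ⟨c * (a₀ / 2), c * C1 + C2 * C3 + c * (a₀ / 2), by positivity, by positivity, fun θ => ?_⟩
  have hD := sD2 θ
  have hF := hD.F hσ0 hσ1 hw
  set A := Aop (fun z => (a z : ℂ)) θ
  have hinteg := (hF.ip_int (sL2 A))
  have e1 : (ip (fun ζ => (Fz σ w ζ : ℂ) * θ ζ) A).re = ∫ ζ, Fz σ w ζ * (conj (θ ζ) * A ζ).re := by
    unfold ip
    rw [← RCLike.re_eq_complex_re, ← integral_re hinteg]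
    congr 1; funext ζ
    simp only [map_mul (starRingEnd ℂ), Complex.conj_ofReal, RCLike.re_eq_complex_re]
    rw [mul_assoc, Complex.re_ofReal_mul]
  have i1 : Integrable (fun ζ => Fz σ w ζ * (conj (θ ζ) * A ζ).re) := by
    have := hinteg.re
    refine this.congr (Filter.Eventually.of_forall fun ζ => ?_)
    simp only [map_mul (starRingEnd ℂ), Complex.conj_ofReal, RCLike.re_eq_complex_re]
    rw [mul_assoc, Complex.re_ofReal_mul]
  have i2 : Integrable (fun ζ => ‖θ ζ‖ * ‖A ζ‖) := by
    have := ((sL2 θ).ip_int (sL2 A)).norm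
    simpa using this
  have habs : ∀ ζ, |(conj (θ ζ) * A ζ).re| ≤ ‖θ ζ‖ * ‖A ζ‖ := fun ζ => by
    refine (Complex.abs_re_le_norm _).trans ?_
    simp
  have i4 : Integrable (fun ζ => (Fz σ w ζ - c * Lz σ ζ) * (conj (θ ζ) * A ζ).re) := by
    refine (i2.const_mul C2).mono' ?_ (Filter.Eventually.of_forall fun ζ => ?_)
    · refine AEStronglyMeasurable.mul ?_ ?_
      · exact ((Fz_cont σ hw).measurable.sub ((Lz_meas σ).measurable.const_mul c)).aestronglyMeasurable
      · exact (Complex.continuous_re.comp_aestronglyMeasurable ((sL2 θ).ip_int (sL2 A)).1)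
    · rw [Real.norm_eq_abs, abs_mul]
      exact mul_le_mul (h2 ζ) (habs ζ) (abs_nonneg _) hC2
  have i3 : Integrable (fun ζ => c * (Lz σ ζ * (conj (θ ζ) * A ζ).re)) := by
    refine (i1.sub i4).congr (Filter.Eventually.of_forall fun ζ => ?_)
    simp only [Pi.sub_apply]; ring
  have e2 : ∫ ζ, Fz σ w ζ * (conj (θ ζ) * A ζ).re =
      c * (∫ ζ, Lz σ ζ * (conj (θ ζ) * A ζ).re) + ∫ ζ, (Fz σ w ζ - c * Lz σ ζ) * (conj (θ ζ) * A ζ).re := by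
    rw [← integral_const_mul, ← integral_add i3 i4]
    congr 1; funext ζ; ring
  have e3 : -(C2 * C3 * nq θ) ≤ ∫ ζ, (Fz σ w ζ - c * Lz σ ζ) * (conj (θ ζ) * A ζ).re := by
    have b1 : ∫ ζ, ‖θ ζ‖ * ‖A ζ‖ ≤ C3 * nq θ := by
      have b2 := ip_le (sL2 θ).norm.ofReal (sL2 A).norm.ofReal (n := n)
      have b3 : nr (fun ζ => ((‖θ ζ‖ : ℝ) : ℂ)) = nr θ := by simp [nr, nq]
      have b4 : nr (fun ζ => ((‖A ζ‖ : ℝ) : ℂ)) = nr A := by simp [nr, nq]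
      have b5 : ip (fun ζ => ((‖θ ζ‖ : ℝ) : ℂ)) (fun ζ => ((‖A ζ‖ : ℝ) : ℂ)) = ((∫ ζ, ‖θ ζ‖ * ‖A ζ‖ : ℝ) : ℂ) := by
        unfold ip; refine Eq.trans ?_ (integral_ofReal (𝕜 := ℂ)); congr 1; funext ζ; simp
      have b6 : 0 ≤ ∫ ζ, ‖θ ζ‖ * ‖A ζ‖ := integral_nonneg fun _ => by positivity
      erw [b5] at b2
      rw [Complex.norm_real, Real.norm_of_nonneg b6] at b2
      refine b2.trans ?_
      erw [b3, b4]
      rw [← nr_sq θ]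
      have := mul_le_mul_of_nonneg_left (h3 θ) (nr_nonneg θ)
      linarith
    have := norm_integral_le_of_norm_le (i2.const_mul C2) (Filter.Eventually.of_forall fun ζ => by
      change ‖(Fz σ w ζ - c * Lz σ ζ) * (conj (θ ζ) * A ζ).re‖ ≤ C2 * (‖θ ζ‖ * ‖A ζ‖)
      rw [Real.norm_eq_abs, abs_mul]
      exact mul_le_mul (h2 ζ) (habs ζ) (abs_nonneg _) hC2)
    rw [integral_const_mul, Real.norm_eq_abs] at this
    have h5 := (abs_le.1 this).1
    have h6 := mul_le_mul_of_nonneg_left b1 hC2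
    linarith
  rw [e1, e2]
  have h7 := mul_le_mul_of_nonneg_left (h1 θ) hc.le
  have h8 := ns_eq hσ1 hD
  rw [h8]
  linarith

end KH

namespace KH
open SchwartzMap Function
open scoped FourierTransform LineDeriv ContDiff ComplexConjugate

/-- operator families, uniformly bounded -/
inductive Fam {n : ℕ} {ι : Type} : (ι → Sch n →L[ℂ] Sch n) → Prop
  | base (b : Z n → ℂ) (hb : CB b) : Fam (fun _ => Aop b)
  | left (M : ι → Z n → ℂ) (T : ι → Sch n →L[ℂ] Sch n) (hM : ∀ i, (M i).HasTemperateGrowth)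
      (hM1 : ∀ i z, ‖M i z‖ ≤ 1) (hT : Fam T) : Fam (fun i => (mu (M i)).comp (T i))
  | right (M : ι → Z n → ℂ) (T : ι → Sch n →L[ℂ] Sch n) (hM : ∀ i, (M i).HasTemperateGrowth)
      (hM1 : ∀ i z, ‖M i z‖ ≤ 1) (hT : Fam T) : Fam (fun i => (T i).comp (mu (M i)))
  | add (T T' : ι → Sch n →L[ℂ] Sch n) (hT : Fam T) (hT' : Fam T') : Fam (fun i => T i + T' i)

variable {ι : Type}

lemma CB_zero : CB (fun _ : Z n => (0 : ℂ)) := by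
  refine ⟨contDiff_const, fun k => ⟨0, fun z => ?_⟩⟩
  simp [show (fun _ : Z n => (0:ℂ)) = 0 from rfl]

lemma mu_const (c : ℂ) (θ : Sch n) : mu (fun _ => c) θ = c • θ := by
  ext z; rw [mu_apply (Function.HasTemperateGrowth.const c)]; simp

lemma Fam.smul {T : ι → Sch n →L[ℂ] Sch n} (hT : Fam T) (c : ι → ℂ) (hc : ∀ i, ‖c i‖ ≤ 1) :
    Fam (fun i => c i • T i) := by
  have := Fam.left (fun i _ => c i) T (fun i => Function.HasTemperateGrowth.const _) (fun i _ => hc i) hT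
  convert this using 1
  funext i
  ext1 θ
  simp [mu_const]

lemma Fam.zero : Fam (fun _ : ι => (0 : Sch n →L[ℂ] Sch n)) := by
  have := (Fam.base (ι := ι) (n := n) _ CB_zero).smul (fun _ => 0) (by simp)
  simpa using this

lemma Fam.sum {α : Type*} (s : Finset α) (T : α → ι → Sch n →L[ℂ] Sch n) (hT : ∀ a, Fam (T a)) :
    Fam (fun i => ∑ a ∈ s, T a i) := by
  classical
  induction s using Finset.induction_on with
  | empty => simpa using Fam.zero
  | insert a s ha ih => simp_rw [Finset.sum_insert ha]; exact Fam.add _ _ (hT a) ih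

lemma ns_add_le {σ : ℝ} (hσ1 : σ < 1) (θ φ : Sch n) :
    ns σ (θ + φ : Sch n) ≤ 2 * ns σ θ + 2 * ns σ φ := by
  have i1 := (sD2 θ).nsint hσ1
  have i2 := (sD2 φ).nsint hσ1
  unfold ns
  rw [← integral_const_mul, ← integral_const_mul, ← integral_add (i1.const_mul 2) (i2.const_mul 2)]
  refine integral_mono ((sD2 (θ + φ)).nsint hσ1) ((i1.const_mul 2).add (i2.const_mul 2)) fun ζ => ?_
  have h0 := Lz_nonneg σ ζ
  have h1 : ‖θ ζ + φ ζ‖ ^ 2 ≤ 2 * ‖θ ζ‖ ^ 2 + 2 * ‖φ ζ‖ ^ 2 := by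
    have := norm_add_le (θ ζ) (φ ζ)
    have h3 : ‖θ ζ + φ ζ‖ ^ 2 ≤ (‖θ ζ‖ + ‖φ ζ‖) ^ 2 := by gcongr
    nlinarith [sq_nonneg (‖θ ζ‖ - ‖φ ζ‖)]
  simp only [_root_.add_apply]
  nlinarith

lemma Fam.bound {σ : ℝ} (hσ1 : σ < 1) {T : ι → Sch n →L[ℂ] Sch n} (hT : Fam T) :
    ∃ C, 0 ≤ C ∧ ∀ i θ, nr (T i θ) ≤ C * nr θ ∧ ns σ (T i θ) ≤ C * ns σ θ := by
  induction hT with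
  | base b hb =>
    obtain ⟨C, hC, h⟩ := nr_Aop hb
    obtain ⟨D, hD, h'⟩ := ns_Aop hσ1 hb
    refine ⟨max C D, le_max_of_le_left hC, fun i θ => ⟨(h θ).trans ?_, (h' θ).trans ?_⟩⟩
    · exact mul_le_mul_of_nonneg_right (le_max_left _ _) (nr_nonneg _)
    · exact mul_le_mul_of_nonneg_right (le_max_right _ _) (ns_nonneg _ _)
  | left M T hM hM1 hT ih =>
    obtain ⟨C, hC, h⟩ := ih
    have hb : ∀ i (φ : Sch n) z, ‖mu (M i) φ z‖ ≤ 1 * ‖φ z‖ := fun i φ z => by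
      rw [mu_apply (hM i), norm_mul]
      exact mul_le_mul_of_nonneg_right (hM1 i z) (norm_nonneg _)
    refine ⟨C, hC, fun i θ => ⟨?_, ?_⟩⟩
    · have := nr_le (sL2 (T i θ)) zero_le_one (hb i (T i θ))
      exact (this.trans (by rw [one_mul])).trans (h i θ).1
    · have := ns_le hσ1 (sD2 (T i θ)) (hb i (T i θ))
      exact (this.trans (by rw [one_pow, one_mul])).trans (h i θ).2
  | right M T hM hM1 hT ih =>
    obtain ⟨C, hC, h⟩ := ih
    have hb : ∀ i (φ : Sch n) z, ‖mu (M i) φ z‖ ≤ 1 * ‖φ z‖ := fun i φ z => by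
      rw [mu_apply (hM i), norm_mul]
      exact mul_le_mul_of_nonneg_right (hM1 i z) (norm_nonneg _)
    refine ⟨C, hC, fun i θ => ⟨?_, ?_⟩⟩
    · have := nr_le (sL2 θ) zero_le_one (hb i θ)
      rw [one_mul] at this
      exact (h i (mu (M i) θ)).1.trans (mul_le_mul_of_nonneg_left this hC)
    · have := ns_le hσ1 (sD2 θ) (hb i θ)
      rw [one_pow, one_mul] at this
      exact (h i (mu (M i) θ)).2.trans (mul_le_mul_of_nonneg_left this hC)
  | add T T' hT hT' ih ih' =>
    obtain ⟨C, hC, h⟩ := ih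
    obtain ⟨D, hD, h'⟩ := ih'
    refine ⟨2 * C + 2 * D, by positivity, fun i θ => ⟨?_, ?_⟩⟩
    · have h1 := nr_add_le (sL2 (T i θ)) (sL2 (T' i θ))
      have h2 := (h i θ).1
      have h3 := (h' i θ).1
      have h4 := mul_nonneg hC (nr_nonneg θ)
      have h5 := mul_nonneg hD (nr_nonneg θ)
      refine h1.trans ?_
      linarith
    · have h1 := ns_add_le hσ1 (T i θ) (T' i θ)
      have h2 := (h i θ).2
      have h3 := (h' i θ).2
      refine h1.trans ?_
      linarith

/-- conjugation property -/
def CJ {n : ℕ} {ι : Type} (ϑ : ι → ℝ) (W V : ι → Sch n →L[ℂ] Sch n) : Prop :=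
  ∀ T : ι → Sch n →L[ℂ] Sch n, Fam T → ∃ T' : ι → Sch n →L[ℂ] Sch n, Fam T' ∧
    ∀ i θ, V i (T i (W i θ)) = T i θ + (ϑ i : ℂ) • T' i θ

lemma CJ.id (ϑ : ι → ℝ) : CJ (n := n) ϑ (fun _ => 1) (fun _ => 1) := by
  intro T hT
  exact ⟨_, Fam.zero, fun i θ => by simp⟩

lemma CJ.comp {ϑ : ι → ℝ} (hϑ : ∀ i, 0 < ϑ i ∧ ϑ i ≤ 1) {W V W' V' : ι → Sch n →L[ℂ] Sch n}
    (h : CJ ϑ W V) (h' : CJ ϑ W' V') : CJ ϑ (fun i => W i * W' i) (fun i => V' i * V i) := by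
  intro T hT
  obtain ⟨T1, hT1, e1⟩ := h T hT
  obtain ⟨T2, hT2, e2⟩ := h' T hT
  obtain ⟨T3, hT3, e3⟩ := h' T1 hT1
  refine ⟨_, Fam.add _ _ hT2 (Fam.add _ _ hT1 (hT3.smul (fun i => (ϑ i : ℂ)) fun i => ?_)), fun i θ => ?_⟩
  · simpa [abs_of_pos (hϑ i).1] using (hϑ i).2
  · simp only [mul_apply_eq_comp, e1, map_add, map_smul, e2, e3, _root_.add_apply,
      _root_.smul_apply, smul_add]
    abel

lemma CJ.pow {ϑ : ι → ℝ} (hϑ : ∀ i, 0 < ϑ i ∧ ϑ i ≤ 1) {W V : ι → Sch n →L[ℂ] Sch n}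
    (h : CJ ϑ W V) (k : ℕ) : CJ ϑ (fun i => W i ^ k) (fun i => V i ^ k) := by
  induction k with
  | zero => simpa using CJ.id ϑ
  | succ k ih =>
    have := CJ.comp hϑ h ih
    simp_rw [pow_succ' (W _)]
    simp_rw [pow_succ (V _)]
    exact this

lemma mu_Sp_pow (J : Finset (Ix n)) (κ r : ℝ) (k : ℕ) :
    (mu (Sp J κ r)) ^ k = mu (Sp J κ (k * r)) := by
  induction k with
  | zero => ext1 θ; simp [mu_Sp_zero]
  | succ k ih =>
    rw [pow_succ, ih]; ext1 θ
    rw [mul_apply_eq_comp, mu_Sp]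
    congr 2; push_cast; ring_nf

/-- first order multiplier -/
def M1 (J : Finset (Ix n)) (κ ϑ : ℝ) (j : Ix n) : Z n → ℂ :=
  fun ζ => ((κ / ϑ * 2 * κ : ℝ) : ℂ) * (co j ζ * Sp J κ (-1) ζ)
/-- zeroth order multiplier -/
def M2 (J : Finset (Ix n)) (κ ϑ : ℝ) : Z n → ℂ := fun ζ => ((κ / ϑ * κ : ℝ) : ℂ) * Sp J κ (-1) ζ

lemma M1_tg (J : Finset (Ix n)) (κ ϑ : ℝ) (j : Ix n) : (M1 J κ ϑ j).HasTemperateGrowth :=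
  (Function.HasTemperateGrowth.const _).mul ((co_tg j).mul (Sp_tg _ _ _))
lemma M2_tg (J : Finset (Ix n)) (κ ϑ : ℝ) : (M2 J κ ϑ).HasTemperateGrowth :=
  (Function.HasTemperateGrowth.const _).mul (Sp_tg _ _ _)

lemma M1_le (J : Finset (Ix n)) {κ ϑ : ℝ} (hκ : 0 < κ) (h : κ ≤ ϑ) {j : Ix n} (hj : j ∈ J) (ζ : Z n) :
    ‖M1 J κ ϑ j ζ‖ ≤ 1 := by
  have hϑ : 0 < ϑ := hκ.trans_le h
  have h1 := Sw_pos J κ ζ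
  have h2 : (κ * |ζ j|) ^ 2 ≤ κ ^ 2 * sqJ J ζ := by
    rw [mul_pow, sq_abs]
    gcongr
    exact Finset.single_le_sum (f := fun j => ζ j ^ 2) (fun _ _ => sq_nonneg _) hj
  have h3 : 2 * (κ * |ζ j|) ≤ Sw J κ ζ := by
    rw [Sw]; nlinarith [sq_nonneg (κ * |ζ j| - 1)]
  rw [M1, Sp_neg_one, co, ← Complex.ofReal_mul, ← Complex.ofReal_mul, Complex.norm_real, Real.norm_eq_abs,
    abs_mul, abs_mul (ζ j), abs_of_pos (by positivity), abs_of_pos (inv_pos.2 h1)]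
  have h4 : κ / ϑ ≤ 1 := (div_le_one hϑ).2 h
  calc κ / ϑ * 2 * κ * (|ζ j| * (Sw J κ ζ)⁻¹) = κ / ϑ * (2 * (κ * |ζ j|) / Sw J κ ζ) := by
        rw [div_eq_mul_inv _ (Sw J κ ζ)]; ring
    _ ≤ 1 * 1 := by
        gcongr
        exact (div_le_one h1).2 h3
    _ = 1 := one_mul _

lemma M2_le (J : Finset (Ix n)) {κ ϑ : ℝ} (hκ : 0 < κ) (h : κ ≤ ϑ) (h1 : ϑ ≤ 1) (ζ : Z n) :
    ‖M2 J κ ϑ ζ‖ ≤ 1 := by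
  have hϑ : 0 < ϑ := hκ.trans_le h
  have h2 := Sw_ge J κ ζ
  rw [M2, Sp_neg_one, ← Complex.ofReal_mul, Complex.norm_real, Real.norm_eq_abs, abs_of_pos (by positivity)]
  have h4 : κ / ϑ ≤ 1 := (div_le_one hϑ).2 h
  calc κ / ϑ * κ * (Sw J κ ζ)⁻¹ ≤ 1 * 1 * 1 := by
        gcongr
        · exact h.trans h1
        · exact inv_le_one_of_one_le₀ h2
    _ = 1 := by norm_num

lemma mu_Sp_one (J : Finset (Ix n)) (κ : ℝ) (θ : Sch n) :
    mu (Sp J κ 1) θ = θ + ((κ ^ 2 : ℝ) : ℂ) • ∑ j ∈ J, mu (co j) (mu (co j) θ) := by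
  ext z
  rw [mu_apply (Sp_tg _ _ _), Sp_one, Sw, sqJ, _root_.add_apply, _root_.smul_apply, _root_.sum_apply]
  simp only [mu_apply (co_tg _)]
  push_cast
  simp only [co, smul_eq_mul]
  rw [add_mul, one_mul, mul_assoc, Finset.sum_mul]
  congr 2
  refine Finset.sum_congr rfl fun j _ => by ring

/-- commutator with `S` -/
lemma S_Aop {b : Z n → ℂ} (hb : CB b) (J : Finset (Ix n)) (κ : ℝ) (θ : Sch n) :
    Aop b (mu (Sp J κ 1) θ) = mu (Sp J κ 1) (Aop b θ) + ((κ ^ 2 : ℝ) : ℂ) • ∑ j ∈ J,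
      (-((2 : ℂ) • mu (co j) (Aop (dj j b) θ)) + Aop (dj j (dj j b)) θ) := by
  rw [mu_Sp_one, mu_Sp_one, map_add, map_smul, map_sum, add_assoc, ← smul_add, ← Finset.sum_add_distrib]
  congr 2
  refine Finset.sum_congr rfl fun j _ => ?_
  rw [co_Aop hb, map_add, co_Aop hb, co_Aop (hb.dj j), two_smul]
  abel

lemma S_Aop' {b : Z n → ℂ} (hb : CB b) (J : Finset (Ix n)) (κ : ℝ) (θ : Sch n) :
    mu (Sp J κ 1) (Aop b θ) = Aop b (mu (Sp J κ 1) θ) + ((κ ^ 2 : ℝ) : ℂ) • ∑ j ∈ J,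
      ((2 : ℂ) • (Aop (dj j b) (mu (co j) θ)) + Aop (dj j (dj j b)) θ) := by
  rw [mu_Sp_one, mu_Sp_one, map_add, map_smul, map_sum, add_assoc, ← smul_add, ← Finset.sum_add_distrib]
  congr 2
  refine Finset.sum_congr rfl fun j _ => ?_
  rw [co_Aop hb, map_add, co_Aop hb, co_Aop (hb.dj j), two_smul]
  abel

lemma CJ_pos {ϑ s : ι → ℝ} (hϑ : ∀ i, 0 < ϑ i ∧ ϑ i ≤ 1) (hs : ∀ i, 0 < s i ∧ s i ≤ ϑ i)
    (J : Finset (Ix n)) : CJ ϑ (fun i => mu (Sp J (s i) 1)) (fun i => mu (Sp J (s i) (-1))) := by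
  intro T hT
  induction hT with
  | base b hb =>
    classical
    refine ⟨fun i => ∑ j ∈ J.attach, (((-1 : ℂ) • (mu (M1 J (s i) (ϑ i) j)).comp (Aop (dj j b))) +
      (mu (M2 J (s i) (ϑ i))).comp (Aop (dj j (dj j b)))), ?_, fun i θ => ?_⟩
    · refine Fam.sum _ (fun (j : J) i => ((-1 : ℂ) • (mu (M1 J (s i) (ϑ i) j)).comp (Aop (dj j b))) +
        (mu (M2 J (s i) (ϑ i))).comp (Aop (dj j (dj j b)))) fun j => ?_
      refine Fam.add _ _ (Fam.smul ?_ (fun _ => -1) (by simp)) ?_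
      · exact Fam.left _ _ (fun i => M1_tg _ _ _ _) (fun i z => M1_le J (hs i).1 (hs i).2 j.2 z)
          (Fam.base _ (hb.dj _))
      · exact Fam.left _ _ (fun i => M2_tg _ _ _) (fun i z => M2_le J (hs i).1 (hs i).2 (hϑ i).2 z)
          (Fam.base _ ((hb.dj _).dj _))
    · rw [S_Aop hb, map_add, mu_Sp, neg_add_cancel, mu_Sp_zero, map_smul, map_sum]
      congr 1
      rw [_root_.sum_apply, Finset.sum_attach J (fun j => (((-1 : ℂ) • (mu (M1 J (s i) (ϑ i) j)).comp (Aop (dj j b))) +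
        (mu (M2 J (s i) (ϑ i))).comp (Aop (dj j (dj j b)))) θ), Finset.smul_sum, Finset.smul_sum]
      refine Finset.sum_congr rfl fun j _ => ?_
      ext z
      simp only [map_add, map_neg, map_smul, _root_.smul_apply, _root_.add_apply, _root_.neg_apply,
        _root_.add_apply, _root_.smul_apply, ContinuousLinearMap.comp_apply]
      simp only [mu_apply (M1_tg _ _ _ _), mu_apply (M2_tg _ _ _), mu_apply (Sp_tg _ _ _), mu_apply (co_tg _), M1, M2, smul_eq_mul]
      have : (ϑ i : ℂ) ≠ 0 := by exact_mod_cast (hϑ i).1.ne'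
      push_cast
      field_simp
  | left M T hM hM1 hT ih =>
    obtain ⟨T', hT', e⟩ := ih
    refine ⟨_, Fam.left M T' hM hM1 hT', fun i θ => ?_⟩
    simp only [ContinuousLinearMap.comp_apply]
    rw [mu_comm (Sp_tg _ _ _) (hM i), e, map_add, map_smul]
  | right M T hM hM1 hT ih =>
    obtain ⟨T', hT', e⟩ := ih
    refine ⟨_, Fam.right M T' hM hM1 hT', fun i θ => ?_⟩
    simp only [ContinuousLinearMap.comp_apply]
    rw [mu_comm (hM i) (Sp_tg _ _ _), e]
  | add T T' hT hT' ih ih' =>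
    obtain ⟨T1, hT1, e1⟩ := ih
    obtain ⟨T2, hT2, e2⟩ := ih'
    refine ⟨_, Fam.add _ _ hT1 hT2, fun i θ => ?_⟩
    simp only [_root_.add_apply, map_add, e1, e2, smul_add]
    abel

lemma CJ_neg {ϑ s : ι → ℝ} (hϑ : ∀ i, 0 < ϑ i ∧ ϑ i ≤ 1) (hs : ∀ i, 0 < s i ∧ s i ≤ ϑ i)
    (J : Finset (Ix n)) : CJ ϑ (fun i => mu (Sp J (s i) (-1))) (fun i => mu (Sp J (s i) 1)) := by
  intro T hT
  induction hT with
  | base b hb =>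
    classical
    refine ⟨fun i => ∑ j ∈ J.attach, ((Aop (dj j b)).comp (mu (M1 J (s i) (ϑ i) j)) +
      (Aop (dj j (dj j b))).comp (mu (M2 J (s i) (ϑ i)))), ?_, fun i θ => ?_⟩
    · refine Fam.sum _ (fun (j : J) i => ((Aop (dj j b)).comp (mu (M1 J (s i) (ϑ i) j))) +
        (Aop (dj j (dj j b))).comp (mu (M2 J (s i) (ϑ i)))) fun j => ?_
      refine Fam.add _ _ ?_ ?_
      · exact Fam.right _ _ (fun i => M1_tg _ _ _ _) (fun i z => M1_le J (hs i).1 (hs i).2 j.2 z)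
          (Fam.base _ (hb.dj _))
      · exact Fam.right _ _ (fun i => M2_tg _ _ _) (fun i z => M2_le J (hs i).1 (hs i).2 (hϑ i).2 z)
          (Fam.base _ ((hb.dj _).dj _))
    · rw [S_Aop' hb, mu_Sp, add_neg_cancel, mu_Sp_zero]
      congr 1
      rw [_root_.sum_apply, Finset.sum_attach J (fun j => ((Aop (dj j b)).comp (mu (M1 J (s i) (ϑ i) j)) +
        (Aop (dj j (dj j b))).comp (mu (M2 J (s i) (ϑ i)))) θ), Finset.smul_sum, Finset.smul_sum]
      refine Finset.sum_congr rfl fun j _ => ?_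
      have hne : (ϑ i : ℂ) ≠ 0 := by exact_mod_cast (hϑ i).1.ne'
      have a1 : ((s i ^ 2 : ℝ) : ℂ) • (2 : ℂ) • mu (co j) (mu (Sp J (s i) (-1)) θ) =
          (ϑ i : ℂ) • mu (M1 J (s i) (ϑ i) j) θ := by
        ext z
        simp only [_root_.smul_apply]
        simp only [mu_apply (M1_tg _ _ _ _), mu_apply (Sp_tg _ _ _), mu_apply (co_tg _), M1, smul_eq_mul]
        push_cast
        field_simp
      have a2 : ((s i ^ 2 : ℝ) : ℂ) • mu (Sp J (s i) (-1)) θ =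
          (ϑ i : ℂ) • mu (M2 J (s i) (ϑ i)) θ := by
        ext z
        simp only [_root_.smul_apply]
        simp only [mu_apply (M2_tg _ _ _), mu_apply (Sp_tg _ _ _), M2, smul_eq_mul]
        push_cast
        field_simp
      change ((s i ^ 2 : ℝ) : ℂ) • ((2 : ℂ) • (Aop (dj j b) (mu (co j) (mu (Sp J (s i) (-1)) θ))) +
        Aop (dj j (dj j b)) (mu (Sp J (s i) (-1)) θ)) = _
      rw [smul_add, ← map_smul (Aop (dj j b)), ← map_smul (Aop (dj j b)), ← map_smul (Aop (dj j (dj j b))), a1, a2]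
      simp only [map_smul, _root_.add_apply, ContinuousLinearMap.comp_apply, smul_add]
  | left M T hM hM1 hT ih =>
    obtain ⟨T', hT', e⟩ := ih
    refine ⟨_, Fam.left M T' hM hM1 hT', fun i θ => ?_⟩
    simp only [ContinuousLinearMap.comp_apply]
    rw [mu_comm (Sp_tg _ _ _) (hM i), e, map_add, map_smul]
  | right M T hM hM1 hT ih =>
    obtain ⟨T', hT', e⟩ := ih
    refine ⟨_, Fam.right M T' hM hM1 hT', fun i θ => ?_⟩
    simp only [ContinuousLinearMap.comp_apply]
    rw [mu_comm (hM i) (Sp_tg _ _ _), e]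
  | add T T' hT hT' ih ih' =>
    obtain ⟨T1, hT1, e1⟩ := ih
    obtain ⟨T2, hT2, e2⟩ := ih'
    refine ⟨_, Fam.add _ _ hT1 hT2, fun i θ => ?_⟩
    simp only [_root_.add_apply, map_add, e1, e2, smul_add]
    abel

/-- the weight `S_{ϑ,XV}^k S_{κ,XV}^{-K} S_{ϑ,T}^{-m}` -/
def Wt (k K m : ℕ) (ϑ κ : ℝ) (ζ : Z n) : ℝ :=
  Sw XVs ϑ ζ ^ k * ((Sw XVs κ ζ) ^ K)⁻¹ * ((Sw Ts ϑ ζ) ^ m)⁻¹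

lemma Wt_pos (k K m : ℕ) (ϑ κ : ℝ) (ζ : Z n) : 0 < Wt k K m ϑ κ ζ := by
  have h1 := Sw_pos XVs ϑ ζ
  have h2 := Sw_pos XVs κ ζ
  have h3 := Sw_pos Ts ϑ ζ
  unfold Wt; positivity

lemma Wt_eq (k K m : ℕ) (ϑ κ : ℝ) (ζ : Z n) :
    (Wt k K m ϑ κ ζ : ℂ) = Sp XVs ϑ (k * 1) ζ * (Sp XVs κ (K * (-1)) ζ * Sp Ts ϑ (m * (-1)) ζ) := by
  have h2 := (Sw_pos XVs κ ζ).le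
  have h3 := (Sw_pos Ts ϑ ζ).le
  simp only [Sp, Wt, mul_one, mul_neg, Real.rpow_neg h2, Real.rpow_neg h3, Real.rpow_natCast]
  push_cast; ring

lemma Wt_inv_eq (k K m : ℕ) (ϑ κ : ℝ) (ζ : Z n) :
    (((Wt k K m ϑ κ ζ)⁻¹ : ℝ) : ℂ) = Sp Ts ϑ (m * 1) ζ * (Sp XVs κ (K * 1) ζ * Sp XVs ϑ (k * (-1)) ζ) := by
  have h1 := (Sw_pos XVs ϑ ζ).le
  simp only [Sp, Wt, mul_one, mul_neg, Real.rpow_neg h1, Real.rpow_natCast, mul_inv, inv_inv]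
  push_cast; ring

lemma Wt_tg (k K m : ℕ) (ϑ κ : ℝ) : (fun ζ : Z n => (Wt k K m ϑ κ ζ : ℂ)).HasTemperateGrowth := by
  simp_rw [Wt_eq]
  exact (Sp_tg _ _ _).mul ((Sp_tg _ _ _).mul (Sp_tg _ _ _))

lemma Wt_inv_tg (k K m : ℕ) (ϑ κ : ℝ) :
    (fun ζ : Z n => (((Wt k K m ϑ κ ζ)⁻¹ : ℝ) : ℂ)).HasTemperateGrowth := by
  simp_rw [Wt_inv_eq]
  exact (Sp_tg _ _ _).mul ((Sp_tg _ _ _).mul (Sp_tg _ _ _))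

lemma CJ_Wt {ϑ s : ι → ℝ} (hϑ : ∀ i, 0 < ϑ i ∧ ϑ i ≤ 1) (hs : ∀ i, 0 < s i ∧ s i ≤ ϑ i)
    (k K m : ℕ) : CJ (n := n) ϑ (fun i => mu (fun ζ => (Wt k K m (ϑ i) (s i) ζ : ℂ)))
      (fun i => mu (fun ζ => (((Wt k K m (ϑ i) (s i) ζ)⁻¹ : ℝ) : ℂ))) := by
  have hϑ' : ∀ i, 0 < ϑ i ∧ ϑ i ≤ ϑ i := fun i => ⟨(hϑ i).1, le_rfl⟩
  have h1 := (CJ_pos (n := n) hϑ hϑ' XVs).pow hϑ k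
  have h2 := (CJ_neg (n := n) hϑ hs XVs).pow hϑ K
  have h3 := (CJ_neg (n := n) hϑ hϑ' Ts).pow hϑ m
  have h4 := CJ.comp hϑ h1 (CJ.comp hϑ h2 h3)
  simp_rw [mu_Sp_pow] at h4
  convert h4 using 2 with i i
  · ext1 θ
    simp only [mul_apply_eq_comp]
    rw [mu_mul (Sp_tg _ _ _) (Sp_tg _ _ _), mu_mul ((Sp_tg _ _ _).fun_mul (Sp_tg _ _ _)) (Sp_tg _ _ _)]
    simp_rw [Wt_eq, mul_assoc]
  · ext1 θ
    simp only [mul_apply_eq_comp]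
    rw [mu_mul (Sp_tg _ _ _) (Sp_tg _ _ _), mu_mul ((Sp_tg _ _ _).fun_mul (Sp_tg _ _ _)) (Sp_tg _ _ _)]
    simp_rw [Wt_inv_eq, mul_assoc]

end KH

namespace KH
open SchwartzMap Function Filter
open scoped FourierTransform LineDeriv ContDiff ComplexConjugate Topology

/-- time index -/
abbrev it : Ix n := Sum.inl ()
/-- space index -/
abbrev ix (i : Fin n) : Ix n := Sum.inr (Sum.inl i)
/-- velocity index -/
abbrev iv (i : Fin n) : Ix n := Sum.inr (Sum.inr i)

/-- nilpotent part of the shear -/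
def Nl : Z n →L[ℝ] Z n := LinearMap.toContinuousLinearMap
  { toFun := fun ζ => WithLp.toLp 2 (Sum.elim 0 (Sum.elim 0 (fun i => ζ (ix i))))
    map_add' := fun x y => by ext j; rcases j with j | j | j <;> simp
    map_smul' := fun c x => by ext j; rcases j with j | j | j <;> simp }

@[simp] lemma Nl_it (ζ : Z n) (j : Unit) : Nl ζ (Sum.inl j) = 0 := rfl
@[simp] lemma Nl_ix (ζ : Z n) (i : Fin n) : Nl ζ (Sum.inr (Sum.inl i)) = 0 := rfl
@[simp] lemma Nl_iv (ζ : Z n) (i : Fin n) : Nl ζ (Sum.inr (Sum.inr i)) = ζ (ix i) := rfl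
@[simp] lemma Nl_Nl (ζ : Z n) : Nl (Nl ζ) = 0 := by
  ext j; rcases j with j | j | j <;> simp

lemma Nl_sum (ζ : Z n) : Nl ζ = ∑ i : Fin n, ζ (ix i) • ej (iv i) := by
  ext j; rcases j with j | j | j
  · simp [ej]
  · simp [ej]
  · simp [ej, Finset.sum_apply, Pi.single_apply]

/-- the shear -/
def Ph (s : ℝ) : Z n ≃L[ℝ] Z n :=
  LinearEquiv.toContinuousLinearEquiv
  { toFun := fun ζ => ζ + s • Nl ζ
    invFun := fun ζ => ζ - s • Nl ζ
    map_add' := fun x y => by simp only [map_add, smul_add]; abel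
    map_smul' := fun c x => by simp [smul_add, smul_comm c s]
    left_inv := fun ζ => by simp
    right_inv := fun ζ => by simp }

lemma Ph_apply (s : ℝ) (ζ : Z n) : Ph s ζ = ζ + s • Nl ζ := rfl
lemma Nl_Ph (s : ℝ) (ζ : Z n) : Nl (Ph s ζ) = Nl ζ := by simp [Ph_apply]
lemma Ph_add (r s : ℝ) (ζ : Z n) : Ph r (Ph s ζ) = Ph (r + s) ζ := by
  rw [Ph_apply, Nl_Ph, Ph_apply, Ph_apply, add_smul]; abel
lemma Ph_neg (s : ℝ) (ζ : Z n) : Ph (-s) (Ph s ζ) = ζ := by simp [Ph_add, Ph_apply]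
lemma Ph_neg' (s : ℝ) (ζ : Z n) : Ph s (Ph (-s) ζ) = ζ := by simp [Ph_add, Ph_apply]
lemma Ph_it (s : ℝ) (ζ : Z n) : (Ph s ζ) it = ζ it := by simp [Ph_apply]
lemma Ph_zero (ζ : Z n) : Ph 0 ζ = ζ := by simp [Ph_apply]

/-- scaling of the space variables -/
def Dc (c : ℝ) : Z n →ₗ[ℝ] Z n :=
  { toFun := fun ζ => WithLp.toLp 2 (Sum.elim (fun j => ζ (Sum.inl j)) (Sum.elim (fun i => c * ζ (ix i)) (fun i => ζ (iv i))))
    map_add' := fun x y => by ext j; rcases j with j | j | j <;> simp [mul_add]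
    map_smul' := fun c x => by ext j; rcases j with j | j | j <;> simp [mul_left_comm] }

lemma det_Ph (s : ℝ) : LinearMap.det ((Ph (n := n) s : Z n →L[ℝ] Z n) : Z n →ₗ[ℝ] Z n) = 1 := by
  have h1 : (Dc (n := n) 2) ∘ₗ (Dc 2⁻¹) = LinearMap.id := by
    ext ζ j; rcases j with j | j | j <;> simp [Dc]
  have h2 : ∀ s : ℝ, (Dc (n := n) 2) ∘ₗ ((Ph (n := n) (2 * s) : Z n →L[ℝ] Z n) : Z n →ₗ[ℝ] Z n) =
      ((Ph (n := n) s : Z n →L[ℝ] Z n) : Z n →ₗ[ℝ] Z n) ∘ₗ (Dc 2) := by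
    intro s; refine LinearMap.ext fun ζ => ?_
    ext j
    rcases j with j | j | j
    · simp [Dc, Ph_apply]
    · simp [Dc, Ph_apply]
    · simp [Dc, Ph_apply]; ring
  have h3 : ((Ph (n := n) (2 * s) : Z n →L[ℝ] Z n) : Z n →ₗ[ℝ] Z n) =
      ((Ph (n := n) s : Z n →L[ℝ] Z n) : Z n →ₗ[ℝ] Z n) ∘ₗ ((Ph (n := n) s : Z n →L[ℝ] Z n) : Z n →ₗ[ℝ] Z n) := by
    refine LinearMap.ext fun ζ => ?_
    simp [Ph_add, two_mul]
  have d1 := congrArg LinearMap.det h1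
  have d2 := congrArg LinearMap.det (h2 s)
  have d3 := congrArg LinearMap.det h3
  rw [LinearMap.det_comp, LinearMap.det_id] at d1
  rw [LinearMap.det_comp, LinearMap.det_comp] at d2
  rw [LinearMap.det_comp] at d3
  have hne : LinearMap.det ((Ph (n := n) s : Z n →L[ℝ] Z n) : Z n →ₗ[ℝ] Z n) ≠ 0 :=
    (LinearEquiv.isUnit_det' (Ph (n := n) s).toLinearEquiv).ne_zero
  have hD : LinearMap.det (Dc (n := n) 2) ≠ 0 := left_ne_zero_of_mul_eq_one d1
  rw [d3, mul_comm] at d2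
  have := mul_right_cancel₀ hD d2
  exact mul_right_cancel₀ hne (this.trans (one_mul _).symm)

lemma Ph_mp (s : ℝ) : MeasurePreserving (Ph (n := n) s) volume volume := by
  refine ⟨(Ph s).continuous.measurable, ?_⟩
  have h := Measure.map_linearMap_addHaar_eq_smul_addHaar (volume : Measure (Z n))
    (f := ((Ph (n := n) s : Z n →L[ℝ] Z n) : Z n →ₗ[ℝ] Z n)) (by rw [det_Ph]; exact one_ne_zero)
  rw [det_Ph] at h
  simpa using h

lemma Ph_int {G : Type*} [NormedAddCommGroup G] [NormedSpace ℝ G] (s : ℝ) (f : Z n → G) :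
    ∫ ζ, f (Ph s ζ) = ∫ ζ, f ζ :=
  (Ph_mp s).integral_comp (Ph (n := n) s).toHomeomorph.measurableEmbedding f

/-- phase -/
def ex (s : ℝ) (ζ : Z n) : ℂ := Complex.exp (2 * π * Complex.I * s * (ζ it : ℝ))

lemma ex_norm (s : ℝ) (ζ : Z n) : ‖ex s ζ‖ = 1 := by
  rw [ex, show (2 * π * Complex.I * s * (ζ it : ℝ) : ℂ) = ((2 * π * s * ζ it : ℝ) : ℂ) * Complex.I by push_cast; ring]
  exact Complex.norm_exp_ofReal_mul_I _

lemma ex_conj (s : ℝ) (ζ : Z n) : conj (ex s ζ) = ex (-s) ζ := by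
  rw [ex, ex, ← Complex.exp_conj]; simp [Complex.conj_ofNat]

lemma ex_Ph (r s : ℝ) (ζ : Z n) : ex r (Ph s ζ) = ex r ζ := by rw [ex, ex, Ph_it]
lemma ex_add (r s : ℝ) (ζ : Z n) : ex r ζ * ex s ζ = ex (r + s) ζ := by
  rw [ex, ex, ex, ← Complex.exp_add]; congr 1; push_cast; ring
lemma ex_zero (ζ : Z n) : ex 0 ζ = 1 := by simp [ex]

lemma exp_tg (c : ℝ) : (fun x : ℝ => Complex.exp ((c : ℂ) * Complex.I * (x : ℂ))).HasTemperateGrowth := by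
  have hd : ∀ k : ℕ, iteratedDeriv k (fun x : ℝ => Complex.exp ((c : ℂ) * Complex.I * (x : ℂ))) =
      fun x : ℝ => ((c : ℂ) * Complex.I) ^ k * Complex.exp ((c : ℂ) * Complex.I * (x : ℂ)) := by
    intro k
    induction k with
    | zero => simp
    | succ k ih =>
      rw [iteratedDeriv_succ, ih]
      funext x
      have h1 : HasDerivAt (fun x : ℝ => (c : ℂ) * Complex.I * (x : ℂ)) ((c : ℂ) * Complex.I * 1) x :=
        (Complex.ofRealCLM.hasDerivAt (x := x)).const_mul _
      have := (h1.cexp.const_mul (((c : ℂ) * Complex.I) ^ k)).deriv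
      rw [this]; ring
  refine ⟨?_, fun k => ⟨0, |c| ^ k, fun x => ?_⟩⟩
  · exact (contDiff_const.mul Complex.ofRealCLM.contDiff).cexp
  · rw [norm_iteratedFDeriv_eq_norm_iteratedDeriv, hd]
    rw [norm_mul, norm_pow, norm_mul, Complex.norm_I, mul_one, Complex.norm_real, Real.norm_eq_abs,
      show (c : ℂ) * Complex.I * (x : ℂ) = ((c * x : ℝ) : ℂ) * Complex.I by push_cast; ring,
      Complex.norm_exp_ofReal_mul_I]
    simp

lemma ex_tg (s : ℝ) : (ex (n := n) s).HasTemperateGrowth := by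
  have := (exp_tg (2 * π * s)).comp (ContinuousLinearMap.hasTemperateGrowth
    (EuclideanSpace.proj (𝕜 := ℝ) (it : Ix n) : Z n →L[ℝ] ℝ))
  refine (congrArg Function.HasTemperateGrowth ?_).mp this
  funext ζ
  change Complex.exp (_ * _ * ((ζ it : ℝ) : ℂ)) = _
  rw [ex]
  congr 1; push_cast; ring

/-- the transport group on Schwartz functions -/
def Vg (s : ℝ) : Sch n →L[ℂ] Sch n := (mu (ex s)).comp (compCLMOfContinuousLinearEquiv ℂ (Ph s))

lemma Vg_apply (s : ℝ) (θ : Sch n) (ζ : Z n) : Vg s θ ζ = ex s ζ * θ (Ph s ζ) := by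
  rw [Vg, ContinuousLinearMap.comp_apply, mu_apply (ex_tg s)]; rfl

/-- the transport generator -/
def Xop : Sch n →L[ℂ] Sch n :=
  (2 * π * Complex.I : ℂ) • mu (co it) +
    ∑ i : Fin n, (mu (co (ix i))).comp (LineDeriv.lineDerivOpCLM ℂ (Sch n) (ej (iv i)))

lemma Xop_eq (θ : Sch n) : Xop θ = (2 * π * Complex.I : ℂ) • mu (co it) θ +
    ∑ i : Fin n, mu (co (ix i)) (∂_{ej (iv i)} θ : Sch n) := by
  simp [Xop, _root_.sum_apply]

lemma Xop_apply (θ : Sch n) (ζ : Z n) :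
    Xop θ ζ = 2 * π * Complex.I * (ζ it : ℝ) * θ ζ + fderiv ℝ θ ζ (Nl ζ) := by
  rw [Xop_eq, _root_.add_apply, _root_.sum_apply, _root_.smul_apply]
  simp only [mu_apply (co_tg _), lineDerivOp_apply_eq_fderiv]
  rw [Nl_sum, map_sum]
  simp only [map_smul, co, Complex.real_smul, smul_eq_mul]
  ring

lemma Vg_deriv (θ : Sch n) (ζ : Z n) (s : ℝ) :
    HasDerivAt (fun s => Vg s θ ζ) (Vg s (Xop θ) ζ) s := by
  have h1 : HasDerivAt (fun s : ℝ => ex s ζ) (ex s ζ * (2 * π * Complex.I * (ζ it : ℝ))) s := by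
    have : HasDerivAt (fun s : ℝ => 2 * π * Complex.I * (s : ℂ) * ((ζ it : ℝ) : ℂ)) (2 * π * Complex.I * 1 * ((ζ it : ℝ) : ℂ)) s :=
      ((Complex.ofRealCLM.hasDerivAt (x := s)).const_mul _).mul_const _
    have := this.cexp
    simpa [ex] using this
  have h2 : HasDerivAt (fun s : ℝ => Ph s ζ) (Nl ζ) s := by
    have := ((hasDerivAt_id s).smul_const (Nl ζ)).const_add ζ
    simpa [Ph_apply] using this
  have h3 : HasDerivAt (fun s : ℝ => θ (Ph s ζ)) (fderiv ℝ θ (Ph s ζ) (Nl ζ)) s :=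
    (θ.differentiable (Ph s ζ)).hasFDerivAt.comp_hasDerivAt s h2
  have h4 := h1.mul h3
  simp_rw [Vg_apply]
  refine h4.congr_deriv ?_
  rw [Xop_apply, Nl_Ph, Ph_it]; ring

lemma Vg_add (r s : ℝ) (θ : Sch n) : Vg r (Vg s θ) = Vg (s + r) θ := by
  ext ζ
  rw [Vg_apply, Vg_apply, Vg_apply, ex_Ph, ← mul_assoc, ex_add, Ph_add, add_comm]
lemma Vg_zero (θ : Sch n) : Vg 0 θ = θ := by
  ext ζ; rw [Vg_apply, ex_zero, Ph_zero, one_mul]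

lemma Vg_comm (s : ℝ) (θ : Sch n) : Xop (Vg s θ) = Vg s (Xop θ) := by
  ext ζ
  have h1 := Vg_deriv (Vg s θ) ζ 0
  rw [Vg_zero] at h1
  simp_rw [Vg_add] at h1
  have h2 : HasDerivAt (fun r => Vg (s + r) θ ζ) (Vg s (Xop θ) ζ) 0 := by
    have := (Vg_deriv θ ζ (s + 0)).comp_const_add s 0
    simpa using this
  exact h1.unique h2

lemma Vg_dec (θ : Sch n) (R : ℝ) (hR : 0 ≤ R) (k : ℕ) : ∃ C, 0 ≤ C ∧ ∀ s : ℝ, |s| ≤ R → ∀ ζ : Z n,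
    ‖Vg s θ ζ‖ ≤ C * ((1 + ‖ζ‖) ^ k)⁻¹ := by
  set D := 2 ^ k * (Finset.Iic (k, 0)).sup (fun m => SchwartzMap.seminorm ℝ m.1 m.2) θ with hD
  have h1 : ∀ y : Z n, (1 + ‖y‖) ^ k * ‖θ y‖ ≤ D := fun y => by
    simpa using one_add_le_sup_seminorm_apply (𝕜 := ℝ) (m := (k, 0)) (k := k) (n := 0) le_rfl le_rfl θ y
  have hD0 : 0 ≤ D := le_trans (by positivity) (h1 0)
  set L := 1 + R * ‖Nl (n := n)‖ with hL
  have hL1 : 1 ≤ L := by rw [hL]; have : 0 ≤ R * ‖Nl (n := n)‖ := by positivity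
                         linarith
  refine ⟨L ^ k * D, by positivity, fun s hs ζ => ?_⟩
  rw [Vg_apply, norm_mul, ex_norm, one_mul, ← div_eq_mul_inv, le_div_iff₀ (by positivity)]
  have h2 : ‖ζ‖ ≤ L * ‖Ph s ζ‖ := by
    have : ζ = Ph s ζ - s • Nl (Ph s ζ) := by rw [Nl_Ph, Ph_apply]; abel
    calc ‖ζ‖ = ‖Ph s ζ - s • Nl (Ph s ζ)‖ := by rw [← this]
      _ ≤ ‖Ph s ζ‖ + ‖s • Nl (Ph s ζ)‖ := norm_sub_le _ _
      _ ≤ ‖Ph s ζ‖ + R * (‖Nl (n := n)‖ * ‖Ph s ζ‖) := by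
        rw [norm_smul, Real.norm_eq_abs]
        gcongr
        exact Nl.le_opNorm _
      _ = _ := by rw [hL]; ring
  have h3 : 1 + ‖ζ‖ ≤ L * (1 + ‖Ph s ζ‖) := by nlinarith
  calc ‖θ (Ph s ζ)‖ * (1 + ‖ζ‖) ^ k ≤ ‖θ (Ph s ζ)‖ * (L * (1 + ‖Ph s ζ‖)) ^ k := by gcongr
    _ = L ^ k * ((1 + ‖Ph s ζ‖) ^ k * ‖θ (Ph s ζ)‖) := by rw [mul_pow]; ring
    _ ≤ L ^ k * D := by gcongr; exact h1 _

lemma jap_L2 : ∃ k : ℕ, L2f (fun ζ : Z n => ((((1 + ‖ζ‖) ^ k)⁻¹ : ℝ) : ℂ)) := by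
  refine ⟨Module.finrank ℝ (Z n) + 1, ?_⟩
  have hc : Continuous (fun ζ : Z n => ((1 + ‖ζ‖) ^ (Module.finrank ℝ (Z n) + 1))⁻¹) := by
    refine Continuous.inv₀ (by fun_prop) fun ζ => by positivity
  refine (memLp_two_iff_integrable_sq_norm (Complex.continuous_ofReal.comp hc).aestronglyMeasurable).2 ?_
  have h := integrable_one_add_norm (E := Z n) (μ := volume) (r := Module.finrank ℝ (Z n) + 1) (by linarith)
  refine h.mono' (by exact ((Complex.continuous_ofReal.comp hc).norm.pow 2).aestronglyMeasurable) (Eventually.of_forall fun ζ => ?_)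
  have h1 : (1:ℝ) ≤ (1 + ‖ζ‖) ^ (Module.finrank ℝ (Z n) + 1) := one_le_pow₀ (by linarith [norm_nonneg ζ])
  have h2 : ((1 + ‖ζ‖) ^ (Module.finrank ℝ (Z n) + 1))⁻¹ ≤ 1 := inv_le_one_of_one_le₀ h1
  have h3 : 0 ≤ ((1 + ‖ζ‖) ^ (Module.finrank ℝ (Z n) + 1))⁻¹ := by positivity
  have h4 : (1 + ‖ζ‖) ^ (-((Module.finrank ℝ (Z n) : ℝ) + 1)) = ((1 + ‖ζ‖) ^ (Module.finrank ℝ (Z n) + 1))⁻¹ := by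
    rw [Real.rpow_neg (by positivity)]; norm_cast
  simp only [Function.comp]
  rw [h4, Complex.norm_real, Real.norm_of_nonneg h3, Real.norm_of_nonneg (by positivity)]
  nlinarith

lemma ip_Vg_deriv {w : Z n → ℂ} (hw : L2f w) (θ : Sch n) (s : ℝ) :
    HasDerivAt (fun s => ip w (Vg s θ)) (ip w (Vg s (Xop θ))) s := by
  obtain ⟨k, hk⟩ := jap_L2 (n := n)
  obtain ⟨C, hC, h⟩ := Vg_dec (Xop θ) (|s| + 1) (by positivity) k
  refine (hasDerivAt_integral_of_dominated_loc_of_deriv_le (μ := volume) (s := Metric.ball s 1)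
    (F := fun s ζ => conj (w ζ) * Vg s θ ζ) (F' := fun s ζ => conj (w ζ) * Vg s (Xop θ) ζ)
    (bound := fun ζ => C * (‖conj (w ζ) * ((((1 + ‖ζ‖) ^ k)⁻¹ : ℝ) : ℂ)‖))
    (Metric.ball_mem_nhds s one_pos) ?_ ?_ ?_ ?_ ?_ ?_).2
  · exact Eventually.of_forall fun r => (hw.ip_int (sL2 (Vg r θ))).1
  · exact hw.ip_int (sL2 (Vg s θ))
  · exact (hw.ip_int (sL2 (Vg s (Xop θ)))).1
  · refine Eventually.of_forall fun ζ r hr => ?_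
    have hr' : |r| ≤ |s| + 1 := by
      rw [Metric.mem_ball, Real.dist_eq] at hr
      have := abs_add_le (r - s) s
      rw [sub_add_cancel] at this
      linarith
    rw [norm_mul, norm_mul, Complex.norm_real, Real.norm_of_nonneg (by positivity)]
    have := h r hr' ζ
    calc ‖conj (w ζ)‖ * ‖Vg r (Xop θ) ζ‖ ≤ ‖conj (w ζ)‖ * (C * ((1 + ‖ζ‖) ^ k)⁻¹) := by gcongr
      _ = _ := by ring
  · exact ((hw.ip_int hk).norm).const_mul C
  · exact Eventually.of_forall fun ζ r _ => (Vg_deriv θ ζ r).const_mul _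

lemma nr_Vg (s : ℝ) (θ : Sch n) : nr (Vg s θ) = nr θ := by
  unfold nr nq
  simp_rw [Vg_apply, norm_mul, ex_norm, one_mul]
  rw [Ph_int s (fun ζ => ‖θ ζ‖ ^ 2)]

/-- adjoint group -/
def Va (s : ℝ) (w : Z n → ℂ) : Z n → ℂ := fun ζ => ex (-s) ζ * w (Ph (-s) ζ)

lemma ex_cont (s : ℝ) : Continuous (ex (n := n) s) := (ex_tg s).1.continuous

lemma Va_L2 (s : ℝ) {w : Z n → ℂ} (hw : L2f w) : L2f (Va s w) := by
  have h1 : L2f (fun ζ => w (Ph (-s) ζ)) := hw.comp_measurePreserving (Ph_mp (-s))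
  exact h1.of_le ((ex_cont (-s)).aestronglyMeasurable.mul h1.1)
    (Eventually.of_forall fun ζ => by rw [Va, norm_mul, ex_norm, one_mul])

lemma ip_Va (s : ℝ) (w : Z n → ℂ) (θ : Sch n) : ip (Va s w) θ = ip w (Vg s θ) := by
  unfold ip Va
  rw [← Ph_int s]
  congr 1; funext ζ
  rw [Ph_neg, ex_Ph, Vg_apply, map_mul, ex_conj, neg_neg]; ring

lemma nr_dual {d : Z n → ℂ} (hd : L2f d) {C : ℝ} (hC : 0 ≤ C) (h : ∀ θ : Sch n, ‖ip d θ‖ ≤ C * nr θ) :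
    nr d ≤ C := by
  have key : ∀ ε : ℝ, 0 < ε → nr d ^ 2 ≤ C * nr d + ε * (C + nr d) := by
    intro ε hε
    obtain ⟨θ, hθ⟩ := dense_sch hd hε
    have hdθ : L2f (fun z => d z - θ z) := hd.sub (sL2 θ)
    have e1 : ip d (fun z => d z - θ z) = ip d d - ip d θ := ip_sub_right hd hd (sL2 θ)
    have e2 : ‖ip d d‖ = nr d ^ 2 := by
      rw [ip_self, Complex.norm_real, Real.norm_of_nonneg (nq_nonneg d), nr_sq]
    have e3 : ‖ip d d‖ ≤ ‖ip d (fun z => d z - θ z)‖ + ‖ip d θ‖ := by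
      rw [e1]; simpa using norm_add_le (ip d d - ip d θ) (ip d θ)
    have e4 := ip_le hd hdθ
    have e5 : nr θ ≤ nr d + ε := by
      have h1 := nr_add_le hd (hdθ.neg)
      have h2 : (d + -(fun z => d z - θ z)) = (θ : Z n → ℂ) := by funext z; simp
      have h3 : nr (-(fun z => d z - θ z)) = nr (fun z => d z - θ z) := by
        simp only [nr, nq, Pi.neg_apply, norm_neg]
      rw [h2, h3] at h1
      linarith
    have e6 := h θ
    have := nr_nonneg d
    nlinarith
  by_contra hcon
  push Not at hcon
  have h0 : 0 < nr d := hC.trans_lt hcon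
  have h1 : 0 < nr d * (nr d - C) := mul_pos h0 (by linarith)
  have := key (nr d * (nr d - C) / (2 * (C + nr d))) (by positivity)
  have e : nr d * (nr d - C) / (2 * (C + nr d)) * (C + nr d) = nr d * (nr d - C) / 2 := by
    field_simp
  rw [e] at this
  nlinarith

lemma flow_bd {w f : Z n → ℂ} (hw : L2f w) (hf : L2f f) (h : ∀ θ : Sch n, ip w (Xop θ) = ip f θ) (s : ℝ) :
    nr (fun ζ => Va s w ζ - w ζ) ≤ |s| * nr f := by
  refine nr_dual ((Va_L2 s hw).sub hw) (mul_nonneg (abs_nonneg _) (nr_nonneg _)) fun θ => ?_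
  change ‖ip (fun ζ => Va s w ζ - w ζ) θ‖ ≤ _
  rw [ip_sub_left (Va_L2 s hw) hw (sL2 θ), ip_Va]
  have h1 : ∀ r, HasDerivAt (fun s => ip w (Vg s θ)) (ip f (Vg r θ)) r := fun r => by
    have := ip_Vg_deriv hw θ r
    rwa [← Vg_comm, h] at this
  have h2 := Convex.norm_image_sub_le_of_norm_hasDerivWithin_le (s := Set.univ) (x := 0) (y := s)
    (C := nr f * nr θ) (fun r _ => (h1 r).hasDerivWithinAt) (fun r _ => by
      have := ip_le hf (sL2 (Vg r θ))
      rwa [nr_Vg] at this) convex_univ (Set.mem_univ _) (Set.mem_univ _)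
  simp only [Vg_zero, sub_zero, Real.norm_eq_abs] at h2
  refine h2.trans (le_of_eq (by ring))

lemma nr_const (c : ℝ) (f : Z n → ℂ) : nr (fun ζ => (c : ℂ) * f ζ) = |c| * nr f := by
  unfold nr nq
  simp_rw [norm_mul, mul_pow, Complex.norm_real, Real.norm_eq_abs]
  rw [integral_const_mul, Real.sqrt_mul (by positivity), Real.sqrt_sq (abs_nonneg _)]

lemma flow_weak {w f : Z n → ℂ} (hw : L2f w) (hf : L2f f) (h : ∀ θ : Sch n, ip w (Xop θ) = ip f θ)
    {g : Z n → ℂ} (hg : L2f g) :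
    Tendsto (fun s : ℝ => ((s⁻¹ : ℝ) : ℂ) * ip (fun ζ => Va s w ζ - w ζ) g) (𝓝[≠] 0) (𝓝 (ip f g)) := by
  have hd : ∀ s, L2f (fun ζ => Va s w ζ - w ζ) := fun s => (Va_L2 s hw).sub hw
  rw [Metric.tendsto_nhds]
  intro ε hε
  set F := nr f with hF
  have hF0 : 0 ≤ F := nr_nonneg f
  obtain ⟨θ, hθ⟩ := dense_sch hg (ε := ε / (4 * (F + 1))) (by positivity)
  have hgθ : L2f (fun z => g z - θ z) := hg.sub (sL2 θ)
  have h1 : Tendsto (fun s : ℝ => ((s⁻¹ : ℝ) : ℂ) * ip (fun ζ => Va s w ζ - w ζ) θ) (𝓝[≠] 0) (𝓝 (ip f θ)) := by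
    have := (ip_Vg_deriv hw θ 0).tendsto_slope_zero
    rw [← Vg_comm, Vg_zero, h] at this
    refine this.congr fun s => ?_
    rw [ip_sub_left (Va_L2 s hw) hw (sL2 θ), ip_Va, zero_add, Complex.real_smul]
  rw [Metric.tendsto_nhds] at h1
  filter_upwards [h1 (ε / 4) (by positivity), self_mem_nhdsWithin] with s hs hs0
  have hs0' : s ≠ 0 := hs0
  rw [dist_eq_norm] at hs ⊢
  have e1 : ip (fun ζ => Va s w ζ - w ζ) g = ip (fun ζ => Va s w ζ - w ζ) θ +
      ip (fun ζ => Va s w ζ - w ζ) (fun z => g z - θ z) := by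
    rw [ip_sub_right (hd s) hg (sL2 θ)]; ring
  have e2 : ip f g = ip f θ + ip f (fun z => g z - θ z) := by
    rw [ip_sub_right hf hg (sL2 θ)]; ring
  have b1 : ‖((s⁻¹ : ℝ) : ℂ) * ip (fun ζ => Va s w ζ - w ζ) (fun z => g z - θ z)‖ ≤ F * (ε / (4 * (F + 1))) := by
    rw [norm_mul, Complex.norm_real, Real.norm_eq_abs, abs_inv]
    calc |s|⁻¹ * ‖ip (fun ζ => Va s w ζ - w ζ) (fun z => g z - θ z)‖
        ≤ |s|⁻¹ * ((|s| * F) * (ε / (4 * (F + 1)))) := by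
          gcongr
          refine (ip_le (hd s) hgθ).trans ?_
          exact mul_le_mul (flow_bd hw hf h s) hθ (nr_nonneg _) (by positivity)
      _ = _ := by
        have : |s| ≠ 0 := abs_ne_zero.2 hs0'
        field_simp
  have b2 : ‖ip f (fun z => g z - θ z)‖ ≤ F * (ε / (4 * (F + 1))) :=
    (ip_le hf hgθ).trans (mul_le_mul_of_nonneg_left hθ hF0)
  have b3 : F * (ε / (4 * (F + 1))) ≤ ε / 4 := by
    rw [← mul_div_assoc, div_le_div_iff₀ (by positivity) (by positivity)]
    nlinarith
  rw [e1, e2, mul_add]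
  calc _ = ‖(((s⁻¹ : ℝ) : ℂ) * ip (fun ζ => Va s w ζ - w ζ) θ - ip f θ) +
        (((s⁻¹ : ℝ) : ℂ) * ip (fun ζ => Va s w ζ - w ζ) (fun z => g z - θ z) - ip f (fun z => g z - θ z))‖ := by
        congr 1; ring
    _ ≤ ‖((s⁻¹ : ℝ) : ℂ) * ip (fun ζ => Va s w ζ - w ζ) θ - ip f θ‖ +
        (‖((s⁻¹ : ℝ) : ℂ) * ip (fun ζ => Va s w ζ - w ζ) (fun z => g z - θ z)‖ + ‖ip f (fun z => g z - θ z)‖) := by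
        refine (norm_add_le _ _).trans (add_le_add le_rfl (norm_sub_le _ _))
    _ < ε := by linarith

/-- the flow identity -/
lemma flow {w f : Z n → ℂ} (hw : L2f w) (hf : L2f f) (h : ∀ θ : Sch n, ip w (Xop θ) = ip f θ)
    {m m' B : Z n → ℝ} (hm : Continuous m) {K : ℝ} (hmK : ∀ ζ, |m ζ| ≤ K)
    (hder : ∀ ζ s, HasDerivAt (fun s => m (Ph s ζ)) (m' (Ph s ζ)) s)
    (hB : ∀ ζ s, |s| ≤ 1 → |m' (Ph s ζ)| ≤ B ζ) (hm' : Continuous m')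
    (hBint : Integrable (fun ζ => B ζ * ‖w ζ‖ ^ 2)) :
    ∫ ζ, m' ζ * ‖w ζ‖ ^ 2 = 2 * (ip f (fun ζ => (m ζ : ℂ) * w ζ)).re := by
  have hK : 0 ≤ K := (abs_nonneg _).trans (hmK 0)
  have hmw : L2f (fun ζ => (m ζ : ℂ) * w ζ) := by
    refine MemLp.of_le_mul (c := K) hw ((Complex.continuous_ofReal.comp hm).aestronglyMeasurable.mul hw.1)
      (Eventually.of_forall fun ζ => ?_)
    rw [norm_mul, Complex.norm_real, Real.norm_eq_abs]
    exact mul_le_mul_of_nonneg_right (hmK ζ) (norm_nonneg _)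
  have mint : ∀ g : Z n → ℂ, L2f g → Integrable (fun ζ => m ζ * ‖g ζ‖ ^ 2) := fun g hg => by
    refine (hg.sq.const_mul K).mono' (hm.aestronglyMeasurable.mul hg.sq.1) (Eventually.of_forall fun ζ => ?_)
    rw [norm_mul, Real.norm_eq_abs, Real.norm_of_nonneg (by positivity)]
    exact mul_le_mul_of_nonneg_right (hmK ζ) (by positivity)
  -- derivative of `Q`
  have hQ : HasDerivAt (fun s => ∫ ζ, m (Ph s ζ) * ‖w ζ‖ ^ 2) (∫ ζ, m' (Ph 0 ζ) * ‖w ζ‖ ^ 2) 0 := by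
    refine (hasDerivAt_integral_of_dominated_loc_of_deriv_le (μ := volume) (s := Metric.ball 0 1)
      (F := fun s ζ => m (Ph s ζ) * ‖w ζ‖ ^ 2) (F' := fun s ζ => m' (Ph s ζ) * ‖w ζ‖ ^ 2)
      (bound := fun ζ => B ζ * ‖w ζ‖ ^ 2)
      (Metric.ball_mem_nhds 0 one_pos) ?_ ?_ ?_ ?_ hBint ?_).2
    · exact Eventually.of_forall fun r => (hm.comp (Ph r).continuous).aestronglyMeasurable.mul hw.sq.1
    · simpa only [Ph_zero] using mint w hw
    · exact (hm'.comp (Ph 0).continuous).aestronglyMeasurable.mul hw.sq.1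
    · refine Eventually.of_forall fun ζ r hr => ?_
      rw [norm_mul, Real.norm_eq_abs, Real.norm_of_nonneg (by positivity)]
      refine mul_le_mul_of_nonneg_right (hB ζ r ?_) (by positivity)
      rw [Metric.mem_ball, dist_zero_right, Real.norm_eq_abs] at hr
      exact hr.le
    · exact Eventually.of_forall fun ζ r _ => (hder ζ r).mul_const _
  simp only [Ph_zero] at hQ
  have hlim1 := hQ.tendsto_slope_zero
  have hd : ∀ s, L2f (fun ζ => Va s w ζ - w ζ) := fun s => (Va_L2 s hw).sub hw
  have eQ : ∀ s : ℝ, ∫ ζ, m (Ph s ζ) * ‖w ζ‖ ^ 2 = (∫ ζ, m ζ * ‖w ζ‖ ^ 2) +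
      (2 * (ip (fun ζ => Va s w ζ - w ζ) (fun ζ => (m ζ : ℂ) * w ζ)).re +
      ∫ ζ, m ζ * ‖Va s w ζ - w ζ‖ ^ 2) := by
    intro s
    have e1 : ∫ ζ, m (Ph s ζ) * ‖w ζ‖ ^ 2 = ∫ ζ, m ζ * ‖Va s w ζ‖ ^ 2 := by
      rw [← Ph_int s (fun ζ => m ζ * ‖Va s w ζ‖ ^ 2)]
      congr 1; funext ζ
      rw [Va, norm_mul, ex_norm, one_mul, Ph_neg]
    have i3 := (hd s).ip_int hmw
    have i4 : Integrable (fun ζ => (conj (Va s w ζ - w ζ) * ((m ζ : ℂ) * w ζ)).re) := i3.re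
    have e2 : (ip (fun ζ => Va s w ζ - w ζ) (fun ζ => (m ζ : ℂ) * w ζ)).re =
        ∫ ζ, (conj (Va s w ζ - w ζ) * ((m ζ : ℂ) * w ζ)).re := by
      unfold ip
      rw [← RCLike.re_eq_complex_re, ← integral_re i3]
    have i5 : Integrable (fun ζ => 2 * (conj (Va s w ζ - w ζ) * ((m ζ : ℂ) * w ζ)).re + m ζ * ‖Va s w ζ - w ζ‖ ^ 2) :=
      (i4.const_mul 2).add (mint _ (hd s))
    rw [e1, e2, ← integral_const_mul, ← integral_add (i4.const_mul 2) (mint _ (hd s)),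
      ← integral_add (mint w hw) i5]
    congr 1; funext ζ
    simp only [← Complex.normSq_eq_norm_sq, RCLike.re_eq_complex_re, Complex.normSq_apply, Complex.mul_re, Complex.mul_im,
      Complex.conj_re, Complex.conj_im, Complex.sub_re, Complex.sub_im, Complex.ofReal_re, Complex.ofReal_im, Pi.add_apply]
    ring
  have hlim2 : Tendsto (fun s : ℝ => s⁻¹ • ((∫ ζ, m (Ph (0 + s) ζ) * ‖w ζ‖ ^ 2) - ∫ ζ, m (Ph 0 ζ) * ‖w ζ‖ ^ 2))
      (𝓝[≠] 0) (𝓝 (2 * (ip f (fun ζ => (m ζ : ℂ) * w ζ)).re + 0)) := by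
    have t1 := (Complex.continuous_re.tendsto _).comp (flow_weak hw hf h hmw)
    have t2 : Tendsto (fun s : ℝ => s⁻¹ * ∫ ζ, m ζ * ‖Va s w ζ - w ζ‖ ^ 2) (𝓝[≠] 0) (𝓝 0) := by
      have t3 : Tendsto (fun s : ℝ => |s| * (K * nr f ^ 2)) (𝓝[≠] 0) (𝓝 0) := by
        have : Tendsto (fun s : ℝ => |s| * (K * nr f ^ 2)) (𝓝 0) (𝓝 (|0| * (K * nr f ^ 2))) :=
          (continuous_abs.mul continuous_const).tendsto 0
        simpa using this.mono_left nhdsWithin_le_nhds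
      refine squeeze_zero_norm' ?_ t3
      filter_upwards [self_mem_nhdsWithin] with s hs0
      have hs0' : s ≠ 0 := hs0
      have b1 : ‖∫ ζ, m ζ * ‖Va s w ζ - w ζ‖ ^ 2‖ ≤ K * nq (fun ζ => Va s w ζ - w ζ) := by
        unfold nq
        rw [← integral_const_mul]
        refine norm_integral_le_of_norm_le ((hd s).sq.const_mul K) (Eventually.of_forall fun ζ => ?_)
        rw [norm_mul, Real.norm_eq_abs, Real.norm_of_nonneg (by positivity)]
        exact mul_le_mul_of_nonneg_right (hmK ζ) (by positivity)
      have b2 := flow_bd hw hf h s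
      have b3 : nq (fun ζ => Va s w ζ - w ζ) ≤ (|s| * nr f) ^ 2 := by
        rw [← nr_sq]; exact pow_le_pow_left₀ (nr_nonneg _) b2 2
      rw [norm_mul, norm_inv, Real.norm_eq_abs]
      calc |s|⁻¹ * ‖∫ ζ, m ζ * ‖Va s w ζ - w ζ‖ ^ 2‖ ≤ |s|⁻¹ * (K * (|s| * nr f) ^ 2) := by
            gcongr
            exact b1.trans (mul_le_mul_of_nonneg_left b3 hK)
        _ = _ := by
          have : |s| ≠ 0 := abs_ne_zero.2 hs0'
          field_simp
    refine ((t1.const_mul 2).add t2).congr fun s => ?_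
    simp only [Function.comp, zero_add, Ph_zero]
    rw [eQ s, Complex.re_ofReal_mul, smul_eq_mul]; ring
  simp only [add_zero] at hlim2
  exact tendsto_nhds_unique hlim1 hlim2

end KH

namespace KH
open SchwartzMap Function Filter
open scoped FourierTransform LineDeriv ContDiff ComplexConjugate Topology

lemma D2.sub {f g : Z n → ℂ} (hf : D2 f) (hg : D2 g) : D2 (fun z => f z - g z) := by
  refine ⟨hf.1.sub hg.1, ?_⟩
  have := hf.2.sub hg.2
  refine (congrArg L2f ?_).mp this
  funext z; simp only [Pi.sub_apply]; ring

lemma apx {σ : ℝ} (hσ1 : σ < 1) {f : Z n → ℂ} (hf : D2 f) {ε : ℝ} (hε : 0 < ε) :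
    ∃ θ : Sch n, D2 (fun z => f z - θ z) ∧ nr (fun z => f z - θ z) ≤ ε ∧
      ns σ (fun z => f z - θ z) ≤ ε ^ 2 := by
  obtain ⟨C, hC, hL⟩ := Lz_le (n := n) hσ1
  have hg : L2f (fun ζ => (Sw Vs 1 ζ : ℂ) * f ζ) := by
    refine (congrArg L2f ?_).mp (hf.1.add hf.2)
    funext z; simp only [Pi.add_apply, Sw]; push_cast; ring
  obtain ⟨φ, hφ⟩ := dense_sch hg (ε := ε / (1 + C)) (by positivity)
  have hgφ : L2f (fun z => (Sw Vs 1 z : ℂ) * f z - φ z) := hg.sub (sL2 φ)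
  have e1 : ∀ z, (Sw Vs 1 z : ℂ) * f z - φ z = (Sw Vs 1 z : ℂ) * (f z - mu (Sp Vs 1 (-1)) φ z) := by
    intro z
    have : (Sw Vs 1 z : ℂ) ≠ 0 := by exact_mod_cast (Sw_pos Vs 1 z).ne'
    rw [mu_apply (Sp_tg _ _ _), Sp_neg_one]; push_cast; field_simp
  have e2 : ∀ z, ‖f z - mu (Sp Vs 1 (-1)) φ z‖ ≤ ‖(Sw Vs 1 z : ℂ) * f z - φ z‖ := by
    intro z
    rw [e1, norm_mul, Complex.norm_real, Real.norm_of_nonneg (Sw_pos _ _ _).le]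
    exact le_mul_of_one_le_left (norm_nonneg _) (Sw_ge _ _ _)
  have hle : ε / (1 + C) ≤ ε := div_le_self hε.le (by linarith)
  have hD := hf.sub (sD2 (mu (Sp Vs 1 (-1)) φ))
  refine ⟨mu (Sp Vs 1 (-1)) φ, hD, (nr_mono hgφ e2).trans (hφ.trans hle), ?_⟩
  have e3 : ns σ (fun z => f z - mu (Sp Vs 1 (-1)) φ z) ≤ (1 + C) * nq (fun z => (Sw Vs 1 z : ℂ) * f z - φ z) := by
    rw [ns, nq, ← integral_const_mul]
    refine integral_mono (hD.nsint hσ1) (hgφ.sq.const_mul _) fun z => ?_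
    simp only
    rw [e1, norm_mul, Complex.norm_real, Real.norm_of_nonneg (Sw_pos _ _ _).le, mul_pow, ← mul_assoc]
    refine mul_le_mul_of_nonneg_right ?_ (by positivity)
    have h1 := hL z
    have h2 := sqJ_nonneg Vs z
    have h3 : Sw Vs 1 z = 1 + sqJ Vs z := by simp [Sw]
    rw [h3]
    nlinarith [mul_nonneg hC h2]
  rw [← nr_sq] at e3
  have e4 : nr (fun z => (Sw Vs 1 z : ℂ) * f z - φ z) ^ 2 ≤ (ε / (1 + C)) ^ 2 :=
    pow_le_pow_left₀ (nr_nonneg _) hφ 2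
  have e5 : (1 + C) * (ε / (1 + C)) ^ 2 = ε * (ε / (1 + C)) := by field_simp
  nlinarith

lemma ns_add_le2 {σ : ℝ} (hσ1 : σ < 1) {f g h : Z n → ℂ} (hf : D2 f) (hg : D2 g)
    (hh : ∀ z, h z = f z + g z) : ns σ h ≤ 2 * ns σ f + 2 * ns σ g := by
  have i1 := hf.nsint hσ1
  have i2 := hg.nsint hσ1
  rw [ns, ns, ns, ← integral_const_mul, ← integral_const_mul, ← integral_add (i1.const_mul 2) (i2.const_mul 2)]
  refine integral_mono_of_nonneg (Eventually.of_forall fun ζ => ?_) ((i1.const_mul 2).add (i2.const_mul 2))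
    (Eventually.of_forall fun ζ => ?_)
  · have := Lz_nonneg σ ζ; simp only [Pi.zero_apply]; positivity
  · simp only [Pi.add_apply]
    have h0 := Lz_nonneg σ ζ
    have h1 : ‖h ζ‖ ≤ ‖f ζ‖ + ‖g ζ‖ := by rw [hh]; exact norm_add_le _ _
    have h2 : ‖h ζ‖ ^ 2 ≤ 2 * ‖f ζ‖ ^ 2 + 2 * ‖g ζ‖ ^ 2 := by
      have := pow_le_pow_left₀ (norm_nonneg _) h1 2
      nlinarith [sq_nonneg (‖f ζ‖ - ‖g ζ‖)]
    nlinarith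

lemma lim_help {x y B : ℝ} (h : ∀ ε : ℝ, 0 < ε → ε ≤ 1 → x ≤ y + ε * B) : x ≤ y := by
  by_contra hc
  push Not at hc
  have h1 : 0 < (x - y) / (2 * (|B| + 1 + (x - y))) := by
    have := abs_nonneg B
    apply div_pos <;> linarith
  have hx : 0 < x - y := by linarith
  have hB := abs_nonneg B
  have h2 : (x - y) / (2 * (|B| + 1 + (x - y))) ≤ 1 := by
    rw [div_le_one (by positivity)]; linarith
  have h3 := h _ h1 h2
  have h4 : (x - y) / (2 * (|B| + 1 + (x - y))) * B ≤ (x - y) / (2 * (|B| + 1 + (x - y))) * (|B| + 1 + (x - y)) := by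
    refine mul_le_mul_of_nonneg_left ?_ h1.le
    linarith [le_abs_self B]
  have h5 : (x - y) / (2 * (|B| + 1 + (x - y))) * (|B| + 1 + (x - y)) = (x - y) / 2 := by
    field_simp
  linarith

lemma nr_theta {f : Z n → ℂ} (hf : L2f f) {θ : Sch n} {ε : ℝ} (h : nr (fun z => f z - θ z) ≤ ε) :
    nr θ ≤ nr f + ε := by
  have hd : L2f (fun z => f z - θ z) := hf.sub (sL2 θ)
  have h1 := nr_add_le hf hd.neg
  have h2 : (f + -(fun z => f z - θ z)) = (θ : Z n → ℂ) := by funext z; simp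
  have h3 : nr (-(fun z => f z - θ z)) = nr (fun z => f z - θ z) := by
    simp only [nr, nq, Pi.neg_apply, norm_neg]
  rw [h2, h3] at h1
  linarith

lemma ns_theta {σ : ℝ} (hσ1 : σ < 1) {f : Z n → ℂ} (hf : D2 f) {θ : Sch n} {ε : ℝ} (hε : 0 ≤ ε)
    (hd : D2 (fun z => f z - θ z)) (h : ns σ (fun z => f z - θ z) ≤ ε ^ 2) :
    Real.sqrt (ns σ θ) ≤ 2 * Real.sqrt (ns σ f) + 2 * ε ∧ ns σ f ≤ 2 * ns σ θ + 2 * ε ^ 2 := by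
  constructor
  · have hd' : D2 (fun z => -(f z - θ z)) := by
      refine (congrArg D2 ?_).mp ((sD2 θ).sub hf)
      funext z; ring
    have e1 := ns_add_le2 hσ1 hf hd' (h := θ) (fun z => by ring)
    have e2 : ns σ (fun z => -(f z - θ z)) = ns σ (fun z => f z - θ z) := by simp only [ns, norm_neg]
    rw [e2] at e1
    have h0 := Real.sqrt_nonneg (ns σ f)
    rw [Real.sqrt_le_left (by positivity)]
    have := Real.sq_sqrt (ns_nonneg σ f)
    nlinarith [mul_nonneg h0 hε]
  · have e1 := ns_add_le2 hσ1 (sD2 θ) hd (h := f) (fun z => by ring)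
    linarith

lemma formlim {σ : ℝ} (hσ1 : σ < 1) {f v : Z n → ℂ} (hf : L2f f) (hv : D2 v) {M L : ℝ} (hM : 0 ≤ M) (hL : 0 ≤ L)
    (h : ∀ θ : Sch n, ‖ip f θ‖ ≤ M * nr θ + L * Real.sqrt (ns σ θ)) :
    ‖ip f v‖ ≤ M * nr v + 2 * L * Real.sqrt (ns σ v) := by
  refine lim_help (B := M + 2 * L + nr f) fun ε hε hε1 => ?_
  obtain ⟨θ, hD, h1, h2⟩ := apx hσ1 hv hε
  have h3 := nr_theta hv.1 h1
  have h4 := (ns_theta hσ1 hv hε.le hD h2).1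
  have e1 : ip f v = ip f θ + ip f (fun z => v z - θ z) := by
    rw [ip_sub_right hf hv.1 (sL2 θ)]; ring
  have e2 := ip_le hf hD.1
  have e3 := norm_add_le (ip f θ) (ip f (fun z => v z - θ z))
  have e4 := h θ
  rw [← e1] at e3
  have e5 : nr f * nr (fun z => v z - θ z) ≤ nr f * ε := mul_le_mul_of_nonneg_left h1 (nr_nonneg f)
  have e6 := mul_le_mul_of_nonneg_left h3 hM
  have e7 := mul_le_mul_of_nonneg_left h4 hL
  linarith

set_option maxHeartbeats 1000000 in
lemma energy1 (hn : 1 ≤ n) {σ : ℝ} (hσ0 : 0 < σ) (hσ1 : σ < 1) {w : E n → ℝ} (hw : Wc w)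
    {a : Z n → ℝ} (hb : CB (fun z => (a z : ℂ))) {a₀ : ℝ} (ha₀ : 0 < a₀) (h : ∀ z, a₀ ≤ a z) :
    ∃ c C D, 0 < c ∧ 0 ≤ C ∧ 0 ≤ D ∧ ∀ (T : Sch n →L[ℂ] Sch n) (CT : ℝ), 0 ≤ CT →
      (∀ θ, ns σ (T θ) ≤ CT * ns σ θ) → ∀ ϑ : ℝ, 0 ≤ ϑ → ∀ v f q : Z n → ℂ, D2 v → L2f f → L2f q →
      (∀ θ : Sch n, ip f θ = ip q θ - (ip (fun ζ => (Fz σ w ζ : ℂ) * v ζ) (Aop (fun z => (a z : ℂ)) θ) +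
        (ϑ : ℂ) * ip (fun ζ => (Fz σ w ζ : ℂ) * v ζ) (T θ))) → 0 ≤ (ip f v).re →
      c * ns σ v ≤ C * nq v + ϑ * (D * Real.sqrt CT) * ns σ v + nr q * nr v := by
  obtain ⟨c, C, hc, hC, h1⟩ := Fcoer hn hσ0 hσ1 hw hb ha₀ h
  obtain ⟨D, hD, h2⟩ := F_form (n := n) hn hσ0 hσ1 hw
  obtain ⟨A, hA, h3⟩ := ns_Aop hσ1 hb
  refine ⟨c / 2, 2 * C, 2 * D, by positivity, by positivity, by positivity, ?_⟩
  intro T CT hCT hT ϑ hϑ v f q hv hf hq heq hpos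
  set V := Real.sqrt (ns σ v) with hV
  have hV0 : 0 ≤ V := Real.sqrt_nonneg _
  have hV2 : V * V = ns σ v := Real.mul_self_sqrt (ns_nonneg σ v)
  refine lim_help (B := c + 2 * C + D * Real.sqrt A * (2 * V + 2) + 2 * ϑ * (D * Real.sqrt CT) * V + nr q + nr f + 2 * C * nr v)
    fun ε hε hε1 => ?_
  obtain ⟨θ, hD2, e1, e2⟩ := apx hσ1 hv hε
  obtain ⟨e3, e4⟩ := ns_theta hσ1 hv hε.le hD2 e2
  have e5 := nr_theta hv.1 e1
  have nA : Real.sqrt (ns σ (Aop (fun z => (a z : ℂ)) θ)) ≤ Real.sqrt A * Real.sqrt (ns σ θ) := by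
    rw [← Real.sqrt_mul hA]; exact Real.sqrt_le_sqrt (h3 θ)
  have nT : Real.sqrt (ns σ (T θ)) ≤ Real.sqrt CT * Real.sqrt (ns σ θ) := by
    rw [← Real.sqrt_mul hCT]; exact Real.sqrt_le_sqrt (hT θ)
  have f1 := h1 θ
  have f2 := h2 _ _ hD2 (sD2 (Aop (fun z => (a z : ℂ)) θ))
  have f3 := h2 _ _ hv (sD2 (T θ))
  have f4 := heq θ
  have f5 : ip (fun ζ => (Fz σ w ζ : ℂ) * v ζ) (Aop (fun z => (a z : ℂ)) θ) =
      ip (fun ζ => (Fz σ w ζ : ℂ) * θ ζ) (Aop (fun z => (a z : ℂ)) θ) +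
      ip (fun ζ => (Fz σ w ζ : ℂ) * (v ζ - θ ζ)) (Aop (fun z => (a z : ℂ)) θ) := by
    rw [← ip_add_left ((sD2 θ).F hσ0 hσ1 hw) (hD2.F hσ0 hσ1 hw) (sL2 _)]
    congr 1; funext z; ring
  have f6 : ip f v = ip f θ + ip f (fun z => v z - θ z) := by
    rw [ip_sub_right hf hv.1 (sL2 θ)]; ring
  have f7 := ip_le hf hD2.1
  have f8 := ip_le hq (sL2 θ)
  have g1 : Real.sqrt (ns σ (fun z => v z - θ z)) ≤ ε := by
    rw [Real.sqrt_le_left hε.le]; exact e2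
  set sθ := Real.sqrt (ns σ θ) with hsθ
  have hs0 : 0 ≤ sθ := Real.sqrt_nonneg _
  have g2 : ‖ip (fun ζ => (Fz σ w ζ : ℂ) * (v ζ - θ ζ)) (Aop (fun z => (a z : ℂ)) θ)‖ ≤
      ε * (D * Real.sqrt A * (2 * V + 2)) := by
    refine f2.trans ?_
    calc D * Real.sqrt (ns σ (fun z => v z - θ z)) * Real.sqrt (ns σ (Aop (fun z => (a z : ℂ)) θ))
        ≤ D * ε * (Real.sqrt A * (2 * V + 2)) := by
          refine mul_le_mul (mul_le_mul_of_nonneg_left g1 hD) (nA.trans ?_) (Real.sqrt_nonneg _) (by positivity)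
          refine mul_le_mul_of_nonneg_left ?_ (Real.sqrt_nonneg _)
          linarith
      _ = _ := by ring
  have g3 : ‖(ϑ : ℂ) * ip (fun ζ => (Fz σ w ζ : ℂ) * v ζ) (T θ)‖ ≤
      ϑ * (D * V * (Real.sqrt CT * (2 * V + 2 * ε))) := by
    rw [norm_mul, Complex.norm_real, Real.norm_of_nonneg hϑ]
    refine mul_le_mul_of_nonneg_left (f3.trans ?_) hϑ
    refine mul_le_mul_of_nonneg_left (nT.trans ?_) (by positivity)
    exact mul_le_mul_of_nonneg_left e3 (Real.sqrt_nonneg _)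
  have g4 : ‖ip f (fun z => v z - θ z)‖ ≤ nr f * ε := f7.trans (mul_le_mul_of_nonneg_left e1 (nr_nonneg _))
  have g5 : ‖ip q θ‖ ≤ nr q * (nr v + ε) := f8.trans (mul_le_mul_of_nonneg_left e5 (nr_nonneg _))
  have g6 : nq θ ≤ 2 * nq v + (2 * ε ^ 2) := by
    rw [← nr_sq, ← nr_sq]
    have := pow_le_pow_left₀ (nr_nonneg _) e5 2
    nlinarith [sq_nonneg (nr v - ε)]
  have r1 := congrArg Complex.re f4
  have r2 := congrArg Complex.re f5
  have r3 := congrArg Complex.re f6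
  simp only [Complex.add_re, Complex.sub_re] at r1 r2 r3
  have k1 := (abs_le.1 (Complex.abs_re_le_norm (ip (fun ζ => (Fz σ w ζ : ℂ) * (v ζ - θ ζ)) (Aop (fun z => (a z : ℂ)) θ)))).1
  have k2 := (abs_le.1 (Complex.abs_re_le_norm ((ϑ : ℂ) * ip (fun ζ => (Fz σ w ζ : ℂ) * v ζ) (T θ)))).1
  have k3 := Complex.re_le_norm (ip f (fun z => v z - θ z))
  have k4 := Complex.re_le_norm (ip q θ)
  have k5 : C * nq θ ≤ C * (2 * nq v + (2 * ε ^ 2)) := mul_le_mul_of_nonneg_left g6 hC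
  have k6 : c * ns σ v ≤ c * (2 * ns σ θ + 2 * ε ^ 2) := mul_le_mul_of_nonneg_left e4 hc.le
  have k7 : ε ^ 2 ≤ ε := by nlinarith
  have k8 := mul_le_mul_of_nonneg_left k7 hc.le
  have k9 := mul_le_mul_of_nonneg_left k7 hC
  have k10 : ϑ * (D * V * (Real.sqrt CT * (2 * V + 2 * ε))) =
     ϑ * (2 * D * Real.sqrt CT) * ns σ v + ε * (2 * ϑ * (D * Real.sqrt CT) * V) := by rw [← hV2]; ring
  have k11 : 0 ≤ ε * (2 * C * nr v) := by have := nr_nonneg v; positivity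
  linarith

end KH

namespace KH
open SchwartzMap Function Filter
open scoped FourierTransform LineDeriv ContDiff ComplexConjugate Topology

/-- `|ξ|²` -/
def pX (ζ : Z n) : ℝ := ∑ i : Fin n, ζ (ix i) ^ 2
/-- `|η|²` -/
def qV (ζ : Z n) : ℝ := ∑ i : Fin n, ζ (iv i) ^ 2
/-- `ξ·η` -/
def rX (ζ : Z n) : ℝ := ∑ i : Fin n, ζ (ix i) * ζ (iv i)

lemma pX_nonneg (ζ : Z n) : 0 ≤ pX ζ := Finset.sum_nonneg fun _ _ => sq_nonneg _
lemma qV_nonneg (ζ : Z n) : 0 ≤ qV ζ := Finset.sum_nonneg fun _ _ => sq_nonneg _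
lemma rX_sq (ζ : Z n) : rX ζ ^ 2 ≤ pX ζ * qV ζ := Finset.sum_mul_sq_le_sq_mul_sq _ _ _
lemma pX_eq (ζ : Z n) : pX ζ = ‖xC ζ‖ ^ 2 := by rw [EuclideanSpace.real_norm_sq_eq]; rfl
lemma qV_eq (ζ : Z n) : qV ζ = ‖vC ζ‖ ^ 2 := by rw [EuclideanSpace.real_norm_sq_eq]; rfl
lemma sqV (ζ : Z n) : sqJ Vs ζ = qV ζ := by rw [sqJ_Vs, qV_eq]
lemma sqXV (ζ : Z n) : sqJ XVs ζ = pX ζ + qV ζ := by rw [sqJ_XVs, qV_eq, pX_eq]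
lemma pX_cont : Continuous (pX (n := n)) := by unfold pX; fun_prop
lemma qV_cont : Continuous (qV (n := n)) := by unfold qV; fun_prop
lemma rX_cont : Continuous (rX (n := n)) := by unfold rX; fun_prop

lemma Ph_ix (s : ℝ) (ζ : Z n) (i : Fin n) : Ph s ζ (ix i) = ζ (ix i) := by simp [Ph_apply]
lemma Ph_iv (s : ℝ) (ζ : Z n) (i : Fin n) : Ph s ζ (iv i) = ζ (iv i) + s * ζ (ix i) := by simp [Ph_apply]
lemma pX_Ph (s : ℝ) (ζ : Z n) : pX (Ph s ζ) = pX ζ := by simp only [pX, Ph_ix]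
lemma rX_Ph (s : ℝ) (ζ : Z n) : rX (Ph s ζ) = rX ζ + s * pX ζ := by
  simp only [rX, pX, Ph_ix, Ph_iv, Finset.mul_sum, ← Finset.sum_add_distrib]
  refine Finset.sum_congr rfl fun i _ => by ring
lemma qV_Ph (s : ℝ) (ζ : Z n) : qV (Ph s ζ) = qV ζ + 2 * s * rX ζ + s ^ 2 * pX ζ := by
  simp only [rX, pX, qV, Ph_iv, Finset.mul_sum, ← Finset.sum_add_distrib]
  refine Finset.sum_congr rfl fun i _ => by ring

section real
variable {p q r δ σ : ℝ}

lemma mul_a (hp : 0 ≤ p) (hq : 0 ≤ q) (hr : r ^ 2 ≤ p * q) (hδ1 : δ ≤ 1 / 4) :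
    |r * (1 + p + q ^ 2) ^ (δ - 1)| ≤ 1 := by
  set D := 1 + p + q ^ 2 with hD
  have hD1 : 1 ≤ D := by nlinarith
  have hD0 : 0 < D := by linarith
  have h1 : D ^ (δ - 1) ≤ D ^ (-(3 / 4) : ℝ) := Real.rpow_le_rpow_of_exponent_le hD1 (by linarith)
  have h2 : q ≤ D ^ (1 / 2 : ℝ) := by
    rw [← Real.sqrt_eq_rpow]; exact Real.le_sqrt_of_sq_le (by nlinarith)
  have h3 : (D ^ (-(3 / 4) : ℝ)) ^ 2 = D ^ (-(3 / 2) : ℝ) := by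
    rw [← Real.rpow_natCast, ← Real.rpow_mul hD0.le]; norm_num
  have h4 : D * D ^ (1 / 2 : ℝ) * D ^ (-(3 / 2) : ℝ) = 1 := by
    nth_rw 1 [← Real.rpow_one D]
    rw [← Real.rpow_add hD0, ← Real.rpow_add hD0]; norm_num
  have h0 : 0 ≤ D ^ (δ - 1) := by positivity
  rw [abs_le_one_iff_mul_self_le_one]
  calc r * D ^ (δ - 1) * (r * D ^ (δ - 1)) = r ^ 2 * (D ^ (δ - 1)) ^ 2 := by ring
    _ ≤ (D * D ^ (1 / 2 : ℝ)) * (D ^ (-(3 / 4) : ℝ)) ^ 2 := by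
      gcongr
      exact hr.trans (mul_le_mul (by nlinarith) h2 hq hD0.le)
    _ = 1 := by rw [h3, h4]

lemma mul_b0 (hp : 0 ≤ p) (hq : 0 ≤ q) (hr : r ^ 2 ≤ p * q) :
    0 ≤ 4 * (q * r ^ 2) * (1 + p + q ^ 2) ^ (δ - 2) ∧
    4 * (q * r ^ 2) * (1 + p + q ^ 2) ^ (δ - 2) ≤ 4 * (p * q ^ 2) * (1 + p + q ^ 2) ^ (δ - 2) ∧
    4 * (p * q ^ 2) * (1 + p + q ^ 2) ^ (δ - 2) ≤ 4 * (1 + p + q ^ 2) ^ δ := by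
  set D := 1 + p + q ^ 2 with hD
  have hD1 : 1 ≤ D := by nlinarith
  have hD0 : 0 < D := by linarith
  have h0 : 0 ≤ D ^ (δ - 2) := by positivity
  refine ⟨by positivity, ?_, ?_⟩
  · refine mul_le_mul_of_nonneg_right ?_ h0
    nlinarith
  · have h1 : D ^ δ = D ^ 2 * D ^ (δ - 2) := by
      rw [← Real.rpow_natCast, ← Real.rpow_add hD0]; norm_num
    rw [h1, ← mul_assoc 4 (D ^ 2)]
    refine mul_le_mul_of_nonneg_right ?_ h0
    nlinarith [sq_nonneg q]

lemma mul_b (hp : 0 ≤ p) (hq : 0 ≤ q) (hr : r ^ 2 ≤ p * q) (hδ : 0 < δ) (hδ1 : δ ≤ 1 / 4) :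
    |p * (1 + p + q ^ 2) ^ (δ - 1) - (1 - δ) * (4 * (q * r ^ 2) * (1 + p + q ^ 2) ^ (δ - 2))| ≤ 5 * (1 + p + q ^ 2) := by
  obtain ⟨h1, h2, h3⟩ := mul_b0 (δ := δ) hp hq hr
  set D := 1 + p + q ^ 2 with hD
  have hD1 : 1 ≤ D := by nlinarith
  have hD0 : 0 < D := by linarith
  have h4 : D ^ δ ≤ D := by
    nth_rw 2 [← Real.rpow_one D]
    exact Real.rpow_le_rpow_of_exponent_le hD1 (by linarith)
  have h5 : D ^ (δ - 1) ≤ 1 := Real.rpow_le_one_of_one_le_of_nonpos hD1 (by linarith)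
  have h6 : 0 ≤ D ^ (δ - 1) := by positivity
  have h7 : p * D ^ (δ - 1) ≤ D := by nlinarith [sq_nonneg q]
  have h8 : 0 ≤ p * D ^ (δ - 1) := by positivity
  rw [abs_le]
  constructor <;> nlinarith

lemma mul_c (hp : 0 ≤ p) (hq : 0 ≤ q) (hr : r ^ 2 ≤ p * q) (hδ : 0 < δ) (hδ1 : δ ≤ 1 / 4) (hσ : 2 * δ ≤ σ) :
    p ^ δ ≤ 8 * (p * (1 + p + q ^ 2) ^ (δ - 1) - (1 - δ) * (4 * (q * r ^ 2) * (1 + p + q ^ 2) ^ (δ - 2))) +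
      400 * (1 + q ^ σ) := by
  obtain ⟨h1, h2, h3⟩ := mul_b0 (δ := δ) hp hq hr
  have hqs : 0 ≤ q ^ σ := Real.rpow_nonneg hq _
  set D := 1 + p + q ^ 2 with hD
  have hD1 : 1 ≤ D := by nlinarith
  have hD0 : 0 < D := by linarith
  have h6 : 0 ≤ D ^ (δ - 1) := by positivity
  have h8 : 0 ≤ p * D ^ (δ - 1) := by positivity
  have h9 : D ^ (δ - 1) = D * D ^ (δ - 2) := by
    nth_rw 2 [← Real.rpow_one D]
    rw [← Real.rpow_add hD0]; congr 1; ring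
  have h10 : D ^ δ = D * D ^ (δ - 1) := by
    nth_rw 2 [← Real.rpow_one D]
    rw [← Real.rpow_add hD0]; congr 1; ring
  by_cases hc : 8 * q ^ 2 ≤ 1 + p
  · have h11 : 4 * (p * q ^ 2) * D ^ (δ - 2) ≤ 1 / 2 * (p * D ^ (δ - 1)) := by
      rw [h9]
      have h0 : 0 ≤ D ^ (δ - 2) := by positivity
      have : 4 * (p * q ^ 2) ≤ 1 / 2 * (p * D) := by nlinarith [sq_nonneg q]
      nlinarith
    have h12 : (1 - δ) * (4 * (q * r ^ 2) * D ^ (δ - 2)) ≤ 1 / 2 * (p * D ^ (δ - 1)) := by nlinarith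
    by_cases hp1 : p ≤ 1
    · have : p ^ δ ≤ 1 := Real.rpow_le_one hp hp1 hδ.le
      nlinarith
    · push Not at hp1
      have h13 : p ^ δ ≤ D ^ δ := Real.rpow_le_rpow hp (by nlinarith) hδ.le
      have h14 : D ^ δ ≤ 4 * (p * D ^ (δ - 1)) := by
        rw [h10]
        have : D ≤ 4 * p := by nlinarith
        nlinarith
      nlinarith
  · push Not at hc
    have h11 : D ≤ 10 * q ^ 2 := by nlinarith
    have hq0 : 0 < q := by
      rcases hq.eq_or_lt with h | h
      · rw [← h] at hc; norm_num at hc; linarith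
      · exact h
    have h12 : D ^ δ ≤ 10 * (1 + q ^ σ) := by
      calc D ^ δ ≤ (10 * q ^ 2) ^ δ := Real.rpow_le_rpow hD0.le h11 hδ.le
        _ = 10 ^ δ * (q ^ (2 * δ)) := by
          rw [Real.mul_rpow (by norm_num) (by positivity), ← Real.rpow_natCast q 2, ← Real.rpow_mul hq]
          norm_num
        _ ≤ 10 * (1 + q ^ σ) := by
          refine mul_le_mul ?_ ?_ (by positivity) (by norm_num)
          · nth_rw 2 [← Real.rpow_one 10]
            exact Real.rpow_le_rpow_of_exponent_le (by norm_num) (by linarith)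
          · rcases le_total q 1 with h | h
            · have := Real.rpow_le_one hq h (by linarith : 0 ≤ 2 * δ)
              linarith
            · have := Real.rpow_le_rpow_of_exponent_le h hσ
              linarith
    have h13 : p ^ δ ≤ D ^ δ := Real.rpow_le_rpow hp (by nlinarith) hδ.le
    nlinarith
end real

/-- the bounded multiplier -/
def mm (δ : ℝ) (ζ : Z n) : ℝ := rX ζ * (1 + pX ζ + qV ζ ^ 2) ^ (δ - 1)
/-- its derivative along the flow -/
def mm' (δ : ℝ) (ζ : Z n) : ℝ := pX ζ * (1 + pX ζ + qV ζ ^ 2) ^ (δ - 1) -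
  (1 - δ) * (4 * (qV ζ * rX ζ ^ 2) * (1 + pX ζ + qV ζ ^ 2) ^ (δ - 2))

lemma DD_pos (ζ : Z n) : 0 < 1 + pX ζ + qV ζ ^ 2 := by
  have := pX_nonneg ζ; positivity

lemma mm_cont (δ : ℝ) : Continuous (mm (n := n) δ) := by
  unfold mm
  refine rX_cont.mul (Continuous.rpow_const ?_ fun ζ => Or.inl (DD_pos ζ).ne')
  exact (continuous_const.add pX_cont).add (qV_cont.pow 2)
lemma mm'_cont (δ : ℝ) : Continuous (mm' (n := n) δ) := by
  have h : Continuous fun ζ : Z n => 1 + pX ζ + qV ζ ^ 2 := (continuous_const.add pX_cont).add (qV_cont.pow 2)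
  have h1 : ∀ r : ℝ, Continuous fun ζ : Z n => (1 + pX ζ + qV ζ ^ 2) ^ r := fun r =>
    Continuous.rpow_const h fun ζ => Or.inl (DD_pos ζ).ne'
  unfold mm'
  exact (pX_cont.mul (h1 _)).sub (continuous_const.mul ((continuous_const.mul (qV_cont.mul (rX_cont.pow 2))).mul (h1 _)))

lemma mm_der (δ : ℝ) (ζ : Z n) (s : ℝ) : HasDerivAt (fun s => mm δ (Ph s ζ)) (mm' δ (Ph s ζ)) s := by
  unfold mm mm'
  have hr : HasDerivAt (fun s => rX (Ph s ζ)) (pX ζ) s := by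
    simp_rw [rX_Ph]
    simpa using ((hasDerivAt_id s).mul_const (pX ζ)).const_add (rX ζ)
  have hq : HasDerivAt (fun s => qV (Ph s ζ)) (2 * rX (Ph s ζ)) s := by
    simp_rw [rX_Ph, qV_Ph]
    have h1 := (((hasDerivAt_id s).const_mul 2).mul_const (rX ζ)).const_add (qV ζ)
    have h2 := ((hasDerivAt_id s).pow 2).mul_const (pX ζ)
    refine (h1.add h2).congr_deriv ?_
    simp; ring
  have hD : HasDerivAt (fun s => 1 + pX (Ph s ζ) + qV (Ph s ζ) ^ 2) (4 * qV (Ph s ζ) * rX (Ph s ζ)) s := by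
    simp_rw [pX_Ph]
    have := (hq.pow 2).const_add (1 + pX ζ)
    refine this.congr_deriv ?_
    simp; ring
  have h := hr.mul (hD.rpow_const (p := δ - 1) (Or.inl (DD_pos _).ne'))
  refine h.congr_deriv ?_
  rw [pX_Ph, show δ - 1 - 1 = δ - 2 by ring]; ring

lemma mm'_bd {δ : ℝ} (hδ : 0 < δ) (hδ1 : δ ≤ 1 / 4) (ζ : Z n) (s : ℝ) (hs : |s| ≤ 1) :
    |mm' δ (Ph s ζ)| ≤ 45 * (1 + sqJ XVs ζ) ^ 2 := by
  have h := mul_b (pX_nonneg (Ph s ζ)) (qV_nonneg (Ph s ζ)) (rX_sq (Ph s ζ)) hδ hδ1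
  refine h.trans ?_
  have hp := pX_nonneg ζ
  have hq := qV_nonneg ζ
  have h1 : qV (Ph s ζ) ≤ 2 * (pX ζ + qV ζ) := by
    rw [qV_Ph]
    have e1 : |rX ζ| ≤ (pX ζ + qV ζ) / 2 := by
      apply abs_le_of_sq_le_sq _ (by positivity)
      nlinarith [rX_sq ζ, sq_nonneg (pX ζ - qV ζ)]
    have e2 : s * rX ζ ≤ (pX ζ + qV ζ) / 2 := by
      calc s * rX ζ ≤ |s * rX ζ| := le_abs_self _
        _ = |s| * |rX ζ| := abs_mul _ _
        _ ≤ 1 * ((pX ζ + qV ζ) / 2) := mul_le_mul hs e1 (abs_nonneg _) zero_le_one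
        _ = _ := one_mul _
    have e3 : s ^ 2 ≤ 1 := by rw [← sq_abs]; nlinarith [abs_nonneg s]
    nlinarith
  have h2 := qV_nonneg (Ph s ζ)
  rw [pX_Ph, sqXV]
  nlinarith

lemma energy2 (hn : 1 ≤ n) {σ δ : ℝ} (hσ0 : 0 < σ) (hσ1 : σ < 1) (hδ : 0 < δ) (hδ1 : δ ≤ 1 / 4) (hδσ : 2 * δ ≤ σ) :
    ∃ C, 0 ≤ C ∧ ∀ (v f : Z n → ℂ) (M L : ℝ), D2 v → L2f (fun ζ => (sqJ XVs ζ : ℂ) * v ζ) → L2f f → 0 ≤ M → 0 ≤ L →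
      (∀ θ : Sch n, ip v (Xop θ) = ip f θ) → (∀ θ : Sch n, ‖ip f θ‖ ≤ M * nr θ + L * Real.sqrt (ns σ θ)) →
      Integrable (fun ζ => (pX ζ ^ δ + qV ζ ^ σ) * ‖v ζ‖ ^ 2) ∧
      ∫ ζ, (pX ζ ^ δ + qV ζ ^ σ) * ‖v ζ‖ ^ 2 ≤ 16 * (M * nr v + 2 * L * Real.sqrt (ns σ v)) + C * ns σ v := by
  obtain ⟨C1, hC1, hL⟩ := Lz_approx (n := n) hσ0 hσ1
  have hc := cσ_pos hn hσ0 hσ1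
  set A := (cσ σ)⁻¹ * (C1 + 1) with hA
  have hA0 : 0 ≤ A := by positivity
  have hqA : ∀ ζ : Z n, qV ζ ^ σ ≤ A * (1 + Lz σ ζ) := by
    intro ζ
    have h1 := (abs_le.1 (hL ζ)).1
    rw [sqV] at h1
    have h2 := Lz_nonneg σ ζ
    rw [hA, mul_assoc, ← div_eq_inv_mul, le_div_iff₀ hc]
    nlinarith
  refine ⟨400 + 401 * A, by positivity, fun v f M L hv hxv hf hM hL0 hX hbd => ?_⟩
  have hG : L2f (fun ζ => ((1 + sqJ XVs ζ : ℝ) : ℂ) * v ζ) := by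
    refine (congrArg L2f ?_).mp (hv.1.add hxv)
    funext ζ; simp only [Pi.add_apply]; push_cast; ring
  have hGi : Integrable (fun ζ => 45 * (1 + sqJ XVs ζ) ^ 2 * ‖v ζ‖ ^ 2) := by
    refine (hG.sq.const_mul 45).congr (Eventually.of_forall fun ζ => ?_)
    simp only [norm_mul, Complex.norm_real, mul_pow, Real.norm_eq_abs, sq_abs, mul_assoc]
  have hm1 : ∀ ζ : Z n, |mm δ ζ| ≤ 1 := fun ζ => mul_a (pX_nonneg ζ) (qV_nonneg ζ) (rX_sq ζ) hδ1
  have hfl := flow hv.1 hf hX (mm_cont δ) hm1 (fun ζ s => mm_der δ ζ s) (fun ζ s hs => mm'_bd hδ hδ1 ζ s hs)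
    (mm'_cont δ) hGi
  have hmi : Integrable (fun ζ => mm' δ ζ * ‖v ζ‖ ^ 2) := by
    refine hGi.mono' ((mm'_cont δ).aestronglyMeasurable.mul hv.1.sq.1) (Eventually.of_forall fun ζ => ?_)
    rw [norm_mul, Real.norm_eq_abs, Real.norm_of_nonneg (by positivity)]
    have := mm'_bd hδ hδ1 ζ 0 (by simp)
    rw [Ph_zero] at this
    exact mul_le_mul_of_nonneg_right this (by positivity)
  have hmv : D2 (fun ζ => (mm δ ζ : ℂ) * v ζ) := by
    have hmeas : AEStronglyMeasurable (fun ζ : Z n => (mm δ ζ : ℂ)) volume :=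
      (Complex.continuous_ofReal.comp (mm_cont δ)).aestronglyMeasurable
    refine ⟨hv.1.of_le (hmeas.mul hv.1.1) (Eventually.of_forall fun ζ => ?_), ?_⟩
    · rw [norm_mul, Complex.norm_real, Real.norm_eq_abs]
      exact mul_le_of_le_one_left (norm_nonneg _) (hm1 ζ)
    · have : L2f (fun ζ => (mm δ ζ : ℂ) * ((sqJ Vs ζ : ℂ) * v ζ)) :=
        hv.2.of_le (hmeas.mul hv.2.1) (Eventually.of_forall fun ζ => by
          rw [norm_mul, Complex.norm_real, Real.norm_eq_abs]
          exact mul_le_of_le_one_left (norm_nonneg _) (hm1 ζ))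
      refine (congrArg L2f ?_).mp this
      funext ζ; ring
  have hpt : ∀ ζ, ‖(mm δ ζ : ℂ) * v ζ‖ ≤ 1 * ‖v ζ‖ := fun ζ => by
    rw [norm_mul, Complex.norm_real, Real.norm_eq_abs]
    exact mul_le_mul_of_nonneg_right (hm1 ζ) (norm_nonneg _)
  have n1 := nr_le hv.1 zero_le_one hpt
  have n2 := ns_le hσ1 hv hpt
  rw [one_pow, one_mul] at n2
  rw [one_mul] at n1
  have hfm := formlim hσ1 hf hmv hM hL0 hbd
  have hfm2 : ‖ip f (fun ζ => (mm δ ζ : ℂ) * v ζ)‖ ≤ M * nr v + 2 * L * Real.sqrt (ns σ v) := by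
    refine hfm.trans (add_le_add (mul_le_mul_of_nonneg_left n1 hM) (mul_le_mul_of_nonneg_left (Real.sqrt_le_sqrt n2) (by positivity)))
  have hre := Complex.re_le_norm (ip f (fun ζ => (mm δ ζ : ℂ) * v ζ))
  have hpw : ∀ ζ : Z n, (pX ζ ^ δ + qV ζ ^ σ) * ‖v ζ‖ ^ 2 ≤ 8 * (mm' δ ζ * ‖v ζ‖ ^ 2) +
      (400 + 401 * A) * ((1 + Lz σ ζ) * ‖v ζ‖ ^ 2) := by
    intro ζ
    have h1 : pX ζ ^ δ ≤ 8 * mm' δ ζ + 400 * (1 + qV ζ ^ σ) := mul_c (pX_nonneg ζ) (qV_nonneg ζ) (rX_sq ζ) hδ hδ1 hδσ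
    have h2 := hqA ζ
    have h3 := Lz_nonneg σ ζ
    have h4 : pX ζ ^ δ + qV ζ ^ σ ≤ 8 * mm' δ ζ + (400 + 401 * A) * (1 + Lz σ ζ) := by nlinarith
    have := mul_le_mul_of_nonneg_right h4 (by positivity : 0 ≤ ‖v ζ‖ ^ 2)
    linarith
  have hRi : Integrable (fun ζ => 8 * (mm' δ ζ * ‖v ζ‖ ^ 2) + (400 + 401 * A) * ((1 + Lz σ ζ) * ‖v ζ‖ ^ 2)) :=
    (hmi.const_mul 8).add ((hv.nsint hσ1).const_mul _)
  have h0 : ∀ ζ : Z n, 0 ≤ (pX ζ ^ δ + qV ζ ^ σ) * ‖v ζ‖ ^ 2 := fun ζ => by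
    have := pX_nonneg ζ
    have := qV_nonneg ζ
    positivity
  have hI : Integrable (fun ζ => (pX ζ ^ δ + qV ζ ^ σ) * ‖v ζ‖ ^ 2) := by
    refine hRi.mono' (AEStronglyMeasurable.mul ?_ hv.1.sq.1) (Eventually.of_forall fun ζ => ?_)
    · exact ((pX_cont.rpow_const fun _ => Or.inr hδ.le).add (qV_cont.rpow_const fun _ => Or.inr hσ0.le)).aestronglyMeasurable
    · rw [Real.norm_of_nonneg (h0 ζ)]; exact hpw ζ
  refine ⟨hI, (integral_mono hI hRi hpw).trans ?_⟩
  rw [integral_add (hmi.const_mul 8) ((hv.nsint hσ1).const_mul _), integral_const_mul, integral_const_mul, hfl]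
  change _ + _ * ns σ v ≤ _
  linarith

end KH

namespace KH
open SchwartzMap Function Filter
open scoped FourierTransform LineDeriv ContDiff ComplexConjugate Topology

/-- the full weight -/
def jw (ζ : Z n) : ℝ := 1 + ‖ζ‖ ^ 2

lemma jw_eq (ζ : Z n) : jw ζ = 1 + (sqJ Ts ζ + sqJ XVs ζ) := by rw [jw, norm_Z, sqJ_Ts, sqJ_XVs]
lemma jw_ge (ζ : Z n) : 1 ≤ jw ζ := by unfold jw; nlinarith [sq_nonneg ‖ζ‖]
lemma jw_pos (ζ : Z n) : 0 < jw ζ := by linarith [jw_ge ζ]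
lemma jw_cont : Continuous (jw (n := n)) := by unfold jw; fun_prop
lemma jw_le (ζ : Z n) : jw ζ ≤ Sw XVs 1 ζ * Sw Ts 1 ζ := by
  rw [jw_eq, Sw, Sw]; nlinarith [mul_nonneg (sqJ_nonneg Ts ζ) (sqJ_nonneg XVs ζ)]
lemma Sw_le_jw (ζ : Z n) : Sw XVs 1 ζ ≤ jw ζ := by
  rw [jw_eq, Sw]; nlinarith [sqJ_nonneg Ts ζ]
lemma Sw_le1 (J : Finset (Ix n)) {κ : ℝ} (h0 : 0 ≤ κ) (h1 : κ ≤ 1) (ζ : Z n) : Sw J κ ζ ≤ Sw J 1 ζ := by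
  have : κ ^ 2 ≤ 1 := by nlinarith
  rw [Sw, Sw]; nlinarith [sqJ_nonneg J ζ]
lemma Sw_ge1 (J : Finset (Ix n)) {κ : ℝ} (h0 : 0 ≤ κ) (h1 : κ ≤ 1) (ζ : Z n) : κ ^ 2 * Sw J 1 ζ ≤ Sw J κ ζ := by
  have : κ ^ 2 ≤ 1 := by nlinarith
  rw [Sw, Sw]; nlinarith [sqJ_nonneg J ζ]

lemma Wt_cont (k K m : ℕ) (ϑ κ : ℝ) : Continuous (Wt (n := n) k K m ϑ κ) := by
  unfold Wt
  exact (((Sw_cont _ _).pow k).mul (((Sw_cont _ _).pow K).inv₀ fun ζ => (pow_pos (Sw_pos _ _ _) _).ne')).mul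
    (((Sw_cont _ _).pow m).inv₀ fun ζ => (pow_pos (Sw_pos _ _ _) _).ne')

/-- `Wt` kills polynomial growth -/
lemma Wt_bd (k N : ℕ) {ϑ κ : ℝ} (hϑ : 0 < ϑ) (hϑ1 : ϑ ≤ 1) (hκ : 0 < κ) (hκ1 : κ ≤ 1) :
    ∃ C, 0 ≤ C ∧ ∀ ζ : Z n, Wt k (k + N + 1) N ϑ κ ζ * Sw XVs 1 ζ * jw ζ ^ N ≤ C := by
  refine ⟨((κ ^ 2) ^ (k + N + 1))⁻¹ * ((ϑ ^ 2) ^ N)⁻¹, by positivity, fun ζ => ?_⟩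
  have p1 := Sw_pos XVs 1 ζ
  have p2 := Sw_pos Ts 1 ζ
  have p3 := Sw_pos XVs ϑ ζ
  have p4 := Sw_pos XVs κ ζ
  have p5 := Sw_pos Ts ϑ ζ
  have p6 := jw_pos ζ
  calc Wt k (k + N + 1) N ϑ κ ζ * Sw XVs 1 ζ * jw ζ ^ N
      ≤ (Sw XVs 1 ζ ^ k * ((κ ^ 2 * Sw XVs 1 ζ) ^ (k + N + 1))⁻¹ * ((ϑ ^ 2 * Sw Ts 1 ζ) ^ N)⁻¹) * Sw XVs 1 ζ *
        (Sw XVs 1 ζ * Sw Ts 1 ζ) ^ N := by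
        unfold Wt
        gcongr
        · exact Sw_le1 _ hϑ.le hϑ1 _
        · exact Sw_ge1 _ hκ.le hκ1 _
        · exact Sw_ge1 _ hϑ.le hϑ1 _
        · exact jw_le ζ
    _ = _ := by
      field_simp
      ring

lemma ip_real (c : Z n → ℝ) (f g : Z n → ℂ) :
    ip (fun ζ => (c ζ : ℂ) * f ζ) g = ip f (fun ζ => (c ζ : ℂ) * g ζ) := by
  unfold ip; congr 1; funext ζ
  rw [map_mul, Complex.conj_ofReal]; ring

lemma pow_der {g : ℝ → ℝ} {g' s : ℝ} (h : HasDerivAt g g' s) (h0 : 0 < g s) (k : ℕ) :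
    HasDerivAt (fun s => g s ^ k) (k * (g' / g s) * g s ^ k) s := by
  have := h.pow k
  refine this.congr_deriv ?_
  cases k with
  | zero => simp
  | succ k => simp only [Nat.add_sub_cancel, pow_succ]; field_simp

lemma pow_inv_der {g : ℝ → ℝ} {g' s : ℝ} (h : HasDerivAt g g' s) (h0 : 0 < g s) (k : ℕ) :
    HasDerivAt (fun s => (g s ^ k)⁻¹) (-(k * (g' / g s)) * (g s ^ k)⁻¹) s := by
  have := (pow_der h h0 k).fun_inv (pow_pos h0 k).ne'
  refine this.congr_deriv ?_
  have : g s ^ k ≠ 0 := (pow_pos h0 k).ne'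
  field_simp

/-- logarithmic derivative of the weight along the flow -/
def rho (k K : ℕ) (ϑ κ : ℝ) (ζ : Z n) : ℝ :=
  k * (ϑ ^ 2 * (2 * rX ζ) / Sw XVs ϑ ζ) - K * (κ ^ 2 * (2 * rX ζ) / Sw XVs κ ζ)

lemma rho_cont (k K : ℕ) (ϑ κ : ℝ) : Continuous (rho (n := n) k K ϑ κ) := by
  have h : ∀ κ : ℝ, Continuous fun ζ : Z n => κ ^ 2 * (2 * rX ζ) / Sw XVs κ ζ := fun κ =>
    (continuous_const.mul (continuous_const.mul rX_cont)).div (Sw_cont _ _) fun ζ => (Sw_pos _ _ _).ne'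
  unfold rho
  exact (continuous_const.mul (h _)).sub (continuous_const.mul (h _))

lemma rho_bd (k K : ℕ) (ϑ κ : ℝ) (ζ : Z n) : |rho k K ϑ κ ζ| ≤ k + K := by
  have h : ∀ κ : ℝ, |κ ^ 2 * (2 * rX ζ) / Sw XVs κ ζ| ≤ 1 := fun κ => by
    have e1 : |rX ζ| ≤ (pX ζ + qV ζ) / 2 := by
      have := pX_nonneg ζ
      have := qV_nonneg ζ
      apply abs_le_of_sq_le_sq _ (by positivity)
      nlinarith [rX_sq ζ, sq_nonneg (pX ζ - qV ζ)]
    rw [abs_div, abs_of_pos (Sw_pos _ _ _), div_le_one (Sw_pos _ _ _), abs_mul, abs_mul, abs_of_nonneg (sq_nonneg κ), Sw, sqXV]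
    norm_num
    nlinarith [sq_nonneg κ]
  unfold rho
  refine (abs_sub _ _).trans ?_
  rw [abs_mul, abs_mul, Nat.abs_cast, Nat.abs_cast]
  have h1 := mul_le_mul_of_nonneg_left (h ϑ) (Nat.cast_nonneg (α := ℝ) k)
  have h2 := mul_le_mul_of_nonneg_left (h κ) (Nat.cast_nonneg (α := ℝ) K)
  linarith

lemma Wt_der (k K m : ℕ) (ϑ κ : ℝ) (ζ : Z n) :
    HasDerivAt (fun s => Wt k K m ϑ κ (Ph s ζ)) (rho k K ϑ κ ζ * Wt k K m ϑ κ ζ) 0 := by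
  have hS : ∀ κ : ℝ, HasDerivAt (fun s => Sw XVs κ (Ph s ζ)) (κ ^ 2 * (2 * rX ζ)) 0 := fun κ => by
    unfold Sw
    simp_rw [sqXV, pX_Ph, qV_Ph]
    have h1 := (((hasDerivAt_id (0:ℝ)).const_mul 2).mul_const (rX ζ)).const_add (qV ζ)
    have h2 := ((hasDerivAt_id (0:ℝ)).pow 2).mul_const (pX ζ)
    refine ((((h1.add h2).const_add (pX ζ)).const_mul (κ ^ 2)).const_add 1).congr_deriv ?_
    simp
  have hT : ∀ s, Sw Ts ϑ (Ph s ζ) = Sw Ts ϑ ζ := fun s => by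
    rw [Sw, Sw, sqJ_Ts, sqJ_Ts, tC, tC]
    have := Ph_it s ζ
    rw [this]
  unfold Wt
  simp_rw [hT]
  have h := ((pow_der (hS ϑ) (Sw_pos _ _ _) k).mul (pow_inv_der (hS κ) (Sw_pos _ _ _) K)).mul_const ((Sw Ts ϑ ζ ^ m)⁻¹)
  refine h.congr_deriv ?_
  simp only [Ph_zero, rho]; ring

lemma flow_der {g : Z n → ℂ} {ζ : Z n} (h : DifferentiableAt ℝ g ζ) :
    HasDerivAt (fun s => g (Ph s ζ)) (fderiv ℝ g ζ (Nl ζ)) 0 := by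
  have h2 : HasDerivAt (fun s : ℝ => Ph s ζ) (Nl ζ) 0 := by
    have := ((hasDerivAt_id (0:ℝ)).smul_const (Nl ζ)).const_add ζ
    simpa [Ph_apply] using this
  have h' : HasFDerivAt g (fderiv ℝ g ζ) (Ph 0 ζ) := by rw [Ph_zero]; exact h.hasFDerivAt
  exact h'.comp_hasDerivAt 0 h2

lemma Xop_Wt (k K m : ℕ) (ϑ κ : ℝ) (θ : Sch n) (ζ : Z n) :
    Xop (mu (fun ζ => (Wt k K m ϑ κ ζ : ℂ)) θ) ζ =
      (Wt k K m ϑ κ ζ : ℂ) * Xop θ ζ + ((rho k K ϑ κ ζ : ℂ) * (Wt k K m ϑ κ ζ : ℂ)) * θ ζ := by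
  rw [Xop_apply, Xop_apply, mu_apply (Wt_tg _ _ _ _ _)]
  have h1 := flow_der (g := mu (fun ζ => (Wt k K m ϑ κ ζ : ℂ)) θ) (ζ := ζ) (SchwartzMap.differentiable _ _)
  have h2 := (HasDerivAt.ofReal_comp (Wt_der k K m ϑ κ ζ)).mul (flow_der (g := θ) (ζ := ζ) (θ.differentiable _))
  simp_rw [mu_apply (Wt_tg k K m ϑ κ)] at h1
  rw [h1.unique h2]
  simp only [Ph_zero]
  push_cast; ring

/-- the equation on the Fourier side -/
structure Eqn (σ : ℝ) (w : E n → ℝ) (a : Z n → ℝ) (N : ℕ) (H G : Z n → ℂ) : Prop where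
  hH : L2f (fun ζ => (((jw ζ ^ N)⁻¹ : ℝ) : ℂ) * H ζ)
  hG : ∀ k : ℕ, L2f (fun ζ => ((jw ζ ^ k : ℝ) : ℂ) * G ζ)
  eq : ∀ θ : Sch n, ip H (Xop θ) + ip (fun ζ => (Fz σ w ζ : ℂ) * H ζ) (Aop (fun z => (a z : ℂ)) θ) = ip G θ

lemma L2f.weight {f g : Z n → ℂ} {c : Z n → ℝ} (hf : L2f f) (hc : Continuous c) {C : ℝ} (hC : ∀ ζ, |c ζ| ≤ C)
    (h : ∀ ζ, g ζ = (c ζ : ℂ) * f ζ) : L2f g := by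
  have : g = fun ζ => (c ζ : ℂ) * f ζ := funext h
  rw [this]
  refine MemLp.of_le_mul (c := C) hf ((Complex.continuous_ofReal.comp hc).aestronglyMeasurable.mul hf.1)
    (Eventually.of_forall fun ζ => ?_)
  rw [norm_mul, Complex.norm_real, Real.norm_eq_abs]
  exact mul_le_mul_of_nonneg_right (hC ζ) (norm_nonneg _)

section
variable {σ : ℝ} {w : E n → ℝ} {a : Z n → ℝ} {N : ℕ} {H G : Z n → ℂ}

lemma Eqn.hv (he : Eqn σ w a N H G) (k : ℕ) {ϑ κ : ℝ} (hϑ : 0 < ϑ) (hϑ1 : ϑ ≤ 1) (hκ : 0 < κ) (hκ1 : κ ≤ 1) :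
    D2 (fun ζ => (Wt k (k + N + 1) N ϑ κ ζ : ℂ) * H ζ) ∧
    L2f (fun ζ => (sqJ XVs ζ : ℂ) * ((Wt k (k + N + 1) N ϑ κ ζ : ℂ) * H ζ)) := by
  obtain ⟨C, hC, hb⟩ := Wt_bd (n := n) k N hϑ hϑ1 hκ hκ1
  have key : ∀ c : Z n → ℝ, Continuous c → (∀ ζ, 0 ≤ c ζ ∧ c ζ ≤ Sw XVs 1 ζ) →
      L2f (fun ζ => (c ζ : ℂ) * ((Wt k (k + N + 1) N ϑ κ ζ : ℂ) * H ζ)) := by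
    intro c hc hc1
    refine he.hH.weight (c := fun ζ => c ζ * Wt k (k + N + 1) N ϑ κ ζ * jw ζ ^ N) (C := C)
      ((hc.mul (Wt_cont _ _ _ _ _)).mul (jw_cont.pow N)) (fun ζ => ?_) (fun ζ => ?_)
    · have p1 := Wt_pos k (k + N + 1) N ϑ κ ζ
      have p2 := jw_pos ζ
      rw [abs_of_nonneg (mul_nonneg (mul_nonneg (hc1 ζ).1 p1.le) (by positivity))]
      refine le_trans ?_ (hb ζ)
      refine mul_le_mul_of_nonneg_right ?_ (by positivity)
      rw [mul_comm]
      exact mul_le_mul_of_nonneg_left (hc1 ζ).2 p1.le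
    · have p2 : (jw ζ : ℂ) ≠ 0 := by exact_mod_cast (jw_pos ζ).ne'
      push_cast; field_simp
  refine ⟨⟨?_, ?_⟩, ?_⟩
  · have := key (fun _ => 1) continuous_const fun ζ => ⟨zero_le_one, Sw_ge _ _ _⟩
    simpa using this
  · refine key _ (sqJ_cont _) fun ζ => ⟨sqJ_nonneg _ _, ?_⟩
    rw [Sw, sqV, sqXV]; linarith [pX_nonneg ζ]
  · refine key _ (sqJ_cont _) fun ζ => ⟨sqJ_nonneg _ _, ?_⟩
    rw [Sw]; linarith [sqJ_nonneg XVs ζ]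

lemma Wt_le_jw (k K m : ℕ) {ϑ : ℝ} (κ : ℝ) (hϑ : 0 < ϑ) (hϑ1 : ϑ ≤ 1) (ζ : Z n) : Wt k K m ϑ κ ζ ≤ jw ζ ^ k := by
  have p3 := Sw_pos XVs ϑ ζ
  have h1 : Sw XVs ϑ ζ ^ k ≤ jw ζ ^ k := pow_le_pow_left₀ p3.le ((Sw_le1 _ hϑ.le hϑ1 _).trans (Sw_le_jw ζ)) k
  have h2 : (Sw XVs κ ζ ^ K)⁻¹ ≤ 1 := inv_le_one_of_one_le₀ (one_le_pow₀ (Sw_ge _ _ _))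
  have h3 : (Sw Ts ϑ ζ ^ m)⁻¹ ≤ 1 := inv_le_one_of_one_le₀ (one_le_pow₀ (Sw_ge _ _ _))
  have p4 := Sw_pos XVs κ ζ
  have p5 := Sw_pos Ts ϑ ζ
  have p6 := jw_pos ζ
  unfold Wt
  calc _ ≤ jw ζ ^ k * 1 * 1 := by gcongr
    _ = _ := by ring

lemma Eqn.hg (he : Eqn σ w a N H G) (k K m : ℕ) {ϑ : ℝ} (κ : ℝ) (hϑ : 0 < ϑ) (hϑ1 : ϑ ≤ 1) :
    L2f (fun ζ => (Wt k K m ϑ κ ζ : ℂ) * G ζ) ∧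
    nq (fun ζ => (Wt k K m ϑ κ ζ : ℂ) * G ζ) ≤ nq (fun ζ => ((jw ζ ^ k : ℝ) : ℂ) * G ζ) := by
  have hb : ∀ ζ : Z n, ‖(Wt k K m ϑ κ ζ : ℂ) * G ζ‖ ≤ 1 * ‖((jw ζ ^ k : ℝ) : ℂ) * G ζ‖ := fun ζ => by
    rw [one_mul, norm_mul, norm_mul, Complex.norm_real, Complex.norm_real, Real.norm_of_nonneg (Wt_pos _ _ _ _ _ _).le,
      Real.norm_of_nonneg (by have := jw_pos ζ; positivity)]
    exact mul_le_mul_of_nonneg_right (Wt_le_jw k K m κ hϑ hϑ1 ζ) (norm_nonneg _)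
  have hG0 : L2f G := by simpa using he.hG 0
  refine ⟨MemLp.of_le_mul (c := 1) (he.hG k) ?_ (Eventually.of_forall hb), ?_⟩
  · exact (Complex.continuous_ofReal.comp (Wt_cont _ _ _ _ _)).aestronglyMeasurable.mul hG0.1
  · simpa using nq_le (he.hG k) zero_le_one hb

/-- the weighted equation -/
lemma Eqn.weq (he : Eqn σ w a N H G) (hσ0 : 0 < σ) (hσ1 : σ < 1) (hw : Wc w) (k : ℕ) {ϑ κ : ℝ}
    (hϑ : 0 < ϑ) (hϑ1 : ϑ ≤ 1) (hκ : 0 < κ) (hκ1 : κ ≤ 1) {T : Sch n →L[ℂ] Sch n}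
    (hT : ∀ θ, mu (fun ζ => (((Wt k (k + N + 1) N ϑ κ ζ)⁻¹ : ℝ) : ℂ)) (Aop (fun z => (a z : ℂ))
      (mu (fun ζ => (Wt k (k + N + 1) N ϑ κ ζ : ℂ)) θ)) = Aop (fun z => (a z : ℂ)) θ + (ϑ : ℂ) • T θ)
    (θ : Sch n) :
    ip (fun ζ => (Wt k (k + N + 1) N ϑ κ ζ : ℂ) * H ζ) (Xop θ) =
      ip (fun ζ => (Wt k (k + N + 1) N ϑ κ ζ : ℂ) * G ζ - (rho k (k + N + 1) ϑ κ ζ : ℂ) * ((Wt k (k + N + 1) N ϑ κ ζ : ℂ) * H ζ)) θ -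
      (ip (fun ζ => (Fz σ w ζ : ℂ) * ((Wt k (k + N + 1) N ϑ κ ζ : ℂ) * H ζ)) (Aop (fun z => (a z : ℂ)) θ) +
      (ϑ : ℂ) * ip (fun ζ => (Fz σ w ζ : ℂ) * ((Wt k (k + N + 1) N ϑ κ ζ : ℂ) * H ζ)) (T θ)) := by
  set W := Wt (n := n) k (k + N + 1) N ϑ κ with hW
  have hv := (he.hv k hϑ hϑ1 hκ hκ1).1
  have hρv : L2f (fun ζ => (rho k (k + N + 1) ϑ κ ζ : ℂ) * ((W ζ : ℂ) * H ζ)) :=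
    hv.1.weight (rho_cont k (k + N + 1) ϑ κ) (rho_bd k (k + N + 1) ϑ κ) fun ζ => rfl
  have hg := (he.hg k (k + N + 1) N κ hϑ hϑ1).1
  have e0 := he.eq (mu (fun ζ => (W ζ : ℂ)) θ)
  have e1 : ip H (Xop (mu (fun ζ => (W ζ : ℂ)) θ)) = ip (fun ζ => (W ζ : ℂ) * H ζ) (Xop θ) +
      ip (fun ζ => (rho k (k + N + 1) ϑ κ ζ : ℂ) * ((W ζ : ℂ) * H ζ)) θ := by
    unfold ip
    rw [← integral_add (hv.1.ip_int (sL2 _)) (hρv.ip_int (sL2 θ))]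
    congr 1; funext ζ
    rw [Xop_Wt]
    simp only [map_mul, Complex.conj_ofReal]; ring
  have e2 : ip (fun ζ => (Fz σ w ζ : ℂ) * H ζ) (Aop (fun z => (a z : ℂ)) (mu (fun ζ => (W ζ : ℂ)) θ)) =
      ip (fun ζ => (Fz σ w ζ : ℂ) * ((W ζ : ℂ) * H ζ)) (Aop (fun z => (a z : ℂ)) θ) +
      (ϑ : ℂ) * ip (fun ζ => (Fz σ w ζ : ℂ) * ((W ζ : ℂ) * H ζ)) (T θ) := by
    have hF := hv.F hσ0 hσ1 hw
    rw [← ip_const_right, ← ip_add_right hF (sL2 _) ((sL2 (T θ)).const_mul _)]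
    unfold ip
    congr 1; funext ζ
    have := congrArg (fun φ : Sch n => φ ζ) (hT θ)
    simp only [_root_.add_apply, _root_.smul_apply, smul_eq_mul] at this
    beta_reduce
    rw [← this, mu_apply (Wt_inv_tg _ _ _ _ _)]
    have p2 : (W ζ : ℂ) ≠ 0 := by exact_mod_cast (Wt_pos k (k + N + 1) N ϑ κ ζ).ne'
    simp only [map_mul, Complex.conj_ofReal]
    push_cast
    have p3 : (W ζ : ℂ) * (Wt k (k + N + 1) N ϑ κ ζ : ℂ)⁻¹ = 1 := mul_inv_cancel₀ p2
    linear_combination (-(Fz σ w ζ : ℂ) * conj (H ζ) * Aop (fun z => (a z : ℂ)) (mu (fun ζ => (W ζ : ℂ)) θ) ζ) * p3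
  have e3 : ip G (mu (fun ζ => (W ζ : ℂ)) θ) = ip (fun ζ => (W ζ : ℂ) * G ζ) θ := by
    rw [ip_real]
    congr 1; funext ζ
    rw [mu_apply (Wt_tg _ _ _ _ _)]
  rw [e1, e2, e3] at e0
  rw [ip_sub_left hg hρv (sL2 θ), ← e0]
  ring

end
end KH

namespace KH
open SchwartzMap Function Filter
open scoped FourierTransform LineDeriv ContDiff ComplexConjugate Topology

/-- functions defining functionals on the Schwartz space -/
def Tp (f : Z n → ℂ) : Prop := ∀ θ : Sch n, Integrable (fun z => conj (f z) * θ z)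

lemma L2f.tp {f : Z n → ℂ} (hf : L2f f) : Tp f := fun θ => hf.ip_int (sL2 θ)

/-- the functional -/
def ipL {f : Z n → ℂ} (hf : Tp f) : Sch n →ₗ[ℂ] ℂ where
  toFun θ := ip f θ
  map_add' θ φ := by
    rw [ip, ip, ip, ← integral_add (hf θ) (hf φ)]
    congr 1; funext z; rw [_root_.add_apply]; ring
  map_smul' c θ := by
    rw [ip, ip, RingHom.id_apply, smul_eq_mul, ← integral_const_mul]
    congr 1; funext z; rw [_root_.smul_apply, smul_eq_mul]; ring

@[simp] lemma ipL_apply {f : Z n → ℂ} (hf : Tp f) (θ : Sch n) : ipL hf θ = ip f θ := rfl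

section
variable {σ : ℝ} {w : E n → ℝ} {a : Z n → ℝ} {N : ℕ} {H G : Z n → ℂ}

lemma skew {v f : Z n → ℂ} (hv : L2f v) (hf : L2f f) (h : ∀ θ : Sch n, ip v (Xop θ) = ip f θ) :
    (ip f v).re = 0 := by
  have := flow hv hf h (m := fun _ => 1) (m' := fun _ => 0) (B := fun _ => 0) continuous_const (K := 1)
    (fun ζ => by simp) (fun ζ s => hasDerivAt_const _ _) (fun ζ s _ => by simp) continuous_const (by simp)
  simp only [zero_mul, integral_zero, Complex.ofReal_one, one_mul] at this
  change 0 = 2 * (ip f v).re at this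
  linarith

set_option maxHeartbeats 1000000 in
lemma Eqn.unif (he : Eqn σ w a N H G) (hn : 1 ≤ n) (hσ0 : 0 < σ) (hσ1 : σ < 1) (hw : Wc w)
    (hb : CB (fun z => (a z : ℂ))) {a₀ : ℝ} (ha₀ : 0 < a₀) (h : ∀ z, a₀ ≤ a z) (k : ℕ) :
    ∃ ϑ, 0 < ϑ ∧ ϑ ≤ 1 ∧ ∃ C0, 0 < C0 ∧ ∀ κ, 0 < κ → κ ≤ ϑ →
      Integrable (fun ζ => (pX ζ ^ (σ / 4) + qV ζ ^ σ) * ‖(Wt k (k + N + 1) N ϑ κ ζ : ℂ) * H ζ‖ ^ 2) ∧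
      ∫ ζ, (pX ζ ^ (σ / 4) + qV ζ ^ σ) * ‖(Wt k (k + N + 1) N ϑ κ ζ : ℂ) * H ζ‖ ^ 2 ≤
        C0 * (nq (fun ζ => (Wt k (k + N + 1) N ϑ κ ζ : ℂ) * H ζ) + nq (fun ζ => (Wt k (k + N + 1) N ϑ κ ζ : ℂ) * G ζ)) := by
  obtain ⟨c, C, D, hc, hC, hD, en1⟩ := energy1 hn hσ0 hσ1 hw hb ha₀ h
  obtain ⟨Df, hDf, fF⟩ := F_form (n := n) hn hσ0 hσ1 hw
  obtain ⟨A, hA, hAn⟩ := ns_Aop hσ1 hb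
  obtain ⟨A', hA', hAr⟩ := nr_Aop hb
  obtain ⟨CE, hCE, en2⟩ := energy2 hn hσ0 hσ1 (δ := σ / 4) (by linarith) (by linarith) (by linarith)
  obtain ⟨T', hT', eT⟩ := CJ_Wt (n := n) (ι := {x : ℝ × ℝ // 0 < x.2 ∧ x.2 ≤ x.1 ∧ x.1 ≤ 1})
    (ϑ := fun i => i.1.1) (s := fun i => i.1.2) (fun i => ⟨i.2.1.trans_le i.2.2.1, i.2.2.2⟩)
    (fun i => ⟨i.2.1, i.2.2.1⟩) k (k + N + 1) N _ (Fam.base _ hb)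
  obtain ⟨CT, hCT, bT⟩ := hT'.bound hσ1
  set X := D * Real.sqrt CT with hX
  have hX0 : 0 ≤ X := mul_nonneg hD (Real.sqrt_nonneg _)
  set ϑ := min 1 (c / (2 * (X + 1))) with hϑdef
  have hϑ0 : 0 < ϑ := lt_min one_pos (by positivity)
  have hϑ1 : ϑ ≤ 1 := min_le_left _ _
  have hϑX : ϑ * X ≤ c / 2 := by
    have h1 : ϑ ≤ c / (2 * (X + 1)) := min_le_right _ _
    calc ϑ * X ≤ c / (2 * (X + 1)) * (X + 1) := by gcongr; linarith
      _ = c / 2 := by field_simp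
  set Kc : ℝ := k + (k + N + 1 : ℕ) with hKc
  have hKc0 : 0 ≤ Kc := by positivity
  set C1 := 2 * (C + Kc + 1) / c with hC1
  have hC10 : 0 ≤ C1 := by positivity
  set B := Df * (Real.sqrt A + Real.sqrt CT) with hBdef
  have hB0 : 0 ≤ B := mul_nonneg hDf (add_nonneg (Real.sqrt_nonneg _) (Real.sqrt_nonneg _))
  refine ⟨ϑ, hϑ0, hϑ1, 16 * (1 + Kc) + (32 * B + CE) * C1 + 1, by positivity, fun κ hκ hκϑ => ?_⟩
  have hκ1 := hκϑ.trans hϑ1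
  set i : {x : ℝ × ℝ // 0 < x.2 ∧ x.2 ≤ x.1 ∧ x.1 ≤ 1} := ⟨(ϑ, κ), hκ, hκϑ, hϑ1⟩ with hi
  have weq := he.weq hσ0 hσ1 hw k hϑ0 hϑ1 hκ hκ1 (T := T' i) (fun θ => eT i θ)
  obtain ⟨hv, hvX⟩ := he.hv k hϑ0 hϑ1 hκ hκ1
  have hg := (he.hg k (k + N + 1) N κ hϑ0 hϑ1).1
  set v := fun ζ => (Wt k (k + N + 1) N ϑ κ ζ : ℂ) * H ζ with hvdef
  set g := fun ζ => (Wt k (k + N + 1) N ϑ κ ζ : ℂ) * G ζ with hgdef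
  have hρv : L2f (fun ζ => (rho k (k + N + 1) ϑ κ ζ : ℂ) * v ζ) :=
    hv.1.weight (rho_cont k (k + N + 1) ϑ κ) (rho_bd k (k + N + 1) ϑ κ) fun ζ => rfl
  set q := fun ζ => g ζ - (rho k (k + N + 1) ϑ κ ζ : ℂ) * v ζ with hqdef
  have hq : L2f q := hg.sub hρv
  have hF := hv.F hσ0 hσ1 hw
  have weq' : ∀ θ : Sch n, ip v (Xop θ) = ip q θ - (ip (fun ζ => (Fz σ w ζ : ℂ) * v ζ) (Aop (fun z => (a z : ℂ)) θ) +
        (ϑ : ℂ) * ip (fun ζ => (Fz σ w ζ : ℂ) * v ζ) (T' i θ)) := weq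
  have nq1 : nr q ≤ nr g + Kc * nr v := by
    have e1 : q = g + fun ζ => -((rho k (k + N + 1) ϑ κ ζ : ℂ) * v ζ) := by funext ζ; simp [hqdef, sub_eq_add_neg]
    rw [e1]
    refine (nr_add_le hg hρv.neg).trans (add_le_add le_rfl ?_)
    refine nr_le hv.1 hKc0 fun ζ => ?_
    rw [Pi.neg_apply, norm_neg, norm_mul, Complex.norm_real, Real.norm_eq_abs]
    exact mul_le_mul_of_nonneg_right (rho_bd _ _ _ _ _) (norm_nonneg _)
  have p1 := nr_nonneg v
  have p2 := nr_nonneg g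
  have p3 := nr_nonneg q
  have p4 := ns_nonneg σ v
  have s1 := nr_sq v
  have s2 := nr_sq g
  set FV := nr (fun ζ => (Fz σ w ζ : ℂ) * v ζ) with hFV
  have pF : 0 ≤ FV := nr_nonneg _
  obtain ⟨f, hf, -, ef⟩ := riesz ((ipL hv.1.tp).comp Xop.toLinearMap) (C := nr q + FV * (A' + CT)) (by positivity) (fun θ => by
    change ‖ip v (Xop θ)‖ ≤ _
    rw [weq']
    have t1 := ip_le hq (sL2 θ)
    have t2 := ip_le hF (sL2 (Aop (fun z => (a z : ℂ)) θ))
    have t3 := ip_le hF (sL2 (T' i θ))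
    have t4 := mul_le_mul_of_nonneg_left (hAr θ) pF
    have t5 := mul_le_mul_of_nonneg_left (bT i θ).1 pF
    calc _ ≤ ‖ip q θ‖ + (‖ip (fun ζ => (Fz σ w ζ : ℂ) * v ζ) (Aop (fun z => (a z : ℂ)) θ)‖ +
          1 * ‖ip (fun ζ => (Fz σ w ζ : ℂ) * v ζ) (T' i θ)‖) := by
            refine (norm_sub_le _ _).trans (add_le_add le_rfl ((norm_add_le _ _).trans (add_le_add le_rfl ?_)))
            rw [norm_mul, Complex.norm_real, Real.norm_of_nonneg hϑ0.le]
            exact mul_le_mul_of_nonneg_right hϑ1 (norm_nonneg _)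
      _ ≤ _ := by linarith)
  have ef' : ∀ θ : Sch n, ip v (Xop θ) = ip f θ := ef
  have hns : ns σ v ≤ C1 * (nq v + nq g) := by
    have := en1 (T' i) CT hCT (fun θ => (bT i θ).2) ϑ hϑ0.le v f q hv hf hq (fun θ => by rw [← ef', weq']) (skew hv.1 hf ef').ge
    rw [← hX] at this
    have t1 := mul_le_mul_of_nonneg_right nq1 p1
    have t2 := mul_le_mul_of_nonneg_right hϑX p4
    rw [hC1, div_mul_eq_mul_div, le_div_iff₀ hc]
    nlinarith [mul_nonneg hC (sq_nonneg (nr g)), mul_nonneg hKc0 (sq_nonneg (nr g)), sq_nonneg (nr g - nr v), sq_nonneg (nr g), sq_nonneg (nr v)]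
  have bd := en2 v f (nr q) (B * Real.sqrt (ns σ v)) hv hvX hf p3 (mul_nonneg hB0 (Real.sqrt_nonneg _)) ef' (fun θ => by
    rw [← ef', weq']
    have t1 := ip_le hq (sL2 θ)
    have t2 := fF v _ hv (sD2 (Aop (fun z => (a z : ℂ)) θ))
    have t3 := fF v _ hv (sD2 (T' i θ))
    have sv := mul_nonneg hDf (Real.sqrt_nonneg (ns σ v))
    have t4 : Real.sqrt (ns σ (Aop (fun z => (a z : ℂ)) θ)) ≤ Real.sqrt A * Real.sqrt (ns σ θ) := by
      rw [← Real.sqrt_mul hA]; exact Real.sqrt_le_sqrt (hAn θ)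
    have t5 : Real.sqrt (ns σ (T' i θ)) ≤ Real.sqrt CT * Real.sqrt (ns σ θ) := by
      rw [← Real.sqrt_mul hCT]; exact Real.sqrt_le_sqrt (bT i θ).2
    have t6 := mul_le_mul_of_nonneg_left t4 sv
    have t7 := mul_le_mul_of_nonneg_left t5 sv
    calc _ ≤ ‖ip q θ‖ + (‖ip (fun ζ => (Fz σ w ζ : ℂ) * v ζ) (Aop (fun z => (a z : ℂ)) θ)‖ +
          1 * ‖ip (fun ζ => (Fz σ w ζ : ℂ) * v ζ) (T' i θ)‖) := by
            refine (norm_sub_le _ _).trans (add_le_add le_rfl ((norm_add_le _ _).trans (add_le_add le_rfl ?_)))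
            rw [norm_mul, Complex.norm_real, Real.norm_of_nonneg hϑ0.le]
            exact mul_le_mul_of_nonneg_right hϑ1 (norm_nonneg _)
      _ ≤ nr q * nr θ + (Df * √(ns σ v) * (√A * √(ns σ θ)) + 1 * (Df * √(ns σ v) * (√CT * √(ns σ θ)))) := by linarith
      _ = _ := by rw [hBdef]; ring)
  refine ⟨bd.1, bd.2.trans ?_⟩
  have e1 : 2 * (B * √(ns σ v)) * √(ns σ v) = 2 * B * ns σ v := by
    rw [show 2 * (B * √(ns σ v)) * √(ns σ v) = 2 * B * (√(ns σ v) * √(ns σ v)) by ring, Real.mul_self_sqrt p4]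
  rw [e1]
  have t1 := mul_le_mul_of_nonneg_right nq1 p1
  have t2 := mul_le_mul_of_nonneg_left hns (by positivity : 0 ≤ 32 * B + CE)
  nlinarith [mul_nonneg hKc0 (sq_nonneg (nr g)), sq_nonneg (nr g - nr v), sq_nonneg (nr g), sq_nonneg (nr v)]

lemma memL2_lim {f : ℕ → Z n → ℂ} {g : Z n → ℂ} {M : ℝ} (hf : ∀ j, L2f (f j)) (hM : ∀ j, nq (f j) ≤ M)
    (hl : ∀ ζ, Tendsto (fun j => f j ζ) atTop (𝓝 (g ζ))) : L2f g := by
  have hm : AEStronglyMeasurable g volume := aestronglyMeasurable_of_tendsto_ae atTop (fun j => (hf j).1) (Eventually.of_forall hl)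
  refine ⟨hm, ?_⟩
  have h1 := MeasureTheory.Lp.eLpNorm_lim_le_liminf_eLpNorm (p := 2) (μ := (volume : Measure (Z n))) (fun j => (hf j).1) g (Eventually.of_forall hl)
  refine lt_of_le_of_lt h1 (lt_of_le_of_lt (b := ENNReal.ofReal (Real.sqrt M)) ?_ ENNReal.ofReal_lt_top)
  refine liminf_le_of_le (by isBoundedDefault) fun b hb => ?_
  obtain ⟨j, hj⟩ := hb.exists
  refine hj.trans ?_
  have h2 : eLpNorm (f j) 2 volume = ENNReal.ofReal (nr (f j)) := by
    rw [nr_toLp (hf j), Lp.norm_toLp, ENNReal.ofReal_toReal (hf j).2.ne]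
  rw [h2]
  exact ENNReal.ofReal_le_ofReal (Real.sqrt_le_sqrt (hM j))

lemma Wt_low (k K N : ℕ) {ϑ κ : ℝ} (hϑ : 0 < ϑ) (hϑ1 : ϑ ≤ 1) {R : ℝ} (ζ : Z n)
    (hR : pX ζ + qV ζ ≤ R) : Wt k K N ϑ κ ζ * jw ζ ^ N ≤ (1 + R) ^ (k + N) * ((ϑ ^ 2) ^ N)⁻¹ := by
  have p1 := Sw_pos XVs 1 ζ
  have p2 := Sw_pos Ts 1 ζ
  have p3 := Sw_pos XVs ϑ ζ
  have p4 := Sw_pos XVs κ ζ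
  have p5 := Sw_pos Ts ϑ ζ
  have p6 := jw_pos ζ
  have h2 : (Sw XVs κ ζ ^ K)⁻¹ ≤ 1 := inv_le_one_of_one_le₀ (one_le_pow₀ (Sw_ge _ _ _))
  have h3 : Sw XVs 1 ζ ≤ 1 + R := by rw [Sw, sqXV]; linarith
  calc Wt k K N ϑ κ ζ * jw ζ ^ N
      ≤ (Sw XVs 1 ζ ^ k * 1 * ((ϑ ^ 2 * Sw Ts 1 ζ) ^ N)⁻¹) * (Sw XVs 1 ζ * Sw Ts 1 ζ) ^ N := by
        unfold Wt
        gcongr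
        · exact Sw_le1 _ hϑ.le hϑ1 _
        · exact Sw_ge1 _ hϑ.le hϑ1 _
        · exact jw_le ζ
    _ = Sw XVs 1 ζ ^ (k + N) * ((ϑ ^ 2) ^ N)⁻¹ := by
      rw [mul_pow, mul_pow]; field_simp; ring
    _ ≤ _ := by gcongr

lemma Eqn.stage1 (he : Eqn σ w a N H G) (hn : 1 ≤ n) (hσ0 : 0 < σ) (hσ1 : σ < 1) (hw : Wc w)
    (hb : CB (fun z => (a z : ℂ))) {a₀ : ℝ} (ha₀ : 0 < a₀) (h : ∀ z, a₀ ≤ a z) (k : ℕ) :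
    L2f (fun ζ => ((Sw XVs 1 ζ ^ k * (Sw Ts 1 ζ ^ N)⁻¹ : ℝ) : ℂ) * H ζ) := by
  obtain ⟨ϑ, hϑ0, hϑ1, C0, hC0, hu⟩ := he.unif hn hσ0 hσ1 hw hb ha₀ h k
  set δ := σ / 4 with hδ
  have hδ0 : 0 < δ := by positivity
  set ρ := max 1 ((2 * C0) ^ (1 / δ)) with hρ
  have hρ1 : 1 ≤ ρ := le_max_left _ _
  have hρδ : 2 * C0 ≤ ρ ^ δ := by
    calc 2 * C0 = ((2 * C0) ^ (1 / δ)) ^ δ := by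
          rw [← Real.rpow_mul (by positivity), one_div, inv_mul_cancel₀ hδ0.ne', Real.rpow_one]
      _ ≤ ρ ^ δ := Real.rpow_le_rpow (by positivity) (le_max_right _ _) hδ0.le
  set Cl := (1 + 2 * ρ) ^ (k + N) * ((ϑ ^ 2) ^ N)⁻¹ with hCl
  set Mt := nq (fun ζ => ((jw ζ ^ k : ℝ) : ℂ) * G ζ) + 2 * Cl ^ 2 * nq (fun ζ => (((jw ζ ^ N)⁻¹ : ℝ) : ℂ) * H ζ) with hMt
  have bd : ∀ κ, 0 < κ → κ ≤ ϑ → nq (fun ζ => (Wt k (k + N + 1) N ϑ κ ζ : ℂ) * H ζ) ≤ Mt := by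
    intro κ hκ hκϑ
    obtain ⟨i1, i2⟩ := hu κ hκ hκϑ
    have hv := (he.hv k hϑ0 hϑ1 hκ (hκϑ.trans hϑ1)).1.1
    have hg := (he.hg k (k + N + 1) N κ hϑ0 hϑ1).2
    have i3 : 2 * C0 * nq (fun ζ => (Wt k (k + N + 1) N ϑ κ ζ : ℂ) * H ζ) ≤
        (∫ ζ, (pX ζ ^ δ + qV ζ ^ σ) * ‖(Wt k (k + N + 1) N ϑ κ ζ : ℂ) * H ζ‖ ^ 2) +
        2 * C0 * Cl ^ 2 * nq (fun ζ => (((jw ζ ^ N)⁻¹ : ℝ) : ℂ) * H ζ) := by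
      rw [nq, nq, ← integral_const_mul, ← integral_const_mul, ← integral_add i1 (he.hH.sq.const_mul _)]
      refine integral_mono (hv.sq.const_mul _) (i1.add (he.hH.sq.const_mul _)) fun ζ => ?_
      change 2 * C0 * ‖(Wt k (k + N + 1) N ϑ κ ζ : ℂ) * H ζ‖ ^ 2 ≤ (pX ζ ^ δ + qV ζ ^ σ) * ‖(Wt k (k + N + 1) N ϑ κ ζ : ℂ) * H ζ‖ ^ 2 +
        2 * C0 * Cl ^ 2 * ‖(((jw ζ ^ N)⁻¹ : ℝ) : ℂ) * H ζ‖ ^ 2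
      have hp := pX_nonneg ζ
      have hq := qV_nonneg ζ
      have hpδ := Real.rpow_nonneg hp δ
      have hqσ := Real.rpow_nonneg hq σ
      by_cases hR : pX ζ + qV ζ ≤ 2 * ρ
      · have t1 := Wt_low k (k + N + 1) N (κ := κ) hϑ0 hϑ1 ζ hR
        have t2 : ‖(Wt k (k + N + 1) N ϑ κ ζ : ℂ) * H ζ‖ ≤ Cl * ‖(((jw ζ ^ N)⁻¹ : ℝ) : ℂ) * H ζ‖ := by
          have pj : 0 < jw ζ ^ N := pow_pos (jw_pos ζ) N
          rw [norm_mul, norm_mul, Complex.norm_real, Complex.norm_real, Real.norm_of_nonneg (Wt_pos _ _ _ _ _ _).le,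
            Real.norm_of_nonneg (by positivity), ← mul_assoc]
          refine mul_le_mul_of_nonneg_right ?_ (norm_nonneg _)
          rw [← div_eq_mul_inv, le_div_iff₀ pj]
          exact t1
        have t3 := pow_le_pow_left₀ (norm_nonneg _) t2 2
        rw [mul_pow] at t3
        have t4 : 0 ≤ (pX ζ ^ δ + qV ζ ^ σ) * ‖(Wt k (k + N + 1) N ϑ κ ζ : ℂ) * H ζ‖ ^ 2 := by positivity
        have t5 := mul_le_mul_of_nonneg_left t3 (by positivity : 0 ≤ 2 * C0)
        linarith
      · have t1 : 2 * C0 ≤ pX ζ ^ δ + qV ζ ^ σ := by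
          rcases le_or_gt ρ (pX ζ) with h1 | h1
          · have := Real.rpow_le_rpow (by positivity) h1 hδ0.le
            linarith
          · have h2 : ρ ≤ qV ζ := by push Not at hR; linarith
            have h3 := Real.rpow_le_rpow (by positivity) h2 hσ0.le
            have h4 : ρ ^ δ ≤ ρ ^ σ := Real.rpow_le_rpow_of_exponent_le hρ1 (by rw [hδ]; linarith)
            linarith
        have t2 := mul_le_mul_of_nonneg_right t1 (sq_nonneg ‖(Wt k (k + N + 1) N ϑ κ ζ : ℂ) * H ζ‖)
        have t3 : 0 ≤ 2 * C0 * Cl ^ 2 * ‖(((jw ζ ^ N)⁻¹ : ℝ) : ℂ) * H ζ‖ ^ 2 := by positivity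
        linarith
    have i4 : C0 * nq (fun ζ => (Wt k (k + N + 1) N ϑ κ ζ : ℂ) * H ζ) ≤ C0 * Mt := by
      rw [hMt]
      have := mul_le_mul_of_nonneg_left hg hC0.le
      nlinarith
    exact le_of_mul_le_mul_left i4 hC0
  have hκ : ∀ j : ℕ, 0 < ϑ * (1 / ((j : ℝ) + 1)) ∧ ϑ * (1 / ((j : ℝ) + 1)) ≤ ϑ := fun j => by
    refine ⟨by positivity, mul_le_of_le_one_right hϑ0.le ?_⟩
    rw [div_le_one (by positivity)]; linarith [Nat.cast_nonneg (α := ℝ) j]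
  have hl := memL2_lim (f := fun (j : ℕ) ζ => (Wt k (k + N + 1) N ϑ (ϑ * (1 / ((j : ℝ) + 1))) ζ : ℂ) * H ζ)
    (g := fun ζ => ((Sw XVs ϑ ζ ^ k * (Sw Ts ϑ ζ ^ N)⁻¹ : ℝ) : ℂ) * H ζ) (M := Mt)
    (fun j => (he.hv k hϑ0 hϑ1 (hκ j).1 ((hκ j).2.trans hϑ1)).1.1) (fun j => bd _ (hκ j).1 (hκ j).2) (fun ζ => by
      refine Tendsto.mul_const _ ((Complex.continuous_ofReal.tendsto _).comp ?_)
      have c1 : Continuous fun κ : ℝ => Wt k (k + N + 1) N ϑ κ ζ := by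
        have : ∀ κ, 1 + κ ^ 2 * sqJ XVs ζ ≠ 0 := fun κ => (Sw_pos XVs κ ζ).ne'
        unfold Wt Sw
        have h1 : Continuous fun κ : ℝ => ((1 + κ ^ 2 * sqJ XVs ζ) ^ (k + N + 1))⁻¹ :=
          Continuous.inv₀ (by fun_prop) fun κ => pow_ne_zero _ (this κ)
        fun_prop
      have c2 : Tendsto (fun j : ℕ => ϑ * (1 / ((j : ℝ) + 1))) atTop (𝓝 (ϑ * 0)) :=
        tendsto_one_div_add_atTop_nhds_zero_nat.const_mul ϑ
      rw [mul_zero] at c2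
      have c3 := (c1.tendsto 0).comp c2
      have e : Wt k (k + N + 1) N ϑ 0 ζ = Sw XVs ϑ ζ ^ k * (Sw Ts ϑ ζ ^ N)⁻¹ := by
        simp [Wt, Sw]
      rwa [e] at c3)
  refine hl.weight (c := fun ζ => (Sw XVs 1 ζ ^ k * (Sw Ts 1 ζ ^ N)⁻¹) * (Sw XVs ϑ ζ ^ k * (Sw Ts ϑ ζ ^ N)⁻¹)⁻¹)
    (C := ((ϑ ^ 2) ^ k)⁻¹) ?_ (fun ζ => ?_) (fun ζ => ?_)
  · have h1 : ∀ (J : Finset (Ix n)) (κ : ℝ) (m : ℕ), Continuous fun ζ => Sw J κ ζ ^ m := fun J κ m => (Sw_cont J κ).pow m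
    have h2 : ∀ (J : Finset (Ix n)) (κ : ℝ) (m : ℕ), Continuous fun ζ => (Sw J κ ζ ^ m)⁻¹ := fun J κ m =>
      (h1 J κ m).inv₀ fun ζ => (pow_pos (Sw_pos _ _ _) _).ne'
    simp_rw [mul_inv, inv_inv]
    exact ((h1 _ _ _).mul (h2 _ _ _)).mul ((h2 _ _ _).mul (h1 _ _ _))
  · have p1 := Sw_pos XVs 1 ζ
    have p2 := Sw_pos Ts 1 ζ
    have p3 := Sw_pos XVs ϑ ζ
    have p5 := Sw_pos Ts ϑ ζ
    rw [abs_of_pos (by positivity)]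
    have h1 : (ϑ ^ 2) ^ k * Sw XVs 1 ζ ^ k ≤ Sw XVs ϑ ζ ^ k := by
      rw [← mul_pow]; exact pow_le_pow_left₀ (by positivity) (Sw_ge1 _ hϑ0.le hϑ1 ζ) _
    have h2 : Sw Ts ϑ ζ ^ N ≤ Sw Ts 1 ζ ^ N := pow_le_pow_left₀ p5.le (Sw_le1 _ hϑ0.le hϑ1 ζ) _
    calc _ = (Sw XVs 1 ζ ^ k * (Sw XVs ϑ ζ ^ k)⁻¹) * (Sw Ts ϑ ζ ^ N * (Sw Ts 1 ζ ^ N)⁻¹) := by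
          rw [mul_inv, inv_inv]; ring
      _ ≤ ((ϑ ^ 2) ^ k)⁻¹ * 1 := by
        refine mul_le_mul ?_ ?_ (by positivity) (by positivity)
        · rw [← div_eq_mul_inv, div_le_iff₀ (by positivity), inv_mul_eq_div, le_div_iff₀ (by positivity)]; linarith
        · rw [← div_eq_mul_inv, div_le_one (by positivity)]; exact h2
      _ = _ := mul_one _
  · have p3 := Sw_pos XVs ϑ ζ
    have p5 := Sw_pos Ts ϑ ζ
    have : Sw XVs ϑ ζ ^ k * (Sw Ts ϑ ζ ^ N)⁻¹ ≠ 0 := by positivity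
    rw [← mul_assoc, ← Complex.ofReal_mul, mul_assoc _ (_)⁻¹, inv_mul_cancel₀ this, mul_one]

end
end KH

namespace KH
open SchwartzMap Function Filter
open scoped FourierTransform LineDeriv ContDiff ComplexConjugate Topology

lemma tg_dir {φ : Z n → ℂ} (hφ : φ.HasTemperateGrowth) (m : Z n) : (fun z => fderiv ℝ φ z m).HasTemperateGrowth := by
  set Λ : (Z n →L[ℝ] ℂ) →L[ℝ] ℂ := ContinuousLinearMap.apply ℝ ℂ m with hΛ
  have e : (fun z => fderiv ℝ φ z m) = Λ ∘ (fderiv ℝ φ) := by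
    funext z; simp [hΛ]
  have hd : ContDiff ℝ ∞ (fderiv ℝ φ) := hφ.1.fderiv_right (by simp)
  rw [e]
  refine ⟨Λ.contDiff.comp hd, fun k => ?_⟩
  obtain ⟨l, C, hC⟩ := hφ.2 (k+1)
  refine ⟨l, ‖Λ‖ * C, fun z => ?_⟩
  refine (Λ.norm_iteratedFDeriv_comp_left hd.contDiffAt (n := k) (by exact_mod_cast le_top)).trans ?_
  have := hC z
  rw [← norm_iteratedFDeriv_fderiv] at this
  rw [mul_assoc]
  gcongr

/-- temperate functions independent of `τ` -/
def TI (φ : Z n → ℂ) : Prop := φ.HasTemperateGrowth ∧ ∀ ζ (s : ℝ), φ (ζ + s • ej it) = φ ζ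

lemma TI.dir {φ : Z n → ℂ} (h : TI φ) (m : Z n) : TI (fun z => fderiv ℝ φ z m) := by
  refine ⟨tg_dir h.1 m, fun ζ s => ?_⟩
  have e : (fun ζ => φ (ζ + s • ej it)) = φ := funext fun ζ => h.2 ζ s
  have := fderiv_comp_add_right (𝕜 := ℝ) (f := φ) (x := ζ) (s • ej it)
  rw [e] at this
  beta_reduce
  rw [← this]

lemma TI.bd {φ : Z n → ℂ} (h : TI φ) : ∃ (C : ℝ) (l : ℕ), 0 ≤ C ∧ ∀ ζ, ‖φ ζ‖ ≤ C * Sw XVs 1 ζ ^ l := by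
  obtain ⟨l, C, hC⟩ := h.1.2 0
  have hC0 : 0 ≤ C := by
    have := (norm_nonneg _).trans (hC 0)
    simpa using this
  refine ⟨C * 2 ^ l, l, by positivity, fun ζ => ?_⟩
  set z := ζ + (-tC ζ) • ej it with hz
  have h1 : ‖φ ζ‖ ≤ C * (1 + ‖z‖) ^ l := by
    have := hC z
    rw [norm_iteratedFDeriv_zero, h.2] at this
    exact this
  have h2 : ‖z‖ ^ 2 = sqJ XVs ζ := by
    have t0 : tC z = 0 := by simp [hz, tC, ej]
    rw [norm_Z, t0, sqJ_XVs]
    have t1 : xC z = xC ζ := by ext i; simp [hz, xC, ej]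
    have t2 : vC z = vC ζ := by ext i; simp [hz, vC, ej]
    rw [t1, t2]; ring
  refine h1.trans ?_
  rw [mul_assoc, ← mul_pow]
  refine mul_le_mul_of_nonneg_left (pow_le_pow_left₀ (by positivity) ?_ _) hC0
  rw [Sw, ← h2]
  nlinarith [sq_nonneg (‖z‖ - 1), sq_nonneg ‖z‖]

lemma TI_co (j : Ix n) (hj : j ≠ it) : TI (co j) := by
  refine ⟨co_tg j, fun ζ s => ?_⟩
  simp [co, ej, hj]

/-- weights -/
def Vw (m k : ℕ) (ζ : Z n) : ℂ := (((Wt k 0 m 1 1 ζ)⁻¹ : ℝ) : ℂ)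
lemma Vw_tg (m k : ℕ) : (Vw (n := n) m k).HasTemperateGrowth := Wt_inv_tg k 0 m 1 1

/-- rapidly decaying functionals in `(ξ,η)`, of order `m` in `τ` -/
def Yf (m : ℕ) (ℓ : Sch n → ℂ) : Prop := ∀ k, ∃ f : Z n → ℂ, L2f f ∧ ∀ θ, ℓ θ = ip f (mu (Vw m k) θ)

/-- functionals obtained by differentiation in `η` -/
inductive Xf {n : ℕ} (m : ℕ) : (Sch n → ℂ) → Prop
  | base (ℓ : Sch n → ℂ) (h : Yf m ℓ) : Xf m ℓ
  | add (ℓ ℓ' : Sch n → ℂ) (h : Xf m ℓ) (h' : Xf m ℓ') : Xf m (fun θ => ℓ θ + ℓ' θ)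
  | der (i : Fin n) (ℓ : Sch n → ℂ) (h : Xf m ℓ) : Xf m (fun θ => ℓ (∂_{ej (iv i)} θ))

variable {m : ℕ}

lemma Yf.smul {ℓ : Sch n → ℂ} (h : Yf m ℓ) (c : ℂ) : Yf m (fun θ => c * ℓ θ) := by
  intro k
  obtain ⟨f, hf, e⟩ := h k
  refine ⟨fun ζ => conj c * f ζ, hf.const_mul _, fun θ => ?_⟩
  beta_reduce
  rw [ip_const_left, e, Complex.conj_conj]

lemma Xf.smul {ℓ : Sch n → ℂ} (h : Xf m ℓ) (c : ℂ) : Xf m (fun θ => c * ℓ θ) := by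
  induction h with
  | base ℓ h => exact .base _ (h.smul c)
  | add ℓ ℓ' h h' ih ih' => simp_rw [mul_add]; exact .add _ _ ih ih'
  | der i ℓ h ih => exact .der i _ ih

lemma Xf.sub {ℓ ℓ' : Sch n → ℂ} (h : Xf m ℓ) (h' : Xf m ℓ') : Xf m (fun θ => ℓ θ - ℓ' θ) := by
  have := Xf.add _ _ h (h'.smul (-1))
  simpa [sub_eq_add_neg] using this

lemma Xf.sum {s : Finset (Fin n)} {ℓ : Fin n → Sch n → ℂ} {ℓ₀ : Sch n → ℂ} (h0 : Xf m ℓ₀) (h : ∀ i, Xf m (ℓ i)) :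
    Xf m (fun θ => ∑ i ∈ s, ℓ i θ) := by
  classical
  induction s using Finset.induction_on with
  | empty => simpa using h0.smul 0
  | insert a s ha ih => simp_rw [Finset.sum_insert ha]; exact .add _ _ (h a) ih

lemma Xf.lin {ℓ : Sch n → ℂ} (h : Xf m ℓ) (θ φ : Sch n) : ℓ (θ + φ) = ℓ θ + ℓ φ := by
  induction h generalizing θ φ with
  | base ℓ h =>
    obtain ⟨f, hf, e⟩ := h 0
    rw [e, e, e, map_add]
    exact (ipL hf.tp).map_add _ _
  | add ℓ ℓ' h h' ih ih' => simp only [ih, ih']; ring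
  | der i ℓ h ih => simp only [LineDeriv.lineDerivOp_add, ih]

lemma Yf.mul {ℓ : Sch n → ℂ} (h : Yf m ℓ) {φ : Z n → ℂ} (hφ : TI φ) : Yf m (fun θ => ℓ (mu φ θ)) := by
  intro k
  obtain ⟨C, l, hC, hb⟩ := hφ.bd
  obtain ⟨f, hf, e⟩ := h (k + l)
  have p := fun ζ : Z n => Sw_pos XVs 1 ζ
  have hc : Continuous fun ζ => (((Sw XVs 1 ζ ^ l)⁻¹ : ℝ) : ℂ) * φ ζ := by
    refine (Complex.continuous_ofReal.comp (Continuous.inv₀ ((Sw_cont _ _).pow l) fun ζ => (pow_pos (p ζ) _).ne')).mul ?_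
    exact hφ.1.1.continuous
  refine ⟨fun ζ => conj ((((Sw XVs 1 ζ ^ l)⁻¹ : ℝ) : ℂ) * φ ζ) * f ζ, ?_, fun θ => ?_⟩
  · refine MemLp.of_le_mul (c := C) hf ((Complex.continuous_conj.comp hc).aestronglyMeasurable.mul hf.1)
      (Eventually.of_forall fun ζ => ?_)
    rw [norm_mul, RCLike.norm_conj, norm_mul, Complex.norm_real, Real.norm_of_nonneg (by have := p ζ; positivity)]
    refine mul_le_mul_of_nonneg_right ?_ (norm_nonneg _)
    rw [inv_mul_le_iff₀ (pow_pos (p ζ) _), mul_comm]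
    exact hb ζ
  · beta_reduce
    rw [e]
    unfold ip
    congr 1; funext ζ
    rw [mu_apply (Vw_tg _ _), mu_apply (Vw_tg _ _), mu_apply hφ.1, map_mul, Complex.conj_conj]
    have : Vw m (k + l) ζ = (((Sw XVs 1 ζ ^ l)⁻¹ : ℝ) : ℂ) * Vw m k ζ := by
      rw [Vw, Vw, ← Complex.ofReal_mul]
      congr 1
      simp only [Wt, pow_zero, inv_one, mul_one, pow_add, mul_inv]
      ring
    rw [this]; ring

lemma Xf.mul {ℓ : Sch n → ℂ} (h : Xf m ℓ) {φ : Z n → ℂ} (hφ : TI φ) : Xf m (fun θ => ℓ (mu φ θ)) := by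
  induction h generalizing φ with
  | base ℓ h => exact .base _ (h.mul hφ)
  | add ℓ ℓ' h h' ih ih' => exact .add _ _ (ih hφ) (ih' hφ)
  | der i ℓ h ih =>
    have e : ∀ θ : Sch n, ℓ (∂_{ej (iv i)} (mu φ θ)) = ℓ (mu (fun z => fderiv ℝ φ z (ej (iv i))) θ) + ℓ (mu φ (∂_{ej (iv i)} θ)) := by
      intro θ
      rw [← h.lin]
      congr 1
      ext z
      rw [dmul hφ.1, _root_.add_apply, mu_apply (hφ.dir _).1, mu_apply hφ.1]
    simp_rw [e]
    exact .add _ _ (ih (hφ.dir _)) (.der i _ (ih hφ))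

lemma Yf.op {ℓ : Sch n → ℂ} (h : Yf m ℓ) {b : Z n → ℂ} (hb : CB b) : Yf m (fun θ => ℓ (Aop b θ)) := by
  intro k
  obtain ⟨f, hf, e⟩ := h k
  obtain ⟨T', hT', eT⟩ := CJ_Wt (n := n) (ι := Unit) (ϑ := fun _ => 1) (s := fun _ => 1) (fun i => ⟨one_pos, le_rfl⟩)
    (fun i => ⟨one_pos, le_rfl⟩) k 0 m _ (Fam.base _ hb)
  obtain ⟨CT, hCT, bT⟩ := hT'.bound (σ := 1 / 2) (by norm_num)
  obtain ⟨CA, hCA, bA⟩ := nr_Aop hb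
  obtain ⟨g, hg, -, eg⟩ := riesz ((ipL hf.tp).comp (Aop b + T' ()).toLinearMap) (C := nr f * (CA + CT))
    (mul_nonneg (nr_nonneg _) (by positivity)) (fun θ => by
      change ‖ip f (Aop b θ + T' () θ : Sch n)‖ ≤ _
      refine (ip_le hf (sL2 _)).trans ?_
      rw [mul_assoc]
      refine mul_le_mul_of_nonneg_left ?_ (nr_nonneg _)
      have h1 : nr (Aop b θ + T' () θ : Sch n) ≤ nr (Aop b θ) + nr (T' () θ) := nr_add_le (sL2 _) (sL2 _)
      have h2 := bA θ
      have h3 := (bT () θ).1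
      linarith)
  refine ⟨g, hg, fun θ => ?_⟩
  beta_reduce
  rw [e]
  have h1 := eT () (mu (Vw m k) θ)
  have h2 : mu (fun ζ => (Wt k 0 m 1 1 ζ : ℂ)) (mu (Vw m k) θ) = θ := by
    rw [mu_mul (Wt_tg _ _ _ _ _) (Vw_tg _ _)]
    ext z
    rw [mu_apply ((Wt_tg _ _ _ _ _).fun_mul (Vw_tg _ _)), Vw, ← Complex.ofReal_mul, mul_inv_cancel₀ (Wt_pos _ _ _ _ _ _).ne']
    simp
  rw [h2] at h1
  have h3 : mu (Vw m k) (Aop b θ) = Aop b (mu (Vw m k) θ) + T' () (mu (Vw m k) θ) := by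
    have hV : (Vw (n := n) m k) = fun ζ => ((Wt k 0 m 1 1 ζ : ℝ) : ℂ)⁻¹ := by
      funext ζ; rw [Vw, Complex.ofReal_inv]
    simpa [hV] using h1
  rw [h3, ← eg]
  rfl

lemma Xf.op {ℓ : Sch n → ℂ} (h : Xf m ℓ) {b : Z n → ℂ} (hb : CB b) : Xf m (fun θ => ℓ (Aop b θ)) := by
  induction h with
  | base ℓ h => exact .base _ (h.op hb)
  | add ℓ ℓ' h h' ih ih' => exact .add _ _ ih ih'
  | der i ℓ h ih =>
    simp_rw [Aop_deriv b hb]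
    exact .der i _ ih

/-- powers of `τ` -/
def tp (j : ℕ) (ζ : Z n) : ℂ := co it ζ ^ j
lemma tp_tg (j : ℕ) : (tp (n := n) j).HasTemperateGrowth := (co_tg it).pow j
lemma tp_zero (θ : Sch n) : mu (tp 0) θ = θ := by
  ext z; rw [mu_apply (tp_tg 0), tp]; simp
lemma tp_succ (j : ℕ) (θ : Sch n) : mu (tp (j + 1)) θ = mu (co it) (mu (tp j) θ) := by
  ext z; rw [mu_apply (tp_tg _), mu_apply (co_tg _), mu_apply (tp_tg _), tp, tp]; ring

lemma fderiv_tfun {g : Z n → ℂ} (hg : Differentiable ℝ g) {φ : ℝ → ℂ} (e : ∀ ζ, g ζ = φ (tC ζ)) (ζ : Z n) (i : Fin n) :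
    fderiv ℝ g ζ (ej (iv i)) = 0 := by
  have h1 : HasLineDerivAt ℝ g (fderiv ℝ g ζ (ej (iv i))) ζ (ej (iv i)) := (hg ζ).hasFDerivAt.hasLineDerivAt _
  have h2 : HasLineDerivAt ℝ g 0 ζ (ej (iv i)) := by
    unfold HasLineDerivAt
    have : (fun t : ℝ => g (ζ + t • ej (iv i))) = fun _ => g ζ := by
      funext t
      rw [e, e]; congr 1; simp [tC, ej]
    rw [this]
    exact hasDerivAt_const _ _
  exact HasDerivAt.unique h1 h2

lemma mu_t_der {g : Z n → ℂ} (hg : g.HasTemperateGrowth) {φ : ℝ → ℂ} (e : ∀ ζ, g ζ = φ (tC ζ)) (i : Fin n) (θ : Sch n) :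
    (∂_{ej (iv i)} (mu g θ) : Sch n) = mu g (∂_{ej (iv i)} θ) := by
  ext z
  rw [dmul hg, fderiv_tfun (hg.1.differentiable (by simp)) e, mu_apply hg]; ring

section
variable {σ : ℝ} {w : E n → ℝ} {a : Z n → ℝ} {N : ℕ} {H G : Z n → ℂ}

lemma jw_tg : (fun ζ : Z n => (jw ζ : ℂ)).HasTemperateGrowth := by
  have h : (fun ζ : Z n => (1 + ‖ζ‖ ^ 2 : ℝ)).HasTemperateGrowth :=
    (Function.HasTemperateGrowth.const 1).add (Function.hasTemperateGrowth_norm_sq (Z n))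
  exact Function.Complex.hasTemperateGrowth_ofReal.comp h

lemma Eqn.tp (he : Eqn σ w a N H G) : Tp H := fun θ => by
  have h1 : (fun ζ : Z n => (jw ζ : ℂ) ^ N).HasTemperateGrowth := jw_tg.pow N
  refine (he.hH.ip_int (sL2 (mu (fun ζ : Z n => (jw ζ : ℂ) ^ N) θ))).congr (Eventually.of_forall fun ζ => ?_)
  have p : (jw ζ : ℂ) ≠ 0 := by exact_mod_cast (jw_pos ζ).ne'
  simp only [mu_apply h1, map_mul, Complex.conj_ofReal]
  push_cast
  field_simp

lemma Eqn.XG (he : Eqn σ w a N H G) (j : ℕ) : Xf m (fun θ => ip G (mu (KH.tp j) θ)) := by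
  refine .base _ fun k => ?_
  have hG0 : L2f G := by simpa using he.hG 0
  refine ⟨fun ζ => (Wt k 0 m 1 1 ζ : ℂ) * (KH.tp j ζ * G ζ), ?_, fun θ => ?_⟩
  · refine MemLp.of_le (he.hG (k + j)) ?_ (Eventually.of_forall fun ζ => ?_)
    · exact (Complex.continuous_ofReal.comp (Wt_cont _ _ _ _ _)).aestronglyMeasurable.mul ((tp_tg j).1.continuous.aestronglyMeasurable.mul hG0.1)
    · have pj := jw_pos ζ
      rw [norm_mul, norm_mul, norm_mul, Complex.norm_real, Complex.norm_real, Real.norm_of_nonneg (Wt_pos _ _ _ _ _ _).le,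
        Real.norm_of_nonneg (by positivity), ← mul_assoc, pow_add]
      refine mul_le_mul_of_nonneg_right ?_ (norm_nonneg _)
      refine mul_le_mul (Wt_le_jw _ _ _ _ one_pos le_rfl _) ?_ (norm_nonneg _) (by positivity)
      rw [KH.tp, norm_pow]
      refine pow_le_pow_left₀ (norm_nonneg _) ?_ _
      rw [co, Complex.norm_real, jw]
      have : ‖ζ it‖ ≤ ‖ζ‖ := PiLp.norm_apply_le ζ _
      nlinarith [sq_nonneg (‖ζ‖ - 1), sq_nonneg ‖ζ‖]
  · unfold ip
    congr 1; funext ζ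
    have p : (Wt k 0 m 1 1 ζ : ℂ) ≠ 0 := by exact_mod_cast (Wt_pos k 0 m 1 1 ζ).ne'
    have : conj (KH.tp j ζ) = KH.tp j ζ := by simp [KH.tp, co]
    rw [mu_apply (tp_tg j), mu_apply (Vw_tg _ _), Vw, map_mul, map_mul, this, Complex.conj_ofReal]
    push_cast
    field_simp

lemma Eqn.X0 (he : Eqn σ w a N H G) (hn : 1 ≤ n) (hσ0 : 0 < σ) (hσ1 : σ < 1) (hw : Wc w)
    (hb : CB (fun z => (a z : ℂ))) {a₀ : ℝ} (ha₀ : 0 < a₀) (h : ∀ z, a₀ ≤ a z) : Xf N (fun θ => ip H θ) := by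
  refine .base _ fun k => ⟨_, he.stage1 hn hσ0 hσ1 hw hb ha₀ h k, fun θ => ?_⟩
  unfold ip
  congr 1; funext ζ
  have p1 := Sw_pos XVs 1 ζ
  have p2 := Sw_pos Ts 1 ζ
  have e : Wt k 0 N 1 1 ζ = Sw XVs 1 ζ ^ k * (Sw Ts 1 ζ ^ N)⁻¹ := by simp [Wt]
  have p : Sw XVs 1 ζ ^ k * (Sw Ts 1 ζ ^ N)⁻¹ ≠ 0 := by positivity
  rw [mu_apply (Vw_tg _ _), Vw, e, map_mul, Complex.conj_ofReal]
  have p' : ((Sw XVs 1 ζ ^ k * (Sw Ts 1 ζ ^ N)⁻¹ : ℝ) : ℂ) * (((Sw XVs 1 ζ ^ k * (Sw Ts 1 ζ ^ N)⁻¹)⁻¹ : ℝ) : ℂ) = 1 := by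
    rw [← Complex.ofReal_mul, mul_inv_cancel₀ p, Complex.ofReal_one]
  linear_combination (-(conj (H ζ) * θ ζ)) * p'

lemma TI_F (hw : Wc w) : TI (fun ζ : Z n => (Fz σ w ζ : ℂ)) := by
  refine ⟨Fz_tg σ hw, fun ζ s => ?_⟩
  have : vC (ζ + s • ej it) = vC ζ := by ext i; simp [vC, ej]
  simp only [Fz, this]

lemma Eqn.Xt (he : Eqn σ w a N H G) (hw : Wc w) (hb : CB (fun z => (a z : ℂ))) (h0 : Xf N (fun θ => ip H θ)) (j : ℕ) :
    Xf N (fun θ => ip H (mu (KH.tp j) θ)) := by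
  induction j using Nat.strong_induction_on with
  | _ j ih =>
  cases j with
  | zero => simp_rw [tp_zero]; exact h0
  | succ J =>
    have hF := TI_F (n := n) (σ := σ) hw
    set Fm := mu (fun ζ : Z n => (Fz σ w ζ : ℂ)) with hFm
    have L := ipL he.tp
    have Q : ∀ j i b, CB b → i + j ≤ J → Xf N (fun θ => ip H (mu (KH.tp i) (Fm (Aop b (mu (KH.tp j) θ))))) := by
      intro j
      induction j with
      | zero =>
        intro i b hb hi
        simp_rw [tp_zero]
        exact ((ih i (by omega)).mul hF).op hb
      | succ j ihj =>
        intro i b hb hi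
        have e : ∀ θ : Sch n, ip H (mu (KH.tp i) (Fm (Aop b (mu (KH.tp (j + 1)) θ)))) =
            ip H (mu (KH.tp (i + 1)) (Fm (Aop b (mu (KH.tp j) θ)))) -
            ip H (mu (KH.tp i) (Fm (Aop (dj it b) (mu (KH.tp j) θ)))) := by
          intro θ
          have e1 : Aop b (mu (KH.tp (j + 1)) θ) = mu (co it) (Aop b (mu (KH.tp j) θ)) - Aop (dj it b) (mu (KH.tp j) θ) := by
            rw [tp_succ, co_Aop hb]; abel
          rw [e1, map_sub, map_sub, tp_succ (i), mu_comm (co_tg it) (tp_tg i), hFm, mu_comm hF.1 (co_tg it)]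
          exact (ipL he.tp).map_sub _ _
        simp_rw [e]
        exact (ihj (i + 1) b hb (by omega)).sub (ihj i _ (hb.dj it) (by omega))
    have e : ∀ θ : Sch n, ip H (mu (KH.tp (J + 1)) θ) = (2 * π * Complex.I : ℂ)⁻¹ * (ip G (mu (KH.tp J) θ) -
        ip H (mu (KH.tp 0) (Fm (Aop (fun z => (a z : ℂ)) (mu (KH.tp J) θ)))) -
        ∑ i : Fin n, ip H (mu (KH.tp J) (mu (co (ix i)) (∂_{ej (iv i)} θ : Sch n)))) := by
      intro θ
      have e0 := he.eq (mu (KH.tp J) θ)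
      have e1 : ip H (Xop (mu (KH.tp J) θ)) = (2 * π * Complex.I : ℂ) * ip H (mu (KH.tp (J + 1)) θ) +
          ∑ i : Fin n, ip H (mu (KH.tp J) (mu (co (ix i)) (∂_{ej (iv i)} θ : Sch n))) := by
        rw [Xop_eq, tp_succ]
        change ipL he.tp _ = _ * ipL he.tp _ + ∑ i : Fin n, ipL he.tp _
        rw [map_add, map_smul, map_sum, smul_eq_mul]
        congr 1
        refine Finset.sum_congr rfl fun i _ => ?_
        rw [mu_t_der (φ := fun t => (t : ℂ) ^ J) (tp_tg J) (fun ζ => rfl), mu_comm (co_tg _) (tp_tg J)]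
      have e2 : ip (fun ζ => (Fz σ w ζ : ℂ) * H ζ) (Aop (fun z => (a z : ℂ)) (mu (KH.tp J) θ)) =
          ip H (mu (KH.tp 0) (Fm (Aop (fun z => (a z : ℂ)) (mu (KH.tp J) θ)))) := by
        rw [tp_zero, ip_real]
        congr 1; funext ζ; rw [hFm, mu_apply hF.1]
      rw [e1, e2] at e0
      rw [← e0]
      field_simp [two_pi_I_ne]
      ring
    simp_rw [e]
    refine Xf.smul (Xf.sub (Xf.sub (he.XG J) (Q J 0 _ hb (by omega))) (Xf.sum h0 fun i => ?_)) _
    exact .der i _ ((ih J (by omega)).mul (TI_co (ix i) (by simp)))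

/-- `(1+τ²)^J` -/
lemma Eqn.XS (he : Eqn σ w a N H G) (hX : ∀ j, Xf N (fun θ => ip H (mu (KH.tp j) θ))) (J j : ℕ) :
    Xf N (fun θ => ip H (mu (KH.tp j) (mu (fun ζ => ((Sw Ts 1 ζ ^ J : ℝ) : ℂ)) θ))) := by
  have tg : ∀ J : ℕ, (fun ζ : Z n => ((Sw Ts 1 ζ ^ J : ℝ) : ℂ)).HasTemperateGrowth := fun J => by
    have := Sp_tg (n := n) Ts 1 J
    unfold Sp at this
    simpa [Real.rpow_natCast] using this
  induction J generalizing j with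
  | zero => simpa [mu_one] using hX j
  | succ J ih =>
    have e : ∀ θ : Sch n, ip H (mu (KH.tp j) (mu (fun ζ => ((Sw Ts 1 ζ ^ (J + 1) : ℝ) : ℂ)) θ)) =
        ip H (mu (KH.tp j) (mu (fun ζ => ((Sw Ts 1 ζ ^ J : ℝ) : ℂ)) θ)) +
        ip H (mu (KH.tp (j + 2)) (mu (fun ζ => ((Sw Ts 1 ζ ^ J : ℝ) : ℂ)) θ)) := by
      intro θ
      change ipL he.tp _ = ipL he.tp _ + ipL he.tp _
      rw [← map_add]
      congr 1
      ext z
      simp only [_root_.add_apply, mu_apply (tp_tg _), mu_apply (tg _)]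
      have : (Sw Ts 1 z : ℂ) = 1 + co it z ^ 2 := by
        rw [Sw, sqJ_Ts]; simp [co, tC]
      push_cast
      rw [KH.tp, KH.tp, pow_succ, this]; ring
    simp_rw [e]
    exact .add _ _ (ih j) (ih (j + 2))
end
end KH

namespace KH
open SchwartzMap Function Filter
open scoped FourierTransform LineDeriv ContDiff ComplexConjugate Topology

/-- functionals represented by polynomially bounded `C^r` functions -/
def Rg (r : ℕ) (Λ : Sch n → ℂ) : Prop :=
  ∃ g : Z n → ℂ, ContDiff ℝ r g ∧ (∃ (C : ℝ) (l : ℕ), ∀ z, ‖g z‖ ≤ C * jw z ^ l) ∧ ∀ ψ : Sch n, Λ ψ = ∫ z, g z * ψ z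

lemma jwp_tg (l : ℕ) : (fun ζ : Z n => (jw ζ : ℂ) ^ l).HasTemperateGrowth := jw_tg.pow l

lemma poly_int {g : Z n → ℂ} (hg : Continuous g) {C : ℝ} {l : ℕ} (h : ∀ z, ‖g z‖ ≤ C * jw z ^ l) (ψ : Sch n) :
    Integrable (fun z => g z * ψ z) := by
  refine ((mu (fun ζ : Z n => (jw ζ : ℂ) ^ l) ψ).integrable.norm.const_mul C).mono'
    (hg.mul ψ.continuous).aestronglyMeasurable (Eventually.of_forall fun z => ?_)
  have := jw_pos z
  rw [mu_apply (jwp_tg l), norm_mul, norm_mul, norm_pow, Complex.norm_real, Real.norm_of_nonneg this.le, ← mul_assoc]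
  exact mul_le_mul_of_nonneg_right (h z) (norm_nonneg _)

lemma jw_L2 : ∃ d : ℕ, L2f (fun ζ : Z n => (((jw ζ ^ d)⁻¹ : ℝ) : ℂ)) := by
  set D := Module.finrank ℝ (Z n) with hD
  refine ⟨D + 1, ?_⟩
  have hc : Continuous (fun ζ : Z n => (((jw ζ ^ (D + 1))⁻¹ : ℝ) : ℂ)) :=
    Complex.continuous_ofReal.comp (Continuous.inv₀ (jw_cont.pow _) fun ζ => (pow_pos (jw_pos ζ) _).ne')
  unfold L2f
  rw [memLp_two_iff_integrable_sq_norm hc.aestronglyMeasurable]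
  have h := integrable_rpow_neg_one_add_norm_sq (E := Z n) (μ := volume) (r := 4 * ((D : ℝ) + 1)) (by
    rw [← hD]; have : (0 : ℝ) ≤ D := Nat.cast_nonneg _
    linarith)
  refine h.congr (Eventually.of_forall fun ζ => ?_)
  have p := jw_pos ζ
  simp only [Complex.norm_real]
  rw [Real.norm_of_nonneg (by positivity)]
  change jw ζ ^ _ = _
  rw [show -(4 * ((D : ℝ) + 1)) / 2 = -(((D + 1) * 2 : ℕ) : ℝ) by push_cast; ring, Real.rpow_neg p.le, Real.rpow_natCast,
    pow_mul, inv_pow]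

lemma fourier_swap {q : Z n → ℂ} (hq : Integrable q) (ψ : Sch n) :
    ∫ ζ, q ζ * (𝓕⁻ ψ : Sch n) ζ = ∫ z, 𝓕 (fun ζ => q (-ζ)) z * ψ z := by
  have h1 : ∫ ζ, q ζ * (𝓕⁻ ψ : Sch n) ζ = ∫ ζ, q (-ζ) * (𝓕 ψ : Sch n) ζ := by
    rw [← integral_neg_eq_self]
    congr 1; funext ζ
    rw [SchwartzMap.fourierInv_coe, Real.fourierInv_eq_fourier_neg, neg_neg, SchwartzMap.fourier_coe]
  rw [h1]
  have := VectorFourier.integral_fourierIntegral_smul_eq_flip (L := innerₗ (Z n)) (μ := volume) (ν := volume)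
    (f := fun ζ => q (-ζ)) (g := ψ) Real.continuous_fourierChar continuous_inner hq.comp_neg ψ.integrable
  rw [flip_innerₗ] at this
  rw [SchwartzMap.fourier_coe]
  exact this.symm

/-- negative powers of `1+τ²` -/
def SJ (J : ℕ) (ζ : Z n) : ℂ := (((Sw Ts 1 ζ ^ J)⁻¹ : ℝ) : ℂ)

lemma SJ_tg (J : ℕ) : (SJ (n := n) J).HasTemperateGrowth := by
  have := Wt_tg (n := n) 0 0 J 1 1
  refine (congrArg _ ?_).mp this
  funext ζ; simp [Wt, SJ]

lemma SJ_e (J : ℕ) (ζ : Z n) : SJ J ζ = (fun t : ℝ => ((((1 + t ^ 2) ^ J)⁻¹ : ℝ) : ℂ)) (tC ζ) := by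
  simp only [SJ, Sw, sqJ_Ts, one_pow, one_mul]

lemma Xf.rg {m d : ℕ} (hd : L2f (fun ζ : Z n => (((jw ζ ^ d)⁻¹ : ℝ) : ℂ))) {ℓ : Sch n → ℂ} (h : Xf m ℓ) (r : ℕ) :
    Rg r (fun ψ => ℓ (mu (SJ (m + (r + d))) (𝓕⁻ ψ : Sch n))) := by
  induction h with
  | base ℓ h =>
    obtain ⟨f, hf, e⟩ := h (r + d)
    set J := m + (r + d) with hJ
    have tgs := (Vw_tg (n := n) m (r + d)).fun_mul (SJ_tg J)
    set q : Z n → ℂ := fun ζ => conj (f ζ) * (Vw m (r + d) ζ * SJ J ζ) with hq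
    have qm : AEStronglyMeasurable q volume := hf.conj.1.mul tgs.1.continuous.aestronglyMeasurable
    have qb : ∀ ζ, ‖q ζ‖ ≤ ‖f ζ‖ * ((jw ζ ^ (r + d))⁻¹) := by
      intro ζ
      have p1 := Sw_pos XVs 1 ζ
      have p2 := Sw_pos Ts 1 ζ
      have pj := jw_pos ζ
      rw [hq]
      beta_reduce
      rw [norm_mul, RCLike.norm_conj, Vw, SJ, ← Complex.ofReal_mul, Complex.norm_real,
        Real.norm_of_nonneg (mul_nonneg (inv_nonneg.2 (Wt_pos _ _ _ _ _ _).le) (by positivity))]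
      refine mul_le_mul_of_nonneg_left ?_ (norm_nonneg _)
      have : (Wt (r + d) 0 m 1 1 ζ)⁻¹ * (Sw Ts 1 ζ ^ J)⁻¹ = ((Sw XVs 1 ζ * Sw Ts 1 ζ) ^ (r + d))⁻¹ := by
        rw [Wt, hJ, pow_add _ m, mul_pow]
        field_simp
      rw [this]
      exact inv_anti₀ (by positivity) (pow_le_pow_left₀ pj.le (jw_le ζ) _)
    have qi : ∀ i : ℕ, i ≤ r → Integrable (fun ζ => ‖ζ‖ ^ i * ‖q ζ‖) := by
      intro i hi
      have h1 := (hf.ip_int hd).norm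
      refine h1.mono' (Continuous.aestronglyMeasurable (by fun_prop) |>.mul qm.norm) (Eventually.of_forall fun ζ => ?_)
      have pj := jw_pos ζ
      have pg := jw_ge ζ
      have hr : ‖conj (f ζ) * (((jw ζ ^ d)⁻¹ : ℝ) : ℂ)‖ = ‖f ζ‖ * (jw ζ ^ d)⁻¹ := by
        rw [norm_mul, RCLike.norm_conj, Complex.norm_real, Real.norm_of_nonneg (by positivity : 0 ≤ (jw ζ ^ d)⁻¹)]
      rw [hr, Real.norm_of_nonneg (mul_nonneg (pow_nonneg (norm_nonneg _) _) (norm_nonneg _))]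
      have h2 : ‖ζ‖ ^ i ≤ jw ζ ^ r := by
        refine (pow_le_pow_left₀ (norm_nonneg _) ?_ _).trans (pow_le_pow_right₀ pg hi)
        rw [jw]; nlinarith [sq_nonneg (‖ζ‖ - 1), sq_nonneg ‖ζ‖]
      calc ‖ζ‖ ^ i * ‖q ζ‖ ≤ jw ζ ^ r * (‖f ζ‖ * ((jw ζ ^ (r + d))⁻¹)) :=
            mul_le_mul h2 (qb ζ) (norm_nonneg _) (by positivity)
        _ = _ := by rw [pow_add]; field_simp
    have q0 : Integrable q := by
      have := qi 0 (Nat.zero_le _)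
      simp only [pow_zero, one_mul] at this
      exact (integrable_norm_iff qm).1 this
    refine ⟨𝓕 (fun ζ => q (-ζ)), ?_, ⟨∫ ζ, ‖q ζ‖, 0, fun z => ?_⟩, fun ψ => ?_⟩
    · refine Real.contDiff_fourier (N := (r : ℕ∞)) fun i hi => ?_
      have := (qi i (by exact_mod_cast hi)).comp_neg
      simpa using this
    · rw [pow_zero, mul_one]
      refine (VectorFourier.norm_fourierIntegral_le_integral_norm _ _ _ _ _).trans (le_of_eq ?_)
      exact integral_neg_eq_self (fun ζ => ‖q ζ‖) volume
    · beta_reduce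
      rw [← fourier_swap q0, e, ip]
      congr 1; funext ζ
      rw [mu_apply (Vw_tg _ _), mu_apply (SJ_tg _), hq]
      ring
  | add ℓ ℓ' h h' ih ih' =>
    obtain ⟨g, hg, ⟨C, l, hC⟩, e⟩ := ih
    obtain ⟨g', hg', ⟨C', l', hC'⟩, e'⟩ := ih'
    have i1 := poly_int hg.continuous hC
    have i2 := poly_int hg'.continuous hC'
    refine ⟨fun z => g z + g' z, hg.add hg', ⟨|C| + |C'|, l + l', fun z => ?_⟩, fun ψ => ?_⟩
    · have pg := jw_ge z
      have h1 : C * jw z ^ l ≤ |C| * jw z ^ (l + l') :=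
        mul_le_mul (le_abs_self _) (pow_le_pow_right₀ pg (by omega)) (by positivity) (abs_nonneg _)
      have h2 : C' * jw z ^ l' ≤ |C'| * jw z ^ (l + l') :=
        mul_le_mul (le_abs_self _) (pow_le_pow_right₀ pg (by omega)) (by positivity) (abs_nonneg _)
      have h3 := norm_add_le (g z) (g' z)
      have := hC z
      have := hC' z
      linarith
    · beta_reduce at e e' ⊢
      rw [e ψ, e' ψ, ← integral_add (i1 ψ) (i2 ψ)]
      congr 1; funext z; ring
  | der i ℓ h ih =>
    obtain ⟨g, hg, ⟨C, l, hC⟩, e⟩ := ih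
    have hcs : ContDiff ℝ r (co (n := n) (iv i)) := (co_tg (iv i)).1.of_le (by exact_mod_cast le_top)
    refine ⟨fun z => (2 * π * Complex.I) * (co (iv i) z * g z), contDiff_const.mul (hcs.mul hg),
      ⟨2 * π * C, l + 1, fun z => ?_⟩, fun ψ => ?_⟩
    · have pg := jw_pos z
      have h0 : ‖(2 * π * Complex.I : ℂ)‖ = 2 * π := by
        simp [abs_of_pos Real.pi_pos]
      rw [norm_mul, h0, norm_mul, mul_assoc (2 * π) C]
      refine mul_le_mul_of_nonneg_left ?_ (mul_pos two_pos Real.pi_pos).le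
      have h1 : ‖co (iv i) z‖ ≤ jw z := by
        rw [co, Complex.norm_real, jw]
        have : ‖z (iv i)‖ ≤ ‖z‖ := PiLp.norm_apply_le z _
        nlinarith [sq_nonneg (‖z‖ - 1), sq_nonneg ‖z‖]
      calc ‖co (iv i) z‖ * ‖g z‖ ≤ jw z * (C * jw z ^ l) := mul_le_mul h1 (hC z) (norm_nonneg _) pg.le
        _ = _ := by ring
    · beta_reduce at e ⊢
      rw [mu_t_der (φ := fun t : ℝ => ((((1 + t ^ 2) ^ (m + (r + d)))⁻¹ : ℝ) : ℂ)) (SJ_tg _) (fun ζ => SJ_e _ ζ), lineDerivOp_fourierInv_eq, mu_inner, e]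
      congr 1; funext z
      rw [_root_.smul_apply, mu_apply (co_tg _), smul_eq_mul]; ring

/-- uniqueness of representatives -/
lemma rep_unique {g g' : Z n → ℂ} (hg : Continuous g) (hg' : Continuous g')
    (h : ∀ ψ : Sch n, ∫ z, g z * ψ z = ∫ z, g' z * ψ z) : g = g' := by
  have := ae_eq_of_integral_contDiff_smul_eq (μ := volume) hg.locallyIntegrable hg'.locallyIntegrable fun φ hφ hc => ?_
  · exact (Continuous.ae_eq_iff_eq volume hg hg').1 this
  · have hg₁ : HasCompactSupport (Complex.ofRealCLM ∘ φ) := hc.comp_left rfl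
    have hg₂ : ContDiff ℝ ∞ (Complex.ofRealCLM ∘ φ) := by fun_prop
    have := h (hg₁.toSchwartzMap hg₂)
    simpa [mul_comm] using this

section
variable {σ : ℝ} {w : E n → ℝ} {a : Z n → ℝ} {N : ℕ} {H G : Z n → ℂ}

lemma Eqn.smooth (he : Eqn σ w a N H G) (hn : 1 ≤ n) (hσ0 : 0 < σ) (hσ1 : σ < 1) (hw : Wc w)
    (hb : CB (fun z => (a z : ℂ))) {a₀ : ℝ} (ha₀ : 0 < a₀) (h : ∀ z, a₀ ≤ a z) :
    ∃ f : Z n → ℂ, ContDiff ℝ ∞ f ∧ ∀ ψ : Sch n, ip H (𝓕⁻ ψ : Sch n) = ∫ z, f z * ψ z := by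
  obtain ⟨d, hd⟩ := jw_L2 (n := n)
  have h0 := he.X0 hn hσ0 hσ1 hw hb ha₀ h
  have key : ∀ r, Rg r (fun ψ : Sch n => ip H (𝓕⁻ ψ : Sch n)) := by
    intro r
    have := (he.XS (he.Xt hw hb h0) (N + (r + d)) 0).rg hd r
    refine (congrArg (Rg r) ?_).mp this
    funext ψ
    rw [tp_zero]
    congr 2
    ext ζ
    have tg : (fun ζ : Z n => ((Sw Ts 1 ζ ^ (N + (r + d)) : ℝ) : ℂ)).HasTemperateGrowth := by
      have := Sp_tg (n := n) Ts 1 (N + (r + d) : ℕ)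
      unfold Sp at this
      simpa only [Real.rpow_natCast] using this
    rw [mu_apply tg, mu_apply (SJ_tg _), SJ, ← mul_assoc, ← Complex.ofReal_mul,
      mul_inv_cancel₀ (pow_pos (Sw_pos _ _ _) _).ne', Complex.ofReal_one, one_mul]
  choose g hg hb e using key
  have hu : ∀ r, g r = g 0 := fun r => rep_unique (hg r).continuous (hg 0).continuous fun ψ => by rw [← e, ← e]
  refine ⟨g 0, contDiff_infty.2 fun r => ?_, e 0⟩
  rw [← hu r]; exact hg r
end
end KH

namespace KH
open SchwartzMap Function Filter
open scoped FourierTransform LineDeriv ContDiff ComplexConjugate Topology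

section
variable {σ : ℝ} {w : E n → ℝ} {a : Z n → ℝ}

lemma Fn_tg (hw : Wc w) : (fun ζ : Z n => (Fsym σ w (-vC ζ) : ℂ)).HasTemperateGrowth := by
  have h1 : (fun ζ : Z n => -ζ).HasTemperateGrowth := (-ContinuousLinearMap.id ℝ (Z n)).hasTemperateGrowth
  have := (Fz_tg (n := n) σ hw).comp h1
  refine (congrArg _ ?_).mp this
  funext ζ
  have : vC (-ζ) = -vC ζ := by ext i; simp [vC]
  simp [Fz, this]

/-- the transposed operator as a Schwartz function -/
def Pt (σ : ℝ) (w : E n → ℝ) (a : Z n → ℝ) (ψ : Sch n) : Sch n :=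
  -(∂_{(ej it : Z n)} ψ : Sch n) - ∑ i : Fin n, mu (co (iv i)) (∂_{ej (ix i)} ψ : Sch n) +
    𝓕⁻ (mu (fun ζ : Z n => (Fsym σ w (-vC ζ) : ℂ)) (𝓕 (mu (fun z => (a z : ℂ)) ψ) : Sch n))

lemma Pt_coe (hw : Wc w) (hb : CB (fun z => (a z : ℂ))) (ψ : Sch n) : Ptrans σ w a ψ = Pt σ w a ψ := by
  funext z
  rw [Ptrans, Pt, _root_.add_apply, _root_.sub_apply, _root_.neg_apply, _root_.sum_apply]
  congr 1
  · congr 1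
    refine Finset.sum_congr rfl fun i _ => ?_
    rw [mu_apply (co_tg _), lineDerivOp_apply_eq_fderiv]
    rfl
  · rw [fracLapNeg, SchwartzMap.fourierInv_coe]
    have e : (fun z' => (a z' : ℂ) * ψ z') = ⇑(mu (fun z => (a z : ℂ)) ψ) := by
      funext z
      rw [mu_apply hb.tg]
    have e2 : (fun ζ : Z n => (Fsym σ w (-vC ζ) : ℂ) * FourierTransform.fourier (fun z' => (a z' : ℂ) * ψ z') ζ) =
        ⇑(mu (fun ζ : Z n => (Fsym σ w (-vC ζ) : ℂ)) (𝓕 (mu (fun z => (a z : ℂ)) ψ) : Sch n)) := by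
      funext ζ
      rw [mu_apply (Fn_tg hw), SchwartzMap.fourier_coe, e]
    rw [e2]

lemma mu_co_der (i : Fin n) (θ : Sch n) :
    (∂_{ej (iv i)} (mu (co (ix i)) θ) : Sch n) = mu (co (ix i)) (∂_{ej (iv i)} θ : Sch n) := by
  ext z
  have h1 : fderiv ℝ (co (n := n) (ix i)) z (ej (iv i)) = 0 := by
    have hd : Differentiable ℝ (co (n := n) (ix i)) := (co_tg _).1.differentiable (by simp)
    have h1 : HasLineDerivAt ℝ (co (n := n) (ix i)) (fderiv ℝ (co (n := n) (ix i)) z (ej (iv i))) z (ej (iv i)) :=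
      (hd z).hasFDerivAt.hasLineDerivAt _
    have h2 : HasLineDerivAt ℝ (co (n := n) (ix i)) 0 z (ej (iv i)) := by
      unfold HasLineDerivAt
      have : (fun t : ℝ => co (n := n) (ix i) (z + t • ej (iv i))) = fun _ => co (ix i) z := by
        funext t
        simp [co, ej, ix, iv]
      rw [this]
      exact hasDerivAt_const _ _
    exact HasDerivAt.unique h1 h2
  rw [dmul (co_tg _), h1, mu_apply (co_tg _)]; ring

lemma co_fourier (j : Ix n) (g : Sch n) : mu (co j) (𝓕 g : Sch n) = (2 * π * Complex.I : ℂ)⁻¹ • (𝓕 (∂_{ej j} g : Sch n) : Sch n) := by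
  rw [fourier_lineDerivOp_eq, mu_inner, smul_smul, inv_mul_cancel₀ two_pi_I_ne, one_smul]

lemma Pt_inv (hw : Wc w) (θ : Sch n) (ζ : Z n) :
    (𝓕⁻ (Pt σ w a (𝓕 θ : Sch n)) : Sch n) ζ = Xop θ ζ + (Fz σ w ζ : ℂ) * Aop (fun z => (a z : ℂ)) θ ζ := by
  have e1 : ∀ i : Fin n, mu (co (iv i)) (∂_{ej (ix i)} (𝓕 θ : Sch n) : Sch n) =
      (𝓕 (-(mu (co (ix i)) (∂_{ej (iv i)} θ : Sch n))) : Sch n) := by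
    intro i
    rw [lineDerivOp_fourier_eq, mu_inner, co_fourier, LineDeriv.lineDerivOp_smul, mu_co_der,
      FourierTransform.fourier_smul, smul_smul, FourierTransform.fourier_neg, mul_neg, inv_mul_cancel₀ two_pi_I_ne, neg_one_smul]
  have e2 : (∂_{(ej it : Z n)} (𝓕 θ : Sch n) : Sch n) = (𝓕 (-(2 * π * Complex.I : ℂ) • mu (co it) θ) : Sch n) := by
    rw [lineDerivOp_fourier_eq, mu_inner]
  have e3 : Pt σ w a (𝓕 θ : Sch n) = (𝓕 (Xop θ) : Sch n) +
      𝓕⁻ (mu (fun ζ : Z n => (Fsym σ w (-vC ζ) : ℂ)) (𝓕 (mu (fun z => (a z : ℂ)) (𝓕 θ : Sch n)) : Sch n)) := by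
    rw [Pt, e2]
    simp_rw [e1]
    congr 1
    have hL : ∀ φ : Sch n, (𝓕 φ : Sch n) = FourierTransform.fourierCLM ℂ (Sch n) φ := fun φ => rfl
    simp_rw [hL]
    rw [← map_neg, ← map_sum, ← map_sub, Xop_eq]
    congr 1
    rw [Finset.sum_neg_distrib, neg_smul]
    abel
  rw [e3, FourierTransform.fourierInv_add, FourierTransform.fourierInv_fourier_eq, _root_.add_apply]
  congr 1
  set k : Sch n := mu (fun ζ : Z n => (Fsym σ w (-vC ζ) : ℂ)) (𝓕 (mu (fun z => (a z : ℂ)) (𝓕 θ : Sch n)) : Sch n) with hk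
  have e4 : (𝓕⁻ (𝓕⁻ k : Sch n) : Sch n) ζ = k (-ζ) := by
    rw [SchwartzMap.fourierInv_coe, Real.fourierInv_eq_fourier_neg, ← SchwartzMap.fourier_coe,
      FourierTransform.fourier_fourierInv_eq]
  rw [e4, hk, mu_apply (Fn_tg hw), Aop_def]
  have : -vC (-ζ) = vC ζ := by ext i; simp [vC]
  rw [this, Fz, SchwartzMap.fourierInv_coe, Real.fourierInv_eq_fourier_neg, SchwartzMap.fourier_coe]

lemma main_eqn {N : ℕ} {h : Z n → ℂ} (hw : Wc w) (hb : CB (fun z => (a z : ℂ)))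
    (hmeas : AEStronglyMeasurable h volume)
    (huHN : MemLp (fun ζ => (((1 + ‖ζ‖ ^ 2) ^ (-(N : ℝ) / 2) : ℝ) : ℂ) * h ζ) 2 volume)
    (hPu : ∀ r : ℝ, IsHr r (fun ψ : Z n → ℂ => _root_.pairing h (Ptrans σ w a ψ))) :
    ∃ G, Eqn σ w a N (fun ζ => conj (h ζ)) G := by
  have hH : L2f (fun ζ : Z n => (((jw ζ ^ N)⁻¹ : ℝ) : ℂ) * conj (h ζ)) := by
    refine MemLp.of_le huHN ?_ (Eventually.of_forall fun ζ => ?_)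
    · refine AEStronglyMeasurable.mul ?_ (Complex.continuous_conj.comp_aestronglyMeasurable hmeas)
      exact (Complex.continuous_ofReal.comp (Continuous.inv₀ (jw_cont.pow _) fun ζ => (pow_pos (jw_pos ζ) _).ne')).aestronglyMeasurable
    · have p := jw_pos ζ
      have pg := jw_ge ζ
      rw [norm_mul, norm_mul, RCLike.norm_conj, Complex.norm_real, Complex.norm_real]
      refine mul_le_mul_of_nonneg_right ?_ (norm_nonneg _)
      change _ ≤ ‖jw ζ ^ (-(N : ℝ) / 2)‖
      rw [Real.norm_of_nonneg (by positivity), Real.norm_of_nonneg (by positivity), ← Real.rpow_natCast, ← Real.rpow_neg p.le]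
      refine Real.rpow_le_rpow_of_exponent_le pg ?_
      have : (0 : ℝ) ≤ N := Nat.cast_nonneg _
      linarith
  have hT : Tp (fun ζ => conj (h ζ)) := fun θ => by
    refine (hH.ip_int (sL2 (mu (fun ζ : Z n => (jw ζ : ℂ) ^ N) θ))).congr (Eventually.of_forall fun ζ => ?_)
    have p : (jw ζ : ℂ) ≠ 0 := by exact_mod_cast (jw_pos ζ).ne'
    simp only [mu_apply (jwp_tg N), map_mul, Complex.conj_ofReal]
    push_cast
    field_simp
  choose G hG eG using fun k : ℕ => hPu (2 * k)
  have hG1 : ∀ k, L2f (fun ζ => ((jw ζ ^ k : ℝ) : ℂ) * G k ζ) := by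
    intro k
    refine (congrArg L2f ?_).mp (hG k)
    funext ζ
    rw [mul_div_cancel_left₀ _ (two_ne_zero), Real.rpow_natCast]
    rfl
  have hG2 : ∀ k, L2f (G k) := by
    intro k
    have hc : Continuous (fun ζ : Z n => (((jw ζ ^ k)⁻¹ : ℝ) : ℂ)) :=
      Complex.continuous_ofReal.comp (Continuous.inv₀ (jw_cont.pow _) fun ζ => (pow_pos (jw_pos ζ) _).ne')
    have e : G k = fun ζ => (((jw ζ ^ k)⁻¹ : ℝ) : ℂ) * (((jw ζ ^ k : ℝ) : ℂ) * G k ζ) := by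
      funext ζ
      rw [← mul_assoc, ← Complex.ofReal_mul, inv_mul_cancel₀ (pow_pos (jw_pos ζ) _).ne', Complex.ofReal_one, one_mul]
    rw [e]
    refine MemLp.of_le (hG1 k) (hc.aestronglyMeasurable.mul (hG1 k).1) (Eventually.of_forall fun ζ => ?_)
    have p := jw_pos ζ
    rw [norm_mul, Complex.norm_real, Real.norm_of_nonneg (by positivity)]
    exact mul_le_of_le_one_left (norm_nonneg _) (inv_le_one_of_one_le₀ (one_le_pow₀ (jw_ge ζ)))
  have pE : ∀ k (θ : Sch n), _root_.pairing h (Ptrans σ w a (𝓕 θ : Sch n)) = ∫ ζ, G k ζ * θ ζ := by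
    intro k θ
    refine (eG k (𝓕 θ : Sch n)).trans ?_
    rw [_root_.pairing, ← SchwartzMap.fourierInv_coe, FourierTransform.fourierInv_fourier_eq]
  have ae : ∀ k, G k =ᵐ[volume] G 0 := by
    intro k
    refine ae_eq_of_integral_contDiff_smul_eq (μ := volume) ((hG2 k).locallyIntegrable (by norm_num))
      ((hG2 0).locallyIntegrable (by norm_num)) fun φ hφ hc => ?_
    have hg₁ : HasCompactSupport (Complex.ofRealCLM ∘ φ) := hc.comp_left rfl
    have hg₂ : ContDiff ℝ ∞ (Complex.ofRealCLM ∘ φ) := by fun_prop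
    have := (pE k (hg₁.toSchwartzMap hg₂)).symm.trans (pE 0 (hg₁.toSchwartzMap hg₂))
    simpa [mul_comm] using this
  refine ⟨fun ζ => conj (G 0 ζ), hH, fun k => ?_, fun θ => ?_⟩
  · have h1 : L2f (fun ζ => ((jw ζ ^ k : ℝ) : ℂ) * G 0 ζ) := by
      refine (memLp_congr_ae ?_).1 (hG1 k)
      filter_upwards [ae k] with ζ hζ
      rw [hζ]
    refine (congrArg L2f ?_).mp h1.conj
    funext ζ
    simp [map_mul]
  · have h1 := pE 0 θ
    rw [_root_.pairing, Pt_coe hw hb, ← SchwartzMap.fourierInv_coe] at h1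
    simp_rw [Pt_inv hw] at h1
    have hF := TI_F (n := n) (σ := σ) hw
    have i1 := hT (Xop θ)
    have i2 := hT (mu (fun ζ : Z n => (Fz σ w ζ : ℂ)) (Aop (fun z => (a z : ℂ)) θ))
    simp only [Complex.conj_conj, mu_apply hF.1] at i1 i2
    simp_rw [mul_add] at h1
    rw [integral_add i1 i2] at h1
    simp only [ip, Complex.conj_conj, map_mul, Complex.conj_ofReal]
    rw [← h1]
    congr 2
    funext ζ; ring
end
end KH

/-- Corollary 1.2, global form: if `u ∈ H^{-N}` and
`Pu ∈ H^r` for every `r`, then `u` is (given by) a `C^∞` function.  The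
tempered distribution `u` is encoded by its function Fourier transform `h`,
acting on test functions by `ψ ↦ pairing h ψ`; `Pu` acts by
`ψ ↦ ⟨u, P^tψ⟩`. -/
theorem statement2
    (n : ℕ) (hn : 1 ≤ n) (σ : ℝ) (hσ0 : 0 < σ) (hσ1 : σ < 1)
    (w : E n → ℝ) (hw : ContDiff ℝ (⊤ : ℕ∞) w)
    (hw01 : ∀ η, 0 ≤ w η ∧ w η ≤ 1)
    (hwout : ∀ η : E n, 2 ≤ ‖η‖ → w η = 1)
    (hwin : ∀ η : E n, ‖η‖ ≤ 1 → w η = 0)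
    (a : Z n → ℝ) (ha : ContDiff ℝ (⊤ : ℕ∞) a)
    (haB : ∀ k : ℕ, ∃ C : ℝ, ∀ z, ‖iteratedFDeriv ℝ k a z‖ ≤ C)
    (a₀ : ℝ) (ha₀ : 0 < a₀) (haLB : ∀ z, a₀ ≤ a z)
    (N : ℕ)
    -- `u ∈ H^{-N}(ℝ^{2n+1})`, encoded by its Fourier transform `h`
    (h : Z n → ℂ) (hmeas : AEStronglyMeasurable h volume)
    (huHN : MemLp (fun ζ => (((1 + ‖ζ‖ ^ 2) ^ (-(N : ℝ) / 2) : ℝ) : ℂ) * h ζ) 2 volume)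
    -- `Pu ∈ H^r(ℝ^{2n+1})` for every `r ∈ ℝ`
    (hPu : ∀ r : ℝ, IsHr r (fun ψ : Z n → ℂ => pairing h (Ptrans σ w a ψ))) :
    -- `u ∈ C^∞(ℝ^{2n+1})`: the distribution `u` is given by a smooth function
    ∃ f : Z n → ℂ, ContDiff ℝ (⊤ : ℕ∞) f ∧
      ∀ ψ : SchwartzMap (Z n) ℂ, pairing h ⇑ψ = ∫ z : Z n, f z * ψ z := by
  have hwc : KH.Wc w := ⟨hw, hw01, hwout, hwin⟩
  have hb : KH.CB (fun z => (a z : ℂ)) := by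
    refine ⟨Complex.ofRealCLM.contDiff.comp ha, fun k => ?_⟩
    obtain ⟨C, hC⟩ := haB k
    refine ⟨C, fun z => ?_⟩
    have h1 : ‖iteratedFDeriv ℝ k (fun z => (a z : ℂ)) z‖ = ‖iteratedFDeriv ℝ k a z‖ :=
      Complex.ofRealLI.norm_iteratedFDeriv_comp_left (f := a) (x := z) ha.contDiffAt (by exact_mod_cast le_top)
    rw [h1]
    exact hC z
  obtain ⟨G, hG⟩ := KH.main_eqn hwc hb hmeas huHN hPu
  obtain ⟨f, hf, e⟩ := hG.smooth hn hσ0 hσ1 hwc hb ha₀ haLB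
  refine ⟨f, hf, fun ψ => ?_⟩
  rw [← e ψ, pairing, KH.ip, ← SchwartzMap.fourierInv_coe]
  simp only [Complex.conj_conj]
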